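/- arXiv:math/0410476 — 2 statements merged into one kernel-verified Lean document; each statement's English description precedes it below -/
import Mathlib

section
/- Let n ≥ 1 and let f : S^n → S^{n+1} be a continuous map whose set of injectivity I contains the closed metric ball D := {x ∈ S^n : |x − x₀| ≤ r} for some x₀ ∈ S^n and 0 < r < 1. Then there are precisely two connected components of S^{n+1} \ f(S^n) whose closure intersects f(D°), where D° := {x ∈ S^n : |x − x₀| < r} is the interior of D in S^n. -/
/-- `C` is a connected component of the subset `S` of a topological space. -/
def IsConnCompIn {α : Type*} [TopologicalSpace α] (S C : Set α) : Prop :=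
  ∃ x ∈ S, C = connectedComponentIn S x

namespace CubicalDuality

open Set Topology

/-- Mod 2 cubical (co)chains on the index set `ι`: a cell is a vector `c : ι → ℤ`, whose even
coordinates stand for points and whose odd coordinates stand for unit edges. -/
abbrev Chain (ι : Type) := (ι → ℤ) → ZMod 2

/-- The closed cube represented by `c` at the scale `2⁻ᵏ`. -/
def cell {ι : Type} (k : ℕ) (c : ι → ℤ) : Set (ι → ℝ) :=
  {x | ∀ i, |2 ^ k * x i - c i| ≤ ((c i % 2 : ℤ) : ℝ)}

/-- Finitely supported chains of scale `2⁻ᵏ` all of whose cells lie in `U`. -/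
def Ch {ι : Type} (k : ℕ) (U : Set (ι → ℝ)) : AddSubgroup (Chain ι) where
  carrier := {z | (∃ R : ℤ, ∀ c, z c ≠ 0 → ∀ i, |c i| ≤ R) ∧ ∀ c, z c ≠ 0 → cell k c ⊆ U}
  zero_mem' := ⟨⟨0, fun c h => (h rfl).elim⟩, fun c h => (h rfl).elim⟩
  add_mem' := by
    rintro a b ⟨⟨R, hR⟩, ha⟩ ⟨⟨S, hS⟩, hb⟩
    have key : ∀ c, (a + b) c ≠ 0 → a c ≠ 0 ∨ b c ≠ 0 := by
      intro c hc
      by_contra! h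
      exact hc (by simp [h.1, h.2])
    refine ⟨⟨max R S, fun c hc i => ?_⟩, fun c hc => ?_⟩
    · rcases key c hc with h | h
      · exact (hR c h i).trans (le_max_left _ _)
      · exact (hS c h i).trans (le_max_right _ _)
    · rcases key c hc with h | h
      · exact ha c h
      · exact hb c h
  neg_mem' := by
    rintro a ⟨⟨R, hR⟩, ha⟩
    exact ⟨⟨R, fun c hc => hR c (by simpa using hc)⟩, fun c hc => ha c (by simpa using hc)⟩

/-- The part of the boundary operator in the direction `i`. -/
def bdAt {ι : Type} [DecidableEq ι] (i : ι) : Chain ι →+ Chain ι where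
  toFun z d := if d i % 2 = 0 then
    z (Function.update d i (d i - 1)) + z (Function.update d i (d i + 1)) else 0
  map_zero' := by ext d; simp
  map_add' a b := by
    ext d
    simp only [Pi.add_apply]
    split_ifs
    · abel
    · simp

/-- The cubical boundary operator. -/
def bd {ι : Type} [DecidableEq ι] [Fintype ι] : Chain ι →+ Chain ι := ∑ i, bdAt i

/-- The cell of the coarser grid whose interior contains the interior of the cell `d`. -/
def par {ι : Type} (d : ι → ℤ) : ι → ℤ :=
  fun i => if d i % 2 = 0 then d i / 2 else 2 * (d i / 4) + 1

/-- Subdivision of chains, from the scale `2⁻ᵏ` to the scale `2⁻ᵏ⁻¹`. -/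
noncomputable def sdv {ι : Type} : Chain ι →+ Chain ι where
  toFun z d := open Classical in if ∀ i, d i % 4 ≠ 2 then z (par d) else 0
  map_zero' := by ext d; simp
  map_add' a b := by
    ext d
    simp only [Pi.add_apply]
    split_ifs <;> simp

/-- The points outside of a closed cube. -/
def outer (ι : Type) (M : ℝ) : Set (ι → ℝ) := {x | ∃ i, M < |x i|}

/-- Chains all of whose cells have dimension `d`. -/
def Deg {ι : Type} [Fintype ι] (d : ℤ) (z : Chain ι) : Prop :=
  ∀ c, z c ≠ 0 → ∑ i, c i % 2 = d

variable {ι : Type}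

theorem zmod_two_add_self (a : ZMod 2) : a + a = 0 := CharTwo.add_self_eq_zero a

theorem bdAt_apply [DecidableEq ι] (i : ι) (z : Chain ι) (d : ι → ℤ) :
    bdAt i z d = if d i % 2 = 0 then
      z (Function.update d i (d i - 1)) + z (Function.update d i (d i + 1)) else 0 := rfl

theorem bd_apply [DecidableEq ι] [Fintype ι] (z : Chain ι) (d : ι → ℤ) :
    bd z d = ∑ i, bdAt i z d := by
  simp [bd]

theorem sdv_apply (z : Chain ι) (d : ι → ℤ) [Decidable (∀ i, d i % 4 ≠ 2)] :
    sdv z d = if ∀ i, d i % 4 ≠ 2 then z (par d) else 0 := by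
  simp only [sdv, AddMonoidHom.coe_mk, ZeroHom.coe_mk]
  congr

theorem bdAt_self [DecidableEq ι] (i : ι) (z : Chain ι) : bdAt i (bdAt i z) = 0 := by
  ext d
  by_cases h : d i % 2 = 0
  · have h1 : ¬ (d i - 1) % 2 = 0 := by omega
    have h2 : ¬ (d i + 1) % 2 = 0 := by omega
    simp [bdAt_apply, h1, h2]
  · simp [bdAt_apply, h]

theorem bdAt_comm [DecidableEq ι] {i j : ι} (hij : i ≠ j) (z : Chain ι) :
    bdAt i (bdAt j z) = bdAt j (bdAt i z) := by
  ext d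
  simp only [bdAt_apply, Function.update_of_ne hij, Function.update_of_ne hij.symm]
  split_ifs
  · simp only [Function.update_comm hij]
    abel
  all_goals simp

theorem bd_bd [DecidableEq ι] [Fintype ι] (z : Chain ι) : bd (bd z) = 0 := by
  have h : bd (bd z) = ∑ p : ι × ι, bdAt p.1 (bdAt p.2 z) := by
    simp only [bd, AddMonoidHom.finsetSum_apply, map_sum, Fintype.sum_prod_type]
    exact Finset.sum_comm
  rw [h]
  refine Finset.sum_involution (fun p _ => p.swap) ?_ ?_ ?_ ?_
  · rintro ⟨i, j⟩ -
    by_cases hij : i = j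
    · subst hij; simp [bdAt_self]
    · simp only [Prod.swap_prod_mk]
      rw [bdAt_comm hij]
      exact ZModModule.add_self _
  · rintro ⟨i, j⟩ - h h'
    simp only [Prod.swap_prod_mk, Prod.mk.injEq] at h'
    obtain rfl := h'.1
    simp [bdAt_self] at h
  · simp
  · simp

theorem par_update [DecidableEq ι] (d : ι → ℤ) (i : ι) (a : ℤ) :
    par (Function.update d i a) =
      Function.update (par d) i (if a % 2 = 0 then a / 2 else 2 * (a / 4) + 1) := by
  ext j
  by_cases h : j = i
  · subst h; simp [par]
  · simp [par, h]

theorem bdAt_sdv [DecidableEq ι] (i : ι) (z : Chain ι) : bdAt i (sdv z) = sdv (bdAt i z) := by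
  classical
  ext d
  by_cases hv : ∀ j, j ≠ i → d j % 4 ≠ 2
  · have hvu : ∀ a, (∀ j, Function.update d i a j % 4 ≠ 2) ↔ a % 4 ≠ 2 := by
      intro a
      constructor
      · intro h; simpa using h i
      · intro h j
        by_cases hj : j = i
        · subst hj; simpa using h
        · simpa [hj] using hv j hj
    have hvd : (∀ j, d j % 4 ≠ 2) ↔ d i % 4 ≠ 2 := by
      simpa using hvu (d i)
    simp only [bdAt_apply, sdv_apply, hvu, hvd, par_update]
    by_cases he : d i % 2 = 0
    · have h1 : ¬ (d i - 1) % 2 = 0 := by omega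
      have h2 : ¬ (d i + 1) % 2 = 0 := by omega
      have h3 : (d i - 1) % 4 ≠ 2 := by omega
      have h4 : (d i + 1) % 4 ≠ 2 := by omega
      simp only [he, h1, h2, h3, h4, ne_eq, not_false_eq_true, if_true, if_false]
      by_cases h5 : d i % 4 = 2
      · have : (d i - 1) / 4 = (d i + 1) / 4 := by omega
        simp [h5, this, zmod_two_add_self]
      · have hp : par d i = d i / 2 := by simp [par, he]
        have h6 : 2 * ((d i - 1) / 4) + 1 = par d i - 1 := by omega
        have h7 : 2 * ((d i + 1) / 4) + 1 = par d i + 1 := by omega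
        have h8 : par d i % 2 = 0 := by omega
        simp [h5, h6, h7, h8]
    · have hp : par d i = 2 * (d i / 4) + 1 := by simp [par, he]
      have h8 : ¬ par d i % 2 = 0 := by omega
      simp [he, h8]
  · push Not at hv
    obtain ⟨j, hj, hj2⟩ := hv
    have h : ∀ a, ¬ ∀ l, Function.update d i a l % 4 ≠ 2 := by
      intro a h
      exact h j (by simpa [hj] using hj2)
    have h' : ¬ ∀ l, d l % 4 ≠ 2 := fun h => h j hj2
    simp only [bdAt_apply, sdv_apply, if_neg (h _), if_neg h']
    simp

theorem bd_sdv [DecidableEq ι] [Fintype ι] (z : Chain ι) : bd (sdv z) = sdv (bd z) := by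
  simp [bd, bdAt_sdv]

theorem bd_sdv_iterate [DecidableEq ι] [Fintype ι] (j : ℕ) (z : Chain ι) :
    bd (sdv^[j] z) = sdv^[j] (bd z) := by
  induction j generalizing z with
  | zero => rfl
  | succ j ih => simp only [Function.iterate_succ_apply]; rw [ih, bd_sdv]

theorem Ch_mono {k : ℕ} {U V : Set (ι → ℝ)} (h : U ⊆ V) : Ch k U ≤ Ch k V :=
  fun _ hz => ⟨hz.1, fun c hc => (hz.2 c hc).trans h⟩

theorem mem_Ch_inter {k : ℕ} {U V : Set (ι → ℝ)} {z : Chain ι} (hU : z ∈ Ch k U)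
    (hV : z ∈ Ch k V) : z ∈ Ch k (U ∩ V) :=
  ⟨hU.1, fun c hc => subset_inter (hU.2 c hc) (hV.2 c hc)⟩

theorem cell_update_subset [DecidableEq ι] (k : ℕ) (d : ι → ℤ) (i : ι) (h : d i % 2 = 0) (a : ℤ)
    (ha : a = d i - 1 ∨ a = d i + 1) : cell k d ⊆ cell k (Function.update d i a) := by
  intro x hx j
  by_cases hj : j = i
  · subst hj
    have h1 := hx j
    have h2 : a % 2 = 1 := by omega
    simp only [h, Int.cast_zero, abs_nonpos_iff] at h1
    simp only [Function.update_self, h2]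
    rw [abs_le]
    rcases ha with rfl | rfl <;> push_cast <;> constructor <;> linarith
  · simpa [hj] using hx j

theorem exists_of_bdAt_ne_zero [DecidableEq ι] {i : ι} {z : Chain ι} {d : ι → ℤ}
    (h : bdAt i z d ≠ 0) :
    d i % 2 = 0 ∧ ∃ a, (a = d i - 1 ∨ a = d i + 1) ∧ z (Function.update d i a) ≠ 0 := by
  rw [bdAt_apply] at h
  split_ifs at h with he
  · refine ⟨he, ?_⟩
    by_contra! hc
    exact h (by rw [hc _ (Or.inl rfl), hc _ (Or.inr rfl), add_zero])
  · exact (h rfl).elim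

theorem bdAt_mem [DecidableEq ι] {k : ℕ} {U : Set (ι → ℝ)} {z : Chain ι} (i : ι)
    (hz : z ∈ Ch k U) : bdAt i z ∈ Ch k U := by
  obtain ⟨⟨R, hR⟩, hU⟩ := hz
  refine ⟨⟨R + 1, fun c hc j => ?_⟩, fun c hc => ?_⟩
  · obtain ⟨he, a, ha, hza⟩ := exists_of_bdAt_ne_zero hc
    have := hR _ hza j
    by_cases hj : j = i
    · subst hj
      simp only [Function.update_self, abs_le] at this ⊢
      omega
    · simp only [Function.update_of_ne hj, abs_le] at this ⊢
      omega
  · obtain ⟨he, a, ha, hza⟩ := exists_of_bdAt_ne_zero hc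
    exact (cell_update_subset k c i he a ha).trans (hU _ hza)

theorem bd_mem [DecidableEq ι] [Fintype ι] {k : ℕ} {U : Set (ι → ℝ)} {z : Chain ι}
    (hz : z ∈ Ch k U) : bd z ∈ Ch k U := by
  simp only [bd, AddMonoidHom.finsetSum_apply]
  exact sum_mem fun i _ => bdAt_mem i hz

theorem cell_subset_par (k : ℕ) (d : ι → ℤ) (h : ∀ i, d i % 4 ≠ 2) :
    cell (k + 1) d ⊆ cell k (par d) := by
  intro x hx i
  have h1 := hx i
  have h4 := h i
  rw [abs_le] at h1 ⊢
  by_cases he : d i % 2 = 0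
  · have hp : d i = 2 * par d i := by simp only [par, he, if_true]; omega
    have hp2 : par d i % 2 = 0 := by omega
    rw [he, hp] at h1
    rw [hp2]
    rw [pow_succ] at h1
    push_cast at h1 ⊢
    constructor <;> linarith [h1.1, h1.2]
  · have he1 : d i % 2 = 1 := by omega
    have hp2 : par d i % 2 = 1 := by simp only [par, he, if_false]; omega
    have hp : d i = 2 * par d i - 1 ∨ d i = 2 * par d i + 1 := by
      simp only [par, he, if_false]; omega
    rw [he1] at h1
    rw [hp2]
    rw [pow_succ] at h1
    rcases hp with hp | hp <;> rw [hp] at h1 <;> push_cast at h1 ⊢ <;>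
    constructor <;> linarith [h1.1, h1.2]

theorem of_sdv_ne_zero {z : Chain ι} {d : ι → ℤ} (h : sdv z d ≠ 0) :
    (∀ i, d i % 4 ≠ 2) ∧ z (par d) ≠ 0 := by
  classical
  rw [sdv_apply] at h
  split_ifs at h with hv
  · exact ⟨hv, h⟩
  · exact (h rfl).elim

theorem sdv_mem {k : ℕ} {U : Set (ι → ℝ)} {z : Chain ι} (hz : z ∈ Ch k U) :
    sdv z ∈ Ch (k + 1) U := by
  obtain ⟨⟨R, hR⟩, hU⟩ := hz
  refine ⟨⟨2 * R + 2, fun c hc j => ?_⟩, fun c hc => ?_⟩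
  · have := hR _ (of_sdv_ne_zero hc).2 j
    simp only [par] at this
    rw [abs_le] at this ⊢
    split_ifs at this <;> omega
  · exact (cell_subset_par k c (of_sdv_ne_zero hc).1).trans (hU _ (of_sdv_ne_zero hc).2)

theorem sdv_iterate_mem {k : ℕ} {U : Set (ι → ℝ)} {z : Chain ι} (j : ℕ) (hz : z ∈ Ch k U) :
    sdv^[j] z ∈ Ch (k + j) U := by
  induction j with
  | zero => exact hz
  | succ j ih => rw [Function.iterate_succ_apply']; exact sdv_mem ih

theorem Deg.subdivide [Fintype ι] {d : ℤ} {z : Chain ι} (h : Deg d z) : Deg d (sdv z) := by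
  intro c hc
  rw [← h _ (of_sdv_ne_zero hc).2]
  refine Finset.sum_congr rfl fun i _ => ?_
  have := (of_sdv_ne_zero hc).1 i
  simp only [par]
  split_ifs <;> omega

theorem Deg.sdv_iterate [Fintype ι] {d : ℤ} {z : Chain ι} (h : Deg d z) (j : ℕ) :
    Deg d (sdv^[j] z) := by
  induction j with
  | zero => exact h
  | succ j ih => rw [Function.iterate_succ_apply']; exact ih.subdivide

theorem Deg.bd [DecidableEq ι] [Fintype ι] {d : ℤ} {z : Chain ι} (h : Deg d z) :
    Deg (d - 1) (bd z) := by
  intro c hc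
  rw [bd_apply] at hc
  obtain ⟨i, -, hi⟩ := Finset.exists_ne_zero_of_sum_ne_zero hc
  obtain ⟨he, a, ha, hza⟩ := exists_of_bdAt_ne_zero hi
  have h1 := h _ hza
  rw [← Finset.add_sum_erase _ _ (Finset.mem_univ i)] at h1 ⊢
  have h2 : ∑ j ∈ Finset.univ.erase i, Function.update c i a j % 2
      = ∑ j ∈ Finset.univ.erase i, c j % 2 :=
    Finset.sum_congr rfl fun j hj => by rw [Function.update_of_ne (Finset.ne_of_mem_erase hj)]
  rw [h2, Function.update_self] at h1
  omega

theorem Deg.mono [Fintype ι] {d : ℤ} {z y : Chain ι} (h : Deg d z)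
    (hy : ∀ c, y c ≠ 0 → z c ≠ 0) : Deg d y := fun c hc => h c (hy c hc)

/-- A chain each of whose cells lies in `P` or in `Q` is a sum of a chain in `P` and one in `Q`. -/
theorem exists_split {k : ℕ} {U P Q : Set (ι → ℝ)} {w : Chain ι} (hw : w ∈ Ch k U)
    (h : ∀ c, w c ≠ 0 → cell k c ⊆ P ∨ cell k c ⊆ Q) :
    ∃ y ∈ Ch k (U ∩ P), w - y ∈ Ch k (U ∩ Q) ∧ (∀ c, y c ≠ 0 → w c ≠ 0) := by
  classical
  refine ⟨fun c => if cell k c ⊆ P then w c else 0, ⟨?_, ?_⟩, ⟨?_, ?_⟩, ?_⟩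
  · obtain ⟨R, hR⟩ := hw.1
    refine ⟨R, fun c hc => hR c ?_⟩
    dsimp only at hc
    split_ifs at hc
    · exact hc
    · exact (hc rfl).elim
  · intro c hc
    dsimp only at hc
    split_ifs at hc with h1
    · exact subset_inter (hw.2 c hc) h1
    · exact (hc rfl).elim
  · obtain ⟨R, hR⟩ := hw.1
    refine ⟨R, fun c hc => hR c ?_⟩
    simp only [Pi.sub_apply] at hc
    split_ifs at hc
    · simp at hc
    · simpa using hc
  · intro c hc
    simp only [Pi.sub_apply] at hc
    split_ifs at hc with h1
    · simp at hc
    · have hc : w c ≠ 0 := by simpa using hc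
      exact subset_inter (hw.2 c hc) ((h c hc).resolve_left h1)
  · intro c hc
    dsimp only at hc
    split_ifs at hc
    · exact hc
    · exact (hc rfl).elim

theorem exists_inter_split {k : ℕ} {U V W : Set (ι → ℝ)} {w b : Chain ι} (hw : w ∈ Ch k U)
    (hb : b ∈ Ch k W) (hwb : w - b ∈ Ch k V) :
    ∃ y ∈ Ch k (U ∩ W), w - y ∈ Ch k V ∧ (∀ c, y c ≠ 0 → w c ≠ 0) := by
  obtain ⟨y, hy, hy2, hy3⟩ := exists_split (P := W) (Q := V) hw (fun c hc => by
    by_cases h : b c = 0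
    · exact Or.inr (hwb.2 c (by simpa [h] using hc))
    · exact Or.inl (hb.2 c h))
  exact ⟨y, hy, Ch_mono inter_subset_right hy2, hy3⟩

end CubicalDuality

namespace CubicalDuality

open Set Topology

variable {ι : Type}

theorem cell_eq_Icc (k : ℕ) (c : ι → ℤ) :
    cell k c = Icc (fun i => ((c i : ℝ) - ((c i % 2 : ℤ) : ℝ)) / 2 ^ k)
      (fun i => ((c i : ℝ) + ((c i % 2 : ℤ) : ℝ)) / 2 ^ k) := by
  ext x
  simp only [cell, mem_ofPred_eq, mem_Icc, Pi.le_def, ← forall_and]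
  refine forall_congr' fun i => ?_
  have h2 : (0 : ℝ) < 2 ^ k := by positivity
  rw [abs_le, div_le_iff₀ h2, le_div_iff₀ h2]
  constructor <;> rintro ⟨h, h'⟩ <;> constructor <;> linarith

theorem isCompact_cell (k : ℕ) (c : ι → ℤ) : IsCompact (cell k c) := by
  rw [cell_eq_Icc]; exact isCompact_Icc

theorem convex_cell (k : ℕ) (c : ι → ℤ) : Convex ℝ (cell k c) := by
  rw [cell_eq_Icc]; exact convex_Icc _ _

theorem isPreconnected_cell (k : ℕ) (c : ι → ℤ) : IsPreconnected (cell k c) :=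
  (convex_cell k c).isPreconnected

/-- The centre of a cell. -/
noncomputable def pt (k : ℕ) (c : ι → ℤ) : ι → ℝ := fun i => c i / 2 ^ k

theorem pt_mem_cell (k : ℕ) (c : ι → ℤ) : pt k c ∈ cell k c := by
  intro i
  have h2 : (2 : ℝ) ^ k ≠ 0 := by positivity
  have h : 2 ^ k * pt k c i - c i = 0 := by simp only [pt]; field_simp; ring
  rw [h, abs_zero]
  exact_mod_cast Int.emod_nonneg _ (by norm_num)

theorem dist_le_of_mem_cell [Fintype ι] {k : ℕ} {c : ι → ℤ} {x y : ι → ℝ} (hx : x ∈ cell k c)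
    (hy : y ∈ cell k c) : dist x y ≤ 2 / 2 ^ k := by
  have h2 : (0 : ℝ) < 2 ^ k := by positivity
  refine (dist_pi_le_iff (by positivity)).2 fun i => ?_
  have hx := abs_le.1 (hx i)
  have hy := abs_le.1 (hy i)
  have h : ((c i % 2 : ℤ) : ℝ) ≤ 1 := by
    exact_mod_cast Int.lt_add_one_iff.1 (Int.emod_lt_of_pos _ (by norm_num))
  rw [Real.dist_eq, abs_le, le_div_iff₀ h2, neg_le, ← sub_nonneg]
  constructor
  · rw [sub_nonneg, le_div_iff₀ h2]; nlinarith
  · nlinarith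

theorem finite_support {k : ℕ} [Finite ι] {U : Set (ι → ℝ)} {z : Chain ι} (hz : z ∈ Ch k U) :
    z.support.Finite := by
  have := Fintype.ofFinite ι
  classical
  obtain ⟨R, hR⟩ := hz.1
  refine (Set.finite_Icc (fun _ : ι => -R) (fun _ => R)).subset fun c hc => ?_
  have := hR c hc
  exact ⟨fun i => (abs_le.1 (this i)).1, fun i => (abs_le.1 (this i)).2⟩

/-- The union of the cells of a chain. -/
def carrier (k : ℕ) (z : Chain ι) : Set (ι → ℝ) := ⋃ c ∈ z.support, cell k c

theorem mem_Ch_carrier {k : ℕ} {U : Set (ι → ℝ)} {z : Chain ι} (hz : z ∈ Ch k U) :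
    z ∈ Ch k (carrier k z) :=
  ⟨hz.1, fun _ hc => subset_biUnion_of_mem (u := fun c => cell k c) hc⟩

theorem carrier_subset {k : ℕ} {U : Set (ι → ℝ)} {z : Chain ι} (hz : z ∈ Ch k U) :
    carrier k z ⊆ U := iUnion₂_subset fun c hc => hz.2 c hc

theorem isCompact_carrier [Finite ι] {k : ℕ} {U : Set (ι → ℝ)} {z : Chain ι} (hz : z ∈ Ch k U) :
    IsCompact (carrier k z) :=
  (finite_support hz).isCompact_biUnion fun c _ => isCompact_cell k c

theorem exists_iterate_small [Fintype ι] {k : ℕ} {U₁ U₂ : Set (ι → ℝ)} (h₁ : IsOpen U₁)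
    (h₂ : IsOpen U₂) {z : Chain ι} (hz : z ∈ Ch k (U₁ ∪ U₂)) :
    ∃ j, ∀ c, (sdv^[j] z) c ≠ 0 → cell (k + j) c ⊆ U₁ ∨ cell (k + j) c ⊆ U₂ := by
  obtain ⟨δ, hδ, hL⟩ := lebesgue_number_lemma_of_metric (c := fun b : Bool => cond b U₁ U₂)
    (isCompact_carrier hz) (by rintro (_ | _) <;> assumption)
    ((carrier_subset hz).trans (by rw [union_eq_iUnion]))
  obtain ⟨j, hj⟩ := exists_pow_lt_of_lt_one (half_pos hδ) (by norm_num : (1 / 2 : ℝ) < 1)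
  refine ⟨j, fun c hc => ?_⟩
  have hp := (sdv_iterate_mem j (mem_Ch_carrier hz)).2 c hc (pt_mem_cell _ _)
  have hb : cell (k + j) c ⊆ Metric.ball (pt (k + j) c) δ := by
    intro x hx
    refine (dist_le_of_mem_cell hx (pt_mem_cell _ _)).trans_lt ?_
    have h3 : (2 : ℝ) / 2 ^ (k + j) ≤ 2 * (1 / 2) ^ j := by
      rw [one_div, inv_pow, ← div_eq_mul_inv]
      gcongr
      · norm_num
      · omega
    linarith
  obtain ⟨b, hb2⟩ := hL _ hp
  cases b
  · exact Or.inr (hb.trans hb2)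
  · exact Or.inl (hb.trans hb2)

section Homology
variable [Fintype ι] [DecidableEq ι]

/-- After subdivision, the chain `z` of scale `2⁻ᵏ` is the boundary of a chain in `U`, up to a
chain in `V`. -/
def Bds (V : Set (ι → ℝ)) (k : ℕ) (U : Set (ι → ℝ)) (z : Chain ι) : Prop :=
  ∃ j, ∃ c ∈ Ch (k + j) U, sdv^[j] z - bd c ∈ Ch (k + j) V

/-- The mod 2 homology of `U` relative to `V` vanishes. -/
def Acyc (V U : Set (ι → ℝ)) : Prop := ∀ k, ∀ z ∈ Ch k U, bd z ∈ Ch k V → Bds V k U z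

/-- The mod 2 homology of `U` relative to `V` has total dimension at most one. -/
def AtMostOne (V U : Set (ι → ℝ)) : Prop := ∀ k, ∀ z ∈ Ch k U, ∀ z' ∈ Ch k U,
  bd z ∈ Ch k V → bd z' ∈ Ch k V → Bds V k U z ∨ Bds V k U z' ∨ Bds V k U (z - z')

variable {V U U₁ U₂ : Set (ι → ℝ)} {k : ℕ} {z w : Chain ι}

theorem Bds.of_iterate {i : ℕ} (h : Bds V (k + i) U (sdv^[i] z)) : Bds V k U z := by
  obtain ⟨j, c, hc, h⟩ := h
  rw [add_assoc, ← Function.iterate_add_apply] at h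
  rw [add_assoc] at hc
  rw [add_comm j i] at h
  exact ⟨i + j, c, hc, h⟩

theorem Bds.exists_forall (h : Bds V k U z) :
    ∃ j₀, ∀ j ≥ j₀, ∃ c ∈ Ch (k + j) U, sdv^[j] z - bd c ∈ Ch (k + j) V := by
  obtain ⟨j, c, hc, h⟩ := h
  refine ⟨j, fun j' hj => ?_⟩
  obtain ⟨i, rfl⟩ := Nat.exists_eq_add_of_le hj
  refine ⟨sdv^[i] c, ?_, ?_⟩
  · rw [← add_assoc]; exact sdv_iterate_mem i hc
  · rw [bd_sdv_iterate, add_comm j i, Function.iterate_add_apply, ← iterate_map_sub, add_comm i j,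
      ← add_assoc]
    exact sdv_iterate_mem i h

theorem Bds.add (hz : Bds V k U z) (hw : Bds V k U w) : Bds V k U (z + w) := by
  obtain ⟨j, h⟩ := hz.exists_forall
  obtain ⟨j', h'⟩ := hw.exists_forall
  obtain ⟨c, hc, h⟩ := h (max j j') (le_max_left _ _)
  obtain ⟨c', hc', h'⟩ := h' (max j j') (le_max_right _ _)
  refine ⟨max j j', c + c', add_mem hc hc', ?_⟩
  rw [iterate_map_add, map_add, add_sub_add_comm]
  exact add_mem h h'

theorem Bds.neg (hz : Bds V k U z) : Bds V k U (-z) := by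
  obtain ⟨j, c, hc, h⟩ := hz
  refine ⟨j, -c, neg_mem hc, ?_⟩
  rw [iterate_map_neg, map_neg, ← neg_sub']
  exact neg_mem h

theorem Bds.mono (h : Bds V k U₁ z) (hU : U₁ ⊆ U₂) : Bds V k U₂ z := by
  obtain ⟨j, c, hc, h⟩ := h
  exact ⟨j, c, Ch_mono hU hc, h⟩

theorem Bds.of_mem (h : z ∈ Ch k V) : Bds V k U z :=
  ⟨0, 0, zero_mem _, by simpa using h⟩

theorem Bds.zero : Bds V k U 0 := .of_mem (zero_mem _)

theorem Bds.of_bd {c : Chain ι} (hc : c ∈ Ch k U) (h : z - bd c ∈ Ch k V) : Bds V k U z :=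
  ⟨0, c, hc, h⟩

/-- The connecting homomorphism of the Mayer-Vietoris sequence. -/
theorem exists_connecting (h₁ : IsOpen U₁) (h₂ : IsOpen U₂)
    (a₁ : ∀ k, ∀ z ∈ Ch k U₁, bd z ∈ Ch k V → Bds V k (U₁ ∪ U₂) z)
    (a₂ : ∀ k, ∀ z ∈ Ch k U₂, bd z ∈ Ch k V → Bds V k (U₁ ∪ U₂) z)
    (hw : w ∈ Ch k (U₁ ∪ U₂)) (hw' : bd w ∈ Ch k V) :
    ∃ j, ∃ z ∈ Ch (k + j) (U₁ ∩ U₂), bd z ∈ Ch (k + j) V ∧ (∀ d, Deg d w → Deg (d - 1) z) ∧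
      Bds V (k + j) U₁ z ∧ (Bds V (k + j) (U₁ ∩ U₂) z → Bds V k (U₁ ∪ U₂) w) := by
  obtain ⟨j, hj⟩ := exists_iterate_small h₁ h₂ hw
  obtain ⟨a, ha, hb, hs⟩ := exists_split (sdv_iterate_mem j hw) hj
  have ha := Ch_mono inter_subset_right ha
  have hb := Ch_mono inter_subset_right hb
  set b := sdv^[j] w - a with hbdef
  have hab : bd a + bd b ∈ Ch (k + j) V := by
    rw [← map_add, hbdef, add_sub_cancel, bd_sdv_iterate]
    exact sdv_iterate_mem j hw'
  obtain ⟨z, hz, hz2, hz3⟩ := exists_inter_split (V := V) (bd_mem ha) (neg_mem (bd_mem hb))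
    (by rwa [sub_neg_eq_add])
  have hzV : bd z ∈ Ch (k + j) V := by
    have := bd_mem hz2
    rw [map_sub, bd_bd, zero_sub] at this
    exact neg_mem_iff.1 this
  refine ⟨j, z, hz, hzV, ?_, ?_, ?_⟩
  · intro d hd
    exact (((hd.sdv_iterate j).mono hs).bd).mono hz3
  · exact .of_bd ha (by rw [← neg_sub]; exact neg_mem hz2)
  · rintro ⟨i, e, he, hze⟩
    apply Bds.of_iterate (i := j)
    apply Bds.of_iterate (i := i)
    have hz2' := sdv_iterate_mem i hz2
    rw [iterate_map_sub] at hz2'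
    have e₁ := a₁ _ (sdv^[i] a - e)
      (sub_mem (sdv_iterate_mem i ha) (Ch_mono inter_subset_left he)) (by
        rw [map_sub, bd_sdv_iterate]
        have := add_mem hz2' hze
        rwa [sub_add_sub_cancel] at this)
    have e₂ := a₂ _ (sdv^[i] b + e)
      (add_mem (sdv_iterate_mem i hb) (Ch_mono inter_subset_right he)) (by
        rw [map_add, bd_sdv_iterate]
        have := sub_mem (sdv_iterate_mem i hab) (add_mem hz2' hze)
        rw [sub_add_sub_cancel, iterate_map_add] at this
        convert this using 1
        abel)
    have := e₁.add e₂
    convert this using 1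
    rw [hbdef, iterate_map_sub]
    abel

theorem Acyc.union (h₁ : IsOpen U₁) (h₂ : IsOpen U₂) (a₁ : Acyc V U₁) (a₂ : Acyc V U₂)
    (a : Acyc V (U₁ ∩ U₂)) : Acyc V (U₁ ∪ U₂) := by
  intro k w hw hw'
  obtain ⟨j, z, hz, hbz, -, -, h⟩ := exists_connecting h₁ h₂
    (fun k z hz hz' => (a₁ k z hz hz').mono subset_union_left)
    (fun k z hz hz' => (a₂ k z hz hz').mono subset_union_right) hw hw'
  exact h (a _ z hz hbz)

/-- Exactness of the Mayer-Vietoris sequence at the homology of the intersection. -/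
theorem Bds.inter (h₁ : IsOpen U₁) (h₂ : IsOpen U₂) {a b : Chain ι}
    (ha : a ∈ Ch k U₁) (hb : b ∈ Ch k U₂) (hza : z - bd a ∈ Ch k V)
    (h : Bds V k (U₁ ∪ U₂) (a - b)) : Bds V k (U₁ ∩ U₂) z := by
  obtain ⟨j, c, hc, h⟩ := h
  obtain ⟨i, hi⟩ := exists_iterate_small h₁ h₂ hc
  obtain ⟨c₁, hc₁, hc₂, -⟩ := exists_split (sdv_iterate_mem i hc) hi
  have hc₁ := Ch_mono inter_subset_right hc₁
  have hc₂ := Ch_mono inter_subset_right hc₂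
  set c₂ := sdv^[i] c - c₁ with hc₂def
  have h' := sdv_iterate_mem i h
  apply Bds.of_iterate (i := j)
  apply Bds.of_iterate (i := i)
  obtain ⟨y, hy, hy2, -⟩ := exists_inter_split (V := V)
    (sub_mem (sdv_iterate_mem i (sdv_iterate_mem j ha)) (bd_mem hc₁))
    (add_mem (sdv_iterate_mem i (sdv_iterate_mem j hb)) (bd_mem hc₂)) (by
      convert h' using 1
      rw [iterate_map_sub sdv j, iterate_map_sub sdv i, iterate_map_sub sdv i, hc₂def, map_sub,
        bd_sdv_iterate]
      abel)
  refine .of_bd hy ?_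
  have h3 := bd_mem hy2
  rw [map_sub, map_sub, bd_bd, sub_zero, bd_sdv_iterate, bd_sdv_iterate] at h3
  have h4 := sdv_iterate_mem i (sdv_iterate_mem j hza)
  rw [iterate_map_sub, iterate_map_sub] at h4
  have := add_mem h4 h3
  rwa [sub_add_sub_cancel] at this

theorem AtMostOne.bds_inter (h₁ : IsOpen U₁) (h₂ : IsOpen U₂) (h : AtMostOne V (U₁ ∪ U₂))
    {z' : Chain ι} (h₁z : Bds V k U₁ z) (h₂z : Bds V k U₂ z) (h₁z' : Bds V k U₁ z')
    (h₂z' : Bds V k U₂ z') :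
    Bds V k (U₁ ∩ U₂) z ∨ Bds V k (U₁ ∩ U₂) z' ∨ Bds V k (U₁ ∩ U₂) (z - z') := by
  obtain ⟨j₁, h₁z⟩ := h₁z.exists_forall
  obtain ⟨j₂, h₂z⟩ := h₂z.exists_forall
  obtain ⟨j₃, h₁z'⟩ := h₁z'.exists_forall
  obtain ⟨j₄, h₂z'⟩ := h₂z'.exists_forall
  set j := j₁ + j₂ + j₃ + j₄
  obtain ⟨a, ha, hza⟩ := h₁z j (by omega)
  obtain ⟨b, hb, hzb⟩ := h₂z j (by omega)
  obtain ⟨a', ha', hza'⟩ := h₁z' j (by omega)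
  obtain ⟨b', hb', hzb'⟩ := h₂z' j (by omega)
  have hab : bd (a - b) ∈ Ch (k + j) V := by
    have := sub_mem hzb hza
    rwa [sub_sub_sub_cancel_left, ← map_sub] at this
  have hab' : bd (a' - b') ∈ Ch (k + j) V := by
    have := sub_mem hzb' hza'
    rwa [sub_sub_sub_cancel_left, ← map_sub] at this
  rcases h _ (a - b) (sub_mem (Ch_mono subset_union_left ha) (Ch_mono subset_union_right hb))
    (a' - b') (sub_mem (Ch_mono subset_union_left ha') (Ch_mono subset_union_right hb')) hab hab'
    with h | h | h
  · exact Or.inl (.of_iterate (.inter h₁ h₂ ha hb hza h))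
  · exact Or.inr (Or.inl (.of_iterate (.inter h₁ h₂ ha' hb' hza' h)))
  · refine Or.inr (Or.inr (.of_iterate (i := j) (.inter h₁ h₂ (sub_mem ha ha') (sub_mem hb hb')
      ?_ ?_)))
    · have := sub_mem hza hza'
      rwa [sub_sub_sub_comm, ← map_sub, ← iterate_map_sub] at this
    · rwa [sub_sub_sub_comm]

theorem AtMostOne.inter (h₁ : IsOpen U₁) (h₂ : IsOpen U₂) (a₁ : Acyc V U₁) (a₂ : Acyc V U₂)
    (h : AtMostOne V (U₁ ∪ U₂)) : AtMostOne V (U₁ ∩ U₂) := fun k z hz z' hz' hbz hbz' =>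
  h.bds_inter h₁ h₂ (a₁ k z (Ch_mono inter_subset_left hz) hbz)
    (a₂ k z (Ch_mono inter_subset_right hz) hbz) (a₁ k z' (Ch_mono inter_subset_left hz') hbz')
    (a₂ k z' (Ch_mono inter_subset_right hz') hbz')

end Homology

end CubicalDuality

namespace CubicalDuality

open Set Topology

variable {ι : Type}

/-- The kernel of the cone operator on the line. -/
def coneKernel (s N e m : ℤ) : ZMod 2 :=
  if e % 2 = 0 ∧ m % 2 ≠ 0 ∧ 0 < s * (m - e) ∧ s * m < N then 1 else 0

theorem sum_shift {N : ℤ} (F : ℤ → ZMod 2) {a : ℤ}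
    (h : ∀ e, F e ≠ 0 → |e| ≤ N) (h' : ∀ e, F (e + a) ≠ 0 → |e| ≤ N) :
    ∑ e ∈ Finset.Icc (-N) N, F e = ∑ e ∈ Finset.Icc (-N) N, F (e + a) := by
  rw [← finsum_eq_sum_of_support_subset, ← finsum_eq_sum_of_support_subset]
  · exact (finsum_comp_equiv (Equiv.addRight a)).symm
  · intro e he; simpa [abs_le] using h' e he
  · intro e he; simpa [abs_le] using h e he

theorem coneKernel_identity {s N : ℤ} (hs : s = 1 ∨ s = -1) (hN : N % 2 = 0) {e m : ℤ}
    (he : |e| < N) :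
    (if m % 2 = 0 then coneKernel s N e (m - 1) + coneKernel s N e (m + 1) else 0) +
      (coneKernel s N (e + 1) m + coneKernel s N (e - 1) m) =
    (if e = m then 1 else 0) + if m = s * N ∧ e % 2 = 0 then 1 else 0 := by
  rw [abs_lt] at he
  rcases hs with rfl | rfl <;> unfold coneKernel <;> split_ifs <;>
    first | rfl | (exfalso; omega)

theorem cone_line {s N : ℤ} (hs : s = 1 ∨ s = -1) (hN : N % 2 = 0) {g : ℤ → ZMod 2}
    (hg : ∀ e, g e ≠ 0 → |e| < N) (m : ℤ) :
    (if m % 2 = 0 then ∑ e ∈ Finset.Icc (-N) N, coneKernel s N e (m - 1) * g e +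
      ∑ e ∈ Finset.Icc (-N) N, coneKernel s N e (m + 1) * g e else 0) +
      ∑ e ∈ Finset.Icc (-N) N, coneKernel s N e m * (if e % 2 = 0 then g (e - 1) + g (e + 1) else 0)
    = g m + ∑ e ∈ Finset.Icc (-N) N, if m = s * N ∧ e % 2 = 0 then g e else 0 := by
  have h2 : ∑ e ∈ Finset.Icc (-N) N,
      coneKernel s N e m * (if e % 2 = 0 then g (e - 1) + g (e + 1) else 0) =
      ∑ e ∈ Finset.Icc (-N) N, (coneKernel s N (e + 1) m + coneKernel s N (e - 1) m) * g e := by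
    have h3 : ∀ e, coneKernel s N e m * (if e % 2 = 0 then g (e - 1) + g (e + 1) else 0) =
        coneKernel s N e m * g (e - 1) + coneKernel s N e m * g (e + 1) := by
      intro e
      split_ifs with h
      · ring
      · simp [coneKernel, h]
    simp only [h3, add_mul, Finset.sum_add_distrib]
    congr 1
    · rw [sum_shift _ (a := 1)]
      · simp
      · intro e he; have := hg _ (right_ne_zero_of_mul he); rw [abs_lt] at this; rw [abs_le]; omega
      · intro e he; have := hg _ (right_ne_zero_of_mul he); rw [abs_lt] at this; rw [abs_le]; omega
    · rw [sum_shift _ (a := -1)]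
      · simp [sub_eq_add_neg]
      · intro e he; have := hg _ (right_ne_zero_of_mul he); rw [abs_lt] at this; rw [abs_le]; omega
      · intro e he; have := hg _ (right_ne_zero_of_mul he); rw [abs_lt] at this; rw [abs_le]; omega
  have h4 : g m = ∑ e ∈ Finset.Icc (-N) N, (if e = m then 1 else 0) * g e := by
    simp only [ite_mul, one_mul, zero_mul, Finset.sum_ite_eq', Finset.mem_Icc]
    split_ifs with h
    · rfl
    · by_contra h5
      have := abs_lt.1 (hg m h5)
      omega
  have h5 : (if m % 2 = 0 then ∑ e ∈ Finset.Icc (-N) N, coneKernel s N e (m - 1) * g e +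
      ∑ e ∈ Finset.Icc (-N) N, coneKernel s N e (m + 1) * g e else 0) =
      ∑ e ∈ Finset.Icc (-N) N,
        (if m % 2 = 0 then coneKernel s N e (m - 1) + coneKernel s N e (m + 1) else 0) * g e := by
    split_ifs
    · simp only [add_mul, Finset.sum_add_distrib]
    · simp
  rw [h2, h4, h5, ← Finset.sum_add_distrib, ← Finset.sum_add_distrib]
  refine Finset.sum_congr rfl fun e _ => ?_
  rw [← add_mul]
  by_cases h : g e = 0
  · simp [h]
  · rw [coneKernel_identity hs hN (hg e h), add_mul, ite_mul (m = s * N ∧ e % 2 = 0), one_mul,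
      zero_mul]

theorem isOpen_half (i : ι) (s : ℤ) (p : ℝ) : IsOpen {x : ι → ℝ | 0 < s * (x i - p)} :=
  isOpen_lt continuous_const (by fun_prop)

section
variable [DecidableEq ι]

/-- The cone operator, sweeping out a chain in the direction `s = ±1` of the coordinate `i`. -/
noncomputable def cone (i : ι) (s N : ℤ) : Chain ι →+ Chain ι where
  toFun z d := ∑ e ∈ Finset.Icc (-N) N, coneKernel s N e (d i) * z (Function.update d i e)
  map_zero' := by ext d; simp
  map_add' a b := by ext d; simp [mul_add, Finset.sum_add_distrib]

theorem cone_apply (i : ι) (s N : ℤ) (z : Chain ι) (d : ι → ℤ) : cone i s N z d =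
    ∑ e ∈ Finset.Icc (-N) N, coneKernel s N e (d i) * z (Function.update d i e) := rfl

theorem bdAt_cone {i j : ι} (hij : i ≠ j) (s N : ℤ) (z : Chain ι) :
    bdAt j (cone i s N z) = cone i s N (bdAt j z) := by
  ext d
  simp only [bdAt_apply, cone_apply, Function.update_of_ne hij, Function.update_of_ne hij.symm]
  split_ifs
  · rw [← Finset.sum_add_distrib]
    simp only [Function.update_comm hij, mul_add]
  · simp

/-- The projection of a chain to the hyperplane `x i = s * N`. -/
noncomputable def push (i : ι) (s N : ℤ) (z : Chain ι) : Chain ι := fun d =>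
  ∑ e ∈ Finset.Icc (-N) N, if d i = s * N ∧ e % 2 = 0 then z (Function.update d i e) else 0

theorem bd_cone [Fintype ι] (i : ι) {s N : ℤ} (hs : s = 1 ∨ s = -1) (hN : N % 2 = 0) {z : Chain ι}
    (hz : ∀ c, z c ≠ 0 → |c i| < N) :
    bd (cone i s N z) + cone i s N (bd z) = z + push i s N z := by
  have h : ∀ j ∈ Finset.univ, j ≠ i → bdAt j (cone i s N z) + cone i s N (bdAt j z) = 0 := by
    intro j _ hj
    rw [bdAt_cone hj.symm]
    exact ZModModule.add_self _
  simp only [bd, AddMonoidHom.finsetSum_apply, map_sum]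
  rw [← Finset.sum_add_distrib, Finset.sum_eq_single i h (by simp)]
  ext d
  have := cone_line hs hN (g := fun e => z (Function.update d i e))
    (fun e he => by simpa using hz _ he) (d i)
  simpa [bdAt_apply, cone_apply, push] using this

theorem cone_mem (i : ι) {s N : ℤ} (hs : s = 1 ∨ s = -1) {k : ℕ} {U : Set (ι → ℝ)} {z : Chain ι}
    (hU : ∀ x ∈ U, ∀ t : ℝ, 0 ≤ s * (t - x i) → Function.update x i t ∈ U) (hz : z ∈ Ch k U) :
    cone i s N z ∈ Ch k U := by
  have key : ∀ d, cone i s N z d ≠ 0 → ∃ e, |e| ≤ N ∧ coneKernel s N e (d i) ≠ 0 ∧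
      z (Function.update d i e) ≠ 0 := by
    intro d hd
    rw [cone_apply] at hd
    obtain ⟨e, he, h⟩ := Finset.exists_ne_zero_of_sum_ne_zero hd
    exact ⟨e, by simpa [abs_le] using he, left_ne_zero_of_mul h, right_ne_zero_of_mul h⟩
  have key2 : ∀ {e m}, coneKernel s N e m ≠ 0 →
      e % 2 = 0 ∧ m % 2 ≠ 0 ∧ 0 < s * (m - e) ∧ s * m < N := by
    intro e m h
    by_contra h'
    exact h (if_neg h')
  refine ⟨?_, fun d hd x hx => ?_⟩
  · obtain ⟨R, hR⟩ := hz.1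
    refine ⟨max R N, fun d hd j => ?_⟩
    obtain ⟨e, he, h, h'⟩ := key d hd
    by_cases hj : j = i
    · subst hj
      refine le_max_of_le_right ?_
      obtain ⟨-, -, h1, h2⟩ := key2 h
      rw [abs_le] at *
      rcases hs with rfl | rfl <;> constructor <;> omega
    · have := hR _ h' j
      rw [Function.update_of_ne hj] at this
      exact this.trans (le_max_left _ _)
  · obtain ⟨e, he, h, h'⟩ := key d hd
    obtain ⟨h1, h2, h3, h4⟩ := key2 h
    have hx' : Function.update x i (e / 2 ^ k : ℝ) ∈ cell k (Function.update d i e) := by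
      intro j
      by_cases hj : j = i
      · subst hj
        have : (2 : ℝ) ^ k * (e / 2 ^ k) = e := by field_simp
        simp [this, h1]
      · simpa [hj] using hx j
    have := hU _ (hz.2 _ h' hx') (x i) ?_
    · simpa using this
    · have hxi := abs_le.1 (hx i)
      have h5 : d i % 2 = 1 := by omega
      rw [h5] at hxi
      have h6 : (0 : ℝ) < 2 ^ k := by positivity
      rw [Function.update_self]
      have h7 : (2 : ℝ) ^ k * (e / 2 ^ k) = e := by field_simp
      refine nonneg_of_mul_nonneg_right (a := (2:ℝ) ^ k) ?_ h6
      have h8 : (2 : ℝ) ^ k * (s * (x i - e / 2 ^ k)) = s * (2 ^ k * x i - e) := by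
        calc _ = (s : ℝ) * (2 ^ k * x i - 2 ^ k * (e / 2 ^ k)) := by ring
          _ = _ := by rw [h7]
      rw [h8]
      rcases hs with rfl | rfl
      · have : (e : ℝ) + 1 ≤ d i := by exact_mod_cast (by omega : e + 1 ≤ d i)
        push_cast at *
        linarith
      · have : (d i : ℝ) + 1 ≤ e := by exact_mod_cast (by omega : d i + 1 ≤ e)
        push_cast at *
        linarith

theorem push_mem (i : ι) {s N : ℤ} (hs : s = 1 ∨ s = -1) (hN : N % 2 = 0) {k : ℕ} {M : ℝ}
    (hM : M < N / 2 ^ k) (hN0 : 0 ≤ N) {U : Set (ι → ℝ)} {z : Chain ι} (hz : z ∈ Ch k U) :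
    push i s N z ∈ Ch k (outer ι M) := by
  have key : ∀ d, push i s N z d ≠ 0 → d i = s * N ∧ ∃ e, z (Function.update d i e) ≠ 0 := by
    intro d hd
    obtain ⟨e, he, h⟩ := Finset.exists_ne_zero_of_sum_ne_zero hd
    rw [ite_ne_right_iff] at h
    exact ⟨h.1.1, e, h.2⟩
  refine ⟨?_, fun d hd x hx => ⟨i, ?_⟩⟩
  · obtain ⟨R, hR⟩ := hz.1
    refine ⟨max R N, fun d hd j => ?_⟩
    obtain ⟨h, e, h'⟩ := key d hd
    by_cases hj : j = i
    · subst hj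
      refine le_max_of_le_right ?_
      rw [h, abs_le]
      rcases hs with rfl | rfl <;> constructor <;> omega
    · have := hR _ h' j
      rw [Function.update_of_ne hj] at this
      exact this.trans (le_max_left _ _)
  · obtain ⟨h, e, h'⟩ := key d hd
    have h1 : d i % 2 = 0 := by rcases hs with rfl | rfl <;> omega
    have h2 := hx i
    rw [h1, h, Int.cast_zero, abs_nonpos_iff, sub_eq_zero] at h2
    have h6 : (0 : ℝ) < 2 ^ k := by positivity
    have h3 : x i = s * (N / 2 ^ k) := by
      field_simp
      push_cast at h2
      linarith
    have h4 : |(s : ℝ)| = 1 := by rcases hs with rfl | rfl <;> simp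
    rw [h3, abs_mul, h4, one_mul]
    exact hM.trans_le (le_abs_self _)

theorem exists_even_large (a b : ℝ) : ∃ N : ℤ, N % 2 = 0 ∧ 0 ≤ N ∧ a < N ∧ b < N := by
  obtain ⟨n, hn⟩ := exists_nat_gt (max a b)
  have h := max_lt_iff.1 hn
  refine ⟨2 * n, by omega, by omega, ?_, ?_⟩ <;> push_cast <;> linarith [h.1, h.2]

theorem acyc_of_cone [Fintype ι] (i : ι) {s : ℤ} (hs : s = 1 ∨ s = -1) {M : ℝ} {U : Set (ι → ℝ)}
    (hU : ∀ x ∈ U, ∀ t : ℝ, 0 ≤ s * (t - x i) → Function.update x i t ∈ U)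
    (hUV : ∀ x ∈ U ∩ outer ι M, ∀ t : ℝ, 0 ≤ s * (t - x i) →
      Function.update x i t ∈ U ∩ outer ι M) : Acyc (outer ι M) U := by
  intro k z hz hbz
  obtain ⟨R, hR⟩ := hz.1
  have h6 : (0 : ℝ) < 2 ^ k := by positivity
  obtain ⟨N, hN, hN0, h1, h2⟩ := exists_even_large R (M * 2 ^ k)
  have h3 := bd_cone i hs hN (z := z) (fun c hc => (hR c hc i).trans_lt (by exact_mod_cast h1))
  refine .of_bd (cone_mem i hs (N := N) hU hz) ?_
  have h4 : z - bd (cone i s N z) = cone i s N (bd z) - push i s N z := by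
    rw [sub_eq_sub_iff_add_eq_add, ← h3, add_comm]
  rw [h4]
  refine sub_mem (Ch_mono inter_subset_right (cone_mem i hs hUV (mem_Ch_inter (bd_mem hz) hbz)))
    (push_mem i hs hN ?_ hN0 hz)
  rwa [lt_div_iff₀ h6]

theorem Acyc.empty [Fintype ι] (V : Set (ι → ℝ)) : Acyc V ∅ := by
  intro k z hz _
  have : z = 0 := by
    by_contra h
    obtain ⟨c, hc⟩ := Function.ne_iff.1 h
    exact hz.2 c hc (pt_mem_cell k c)
  rw [this]
  exact .zero

theorem acyc_half [Fintype ι] {M p : ℝ} (hp : |p| ≤ M) (i : ι) {T : Set (ι → ℝ)} {s : ℤ}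
    (hs : s = 1 ∨ s = -1) (hT : ∀ x ∈ T, ∀ t, Function.update x i t ∈ T) :
    Acyc (outer ι M) ({x | 0 < s * (x i - p)} ∩ T) := by
  rw [abs_le] at hp
  have hU : ∀ x ∈ ({x | 0 < s * (x i - p)} ∩ T : Set (ι → ℝ)), ∀ t : ℝ, 0 ≤ s * (t - x i) →
      Function.update x i t ∈ ({x | 0 < s * (x i - p)} ∩ T : Set (ι → ℝ)) := by
    rintro x ⟨hx, hxT⟩ t ht
    refine ⟨?_, hT x hxT t⟩
    simp only [mem_ofPred_eq, Function.update_self] at *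
    nlinarith
  refine acyc_of_cone i hs hU ?_
  rintro x ⟨hx, j, hj⟩ t ht
  refine ⟨hU x hx t ht, j, ?_⟩
  by_cases hji : j = i
  · subst hji
    have h1 := hx.1
    simp only [mem_ofPred_eq, Function.update_self] at *
    rw [lt_abs] at *
    rcases hs with rfl | rfl <;> push_cast at *
    · left; rcases hj with h | h <;> linarith
    · right; rcases hj with h | h <;> linarith
  · simpa [hji] using hj

theorem acyc_of_exists_ne [Fintype ι] {M : ℝ} {p : ι → ℝ} (hp : ∀ i, |p i| ≤ M) (S : Finset ι) :
    ∀ T : Set (ι → ℝ), IsOpen T → (∀ x ∈ T, ∀ i ∈ S, ∀ t, Function.update x i t ∈ T) →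
      Acyc (outer ι M) ({x | ∃ i ∈ S, x i ≠ p i} ∩ T) := by
  induction S using Finset.induction_on with
  | empty =>
    intro T _ _
    simpa using Acyc.empty (outer ι M)
  | insert i S hi ih =>
    intro T hT hTS
    have hne : ∀ y : ℝ, y ≠ p i ↔ 0 < ((1 : ℤ) : ℝ) * (y - p i) ∨ 0 < ((-1 : ℤ) : ℝ) * (y - p i) := by
      intro y
      push_cast
      rw [← sub_ne_zero, ← lt_or_lt_iff_ne]
      constructor <;> rintro (h | h) <;> first | (left; linarith) | (right; linarith)
    have hS : IsOpen {x : ι → ℝ | ∃ j ∈ S, x j ≠ p j} := by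
      have : {x : ι → ℝ | ∃ j ∈ S, x j ≠ p j} = ⋃ j ∈ S, {x | x j ≠ p j} := by ext; simp
      rw [this]
      exact isOpen_biUnion fun j _ => isOpen_ne_fun (continuous_apply j) continuous_const
    have hdisj : ∀ A : Set (ι → ℝ), ({x | 0 < ((1 : ℤ) : ℝ) * (x i - p i)} ∩ A) ∩
        ({x | 0 < ((-1 : ℤ) : ℝ) * (x i - p i)} ∩ A) = ∅ := by
      intro A
      ext x
      simp only [mem_inter_iff, mem_ofPred_eq, mem_empty_iff_false, iff_false]
      push_cast
      rintro ⟨⟨h, -⟩, h', -⟩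
      linarith
    have hTi := fun x hx => hTS x hx i (Finset.mem_insert_self _ _)
    have hB : Acyc (outer ι M) (({x | 0 < ((1 : ℤ) : ℝ) * (x i - p i)} ∩ T) ∪
        ({x | 0 < ((-1 : ℤ) : ℝ) * (x i - p i)} ∩ T)) := by
      refine .union ((isOpen_half ..).inter hT) ((isOpen_half ..).inter hT)
        (acyc_half (hp i) i (.inl rfl) hTi) (acyc_half (hp i) i (.inr rfl) hTi) ?_
      rw [hdisj]
      exact .empty _
    have hAB : ∀ s : ℤ, Acyc (outer ι M)
        ({x | ∃ j ∈ S, x j ≠ p j} ∩ ({x | 0 < s * (x i - p i)} ∩ T)) := by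
      refine fun s => ih _ ((isOpen_half ..).inter hT) fun x hx j hj t => ⟨?_, ?_⟩
      · have : i ≠ j := by rintro rfl; exact hi hj
        simpa [this] using hx.1
      · exact hTS x hx.2 j (Finset.mem_insert_of_mem hj) t
    have hI : Acyc (outer ι M)
        (({x | ∃ j ∈ S, x j ≠ p j} ∩ ({x | 0 < ((1 : ℤ) : ℝ) * (x i - p i)} ∩ T)) ∪
        ({x | ∃ j ∈ S, x j ≠ p j} ∩ ({x | 0 < ((-1 : ℤ) : ℝ) * (x i - p i)} ∩ T))) := by
      refine .union (hS.inter ((isOpen_half ..).inter hT)) (hS.inter ((isOpen_half ..).inter hT))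
        (hAB _) (hAB _) ?_
      rw [inter_inter_inter_comm, hdisj, inter_empty]
      exact .empty _
    have := (ih T hT fun x hx j hj t => hTS x hx j (Finset.mem_insert_of_mem hj) t).union
      (hS.inter hT) (((isOpen_half ..).inter hT).union ((isOpen_half ..).inter hT)) hB (by
        convert hI using 1
        ext x
        simp only [mem_inter_iff, mem_union]
        tauto)
    convert this using 1
    ext x
    have := hne (x i)
    simp only [mem_inter_iff, mem_union, mem_ofPred_eq, Finset.mem_insert, exists_eq_or_imp]
    rw [this, or_and_right, or_and_right, or_comm]

theorem acyc_compl_singleton [Fintype ι] {M : ℝ} {p : ι → ℝ} (hp : ∀ i, |p i| ≤ M) :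
    Acyc (outer ι M) {p}ᶜ := by
  have := acyc_of_exists_ne hp Finset.univ univ isOpen_univ (by simp)
  convert this using 1
  ext x
  simp [Function.ne_iff]

end

end CubicalDuality

namespace CubicalDuality

open Set Topology

variable {ι : Type}

theorem sdv_ones (z : Chain ι) : sdv z (fun _ => 1) = z (fun _ => 1) := by
  classical
  rw [sdv_apply, if_pos (by simp)]
  congr 1

theorem sdv_iterate_ones (j : ℕ) (z : Chain ι) : (sdv^[j] z) (fun _ => 1) = z (fun _ => 1) := by
  induction j with
  | zero => rfl
  | succ j ih => rw [Function.iterate_succ_apply', sdv_ones, ih]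

section
variable [Fintype ι] [DecidableEq ι]

theorem bd_ones (z : Chain ι) : bd z (fun _ => 1) = 0 := by
  simp [bd_apply, bdAt_apply]

theorem bds_univ_of_ones {M : ℝ} (hM : 1 ≤ M) {k : ℕ} {z : Chain ι} (hz : z ∈ Ch k univ)
    (hbz : bd z ∈ Ch k (outer ι M)) (h : z (fun _ => 1) = 0) : Bds (outer ι M) k univ z := by
  have h2 : (0 : ℝ) < 2 ^ k := by positivity
  refine (acyc_compl_singleton (M := M) (p := pt k fun _ => 1) (fun i => ?_) k z ⟨hz.1, ?_⟩ hbz).mono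
    (subset_univ _)
  · simp only [pt, Int.cast_one]
    rw [abs_of_nonneg (by positivity)]
    refine le_trans ?_ hM
    rw [div_le_one h2]
    exact one_le_pow₀ (by norm_num)
  · intro c hc x hx
    rintro rfl
    apply hc
    convert h
    rename_i i
    have h3 := hx i
    have h4 : (2 : ℝ) ^ k * pt k (fun _ : ι => 1) i - c i = ((1 - c i : ℤ) : ℝ) := by
      simp only [pt]; field_simp; push_cast; ring
    rw [h4] at h3
    have h5 : |1 - c i| ≤ c i % 2 := by exact_mod_cast h3
    rw [abs_le] at h5
    omega

theorem atMostOne_univ {M : ℝ} (hM : 1 ≤ M) : AtMostOne (outer ι M) univ := by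
  intro k z hz z' hz' hbz hbz'
  by_cases h : z (fun _ => 1) = 0
  · exact .inl (bds_univ_of_ones hM hz hbz h)
  by_cases h' : z' (fun _ => 1) = 0
  · exact .inr (.inl (bds_univ_of_ones hM hz' hbz' h'))
  refine .inr (.inr (bds_univ_of_ones hM (sub_mem hz hz') ?_ ?_))
  · rw [map_sub]; exact sub_mem hbz hbz'
  · have key : ∀ a b : ZMod 2, a ≠ 0 → b ≠ 0 → a - b = 0 := by decide
    exact key _ _ h h'

theorem not_bds_univ {M : ℝ} (hM : 0 ≤ M) {k : ℕ} {z : Chain ι} (h : z (fun _ => 1) ≠ 0) :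
    ¬ Bds (outer ι M) k univ z := by
  rintro ⟨j, c, hc, h'⟩
  have h2 := h'.2 (fun _ => 1) (by
    rw [Pi.sub_apply, bd_ones, sub_zero, sdv_iterate_ones]; exact h)
    (show (0 : ι → ℝ) ∈ _ by intro i; simp)
  obtain ⟨i, hi⟩ := h2
  simp only [Pi.zero_apply, abs_zero] at hi
  linarith

theorem exists_univ_cycle {M : ℝ} (hM : 0 ≤ M) : ∃ z ∈ Ch 0 (univ : Set (ι → ℝ)),
    bd z ∈ Ch 0 (outer ι M) ∧ Deg (Fintype.card ι) z ∧ ¬ Bds (outer ι M) 0 univ z := by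
  obtain ⟨N, hN, hN0, h1, -⟩ := exists_even_large M 0
  have hN1 : 0 < N := by exact_mod_cast hM.trans_lt h1
  set z : Chain ι := fun c => if ∀ i, c i % 2 = 1 ∧ |c i| < N then 1 else 0 with hzdef
  have hz : ∀ c, z c ≠ 0 → ∀ i, c i % 2 = 1 ∧ |c i| < N := by
    intro c hc
    by_contra h
    exact hc (if_neg h)
  have hzC : z ∈ Ch 0 univ := ⟨⟨N, fun c hc i => (hz c hc i).2.le⟩, fun c hc => subset_univ _⟩
  refine ⟨z, hzC, ?_, ?_, not_bds_univ hM ?_⟩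
  · have hb : ∀ i, bdAt i z ∈ Ch 0 (outer ι M) := by
      intro i
      refine ⟨(bdAt_mem i hzC).1, fun d hd x hx => ⟨i, ?_⟩⟩
      have h5 : d i % 2 = 0 ∧ |d i| = N := by
        rw [bdAt_apply] at hd
        by_cases h0 : d i % 2 = 0
        · refine ⟨h0, ?_⟩
          rw [if_pos h0] at hd
          by_contra h6
          apply hd
          have : z (Function.update d i (d i - 1)) = z (Function.update d i (d i + 1)) := by
            simp only [hzdef]
            congr 1
            refine propext (forall_congr' fun j => ?_)
            by_cases hj : j = i
            · subst hj
              simp only [Function.update_self, abs_lt]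
              have : d j ≠ N ∧ d j ≠ - N := by
                constructor <;> intro h <;> apply h6 <;> rw [h] <;> simp [hN0]
              omega
            · simp [hj]
          rw [this]
          exact zmod_two_add_self _
        · simp [h0] at hd
      have h6 := hx i
      rw [h5.1, Int.cast_zero, abs_nonpos_iff, sub_eq_zero, pow_zero, one_mul] at h6
      rw [h6]
      have h7 : |(d i : ℝ)| = N := by exact_mod_cast h5.2
      rwa [h7]
    rw [bd, AddMonoidHom.finsetSum_apply]
    exact sum_mem fun i _ => hb i
  · intro c hc
    rw [Finset.sum_congr rfl fun i _ => (hz c hc i).1]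
    simp
  · have : ∀ i : ι, ((1 : ℤ) % 2 = 1 ∧ |(1 : ℤ)| < N) := by
      intro i
      rw [abs_one]
      omega
    simp only [hzdef, if_pos this]
    decide

theorem Bds.inter_of_acyc {V U₁ U₂ : Set (ι → ℝ)} {k : ℕ} {z : Chain ι} (h₁ : IsOpen U₁)
    (h₂ : IsOpen U₂) (hz₁ : Bds V k U₁ z) (hz₂ : Bds V k U₂ z)
    (h : Acyc V (U₁ ∪ U₂)) : Bds V k (U₁ ∩ U₂) z := by
  obtain ⟨j₁, h₁z⟩ := hz₁.exists_forall
  obtain ⟨j₂, h₂z⟩ := hz₂.exists_forall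
  obtain ⟨a, ha, hza⟩ := h₁z (j₁ + j₂) (by omega)
  obtain ⟨b, hb, hzb⟩ := h₂z (j₁ + j₂) (by omega)
  have hab : bd (a - b) ∈ Ch (k + (j₁ + j₂)) V := by
    have := sub_mem hzb hza
    rwa [sub_sub_sub_cancel_left, ← map_sub] at this
  exact .of_iterate (.inter h₁ h₂ ha hb hza (h _ _
    (sub_mem (Ch_mono subset_union_left ha) (Ch_mono subset_union_right hb)) hab))

end

/-- A space whose embedded copies in a cube have acyclic complement. -/
def Good (K : Type) [TopologicalSpace K] : Prop :=
  ∀ (ι : Type) [Fintype ι] [DecidableEq ι] (h : K → ι → ℝ) (M : ℝ), Continuous h →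
    Function.Injective h → (∀ x i, |h x i| ≤ M) → Acyc (outer ι M) (range h)ᶜ

theorem Good.of_unique (K : Type) [TopologicalSpace K] [Unique K] : Good K := by
  intro ι _ _ h M _ _ hM
  rw [range_unique]
  exact acyc_compl_singleton (hM _)

theorem Good.of_bijective {K K' : Type} [TopologicalSpace K] [TopologicalSpace K'] (hK : Good K)
    {g : K → K'} (hg : Continuous g) (hb : Function.Bijective g) : Good K' := by
  intro ι _ _ h M hc hi hM
  rw [← hb.2.range_comp]
  exact hK ι (h ∘ g) M (hc.comp hg) (hi.comp hb.1) fun x => hM _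

theorem Good.prod {Q : Type} [TopologicalSpace Q] [CompactSpace Q] (hQ : Good Q) :
    Good (Q × unitInterval) := by
  intro ι _ _ h M hc hi hM k z hz hbz
  set W : Set unitInterval → Set (ι → ℝ) := fun A => (h '' (univ ×ˢ A))ᶜ with hW
  have hWopen : ∀ {A}, IsClosed A → IsOpen (W A) := fun hA =>
    ((isCompact_univ.prod hA.isCompact).image hc).isClosed.isOpen_compl
  have hWinter : ∀ A B, W A ∩ W B = W (A ∪ B) := by
    intro A B
    simp only [hW]
    rw [← compl_union, ← image_union, prod_union]
  have hWunion : ∀ A B, W A ∪ W B = W (A ∩ B) := by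
    intro A B
    simp only [hW]
    rw [← compl_inter, ← image_inter hi, prod_inter_prod, univ_inter]
  have hac : ∀ t, Acyc (outer ι M) (W {t}) := by
    intro t
    have : W {t} = (range fun q => h (q, t))ᶜ := by
      simp only [hW]
      congr 1
      ext x
      simp
    rw [this]
    exact hQ ι _ M (by fun_prop) (fun a b hab => (Prod.mk.inj (hi hab)).1) fun x => hM _
  have hzW : ∀ A, z ∈ Ch k (W A) := fun A => Ch_mono (compl_subset_compl.2 (image_subset_range _ _)) hz
  have hloc : ∀ t, ∃ u : Set unitInterval, IsOpen u ∧ t ∈ u ∧ Bds (outer ι M) k (W u) z := by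
    intro t
    obtain ⟨j, c, hcc, hcz⟩ := hac t k z (hzW _) hbz
    have hcl : IsClosed (Prod.snd '' (h ⁻¹' carrier (k + j) c) : Set unitInterval) :=
      isClosedMap_snd_of_compactSpace _ ((isCompact_carrier hcc).isClosed.preimage hc)
    refine ⟨_, hcl.isOpen_compl, ?_, j, c, Ch_mono ?_ (mem_Ch_carrier hcc), hcz⟩
    · rintro ⟨⟨q, t'⟩, hq, rfl⟩
      exact carrier_subset hcc hq ⟨(q, t'), by simp, rfl⟩
    · rintro y hy ⟨p, hp, rfl⟩
      exact hp.2 ⟨p, hy, rfl⟩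
  choose u huo hut hub using hloc
  obtain ⟨t, ht0, htm, ⟨n, hn⟩, htu⟩ := exists_monotone_Icc_subset_open_cover_unitInterval huo
    (fun t _ => mem_iUnion.2 ⟨t, hut t⟩)
  have key : ∀ m, Bds (outer ι M) k (W (Icc 0 (t m))) z := by
    intro m
    induction m with
    | zero =>
      rw [ht0, Icc_self]
      exact hac 0 k z (hzW _) hbz
    | succ m ih =>
      obtain ⟨s, hs⟩ := htu m
      have h1 : Icc 0 (t m) ∪ Icc (t m) (t (m + 1)) = Icc 0 (t (m + 1)) :=
        Icc_union_Icc_eq_Icc bot_le (htm m.le_succ)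
      have h2 : Icc 0 (t m) ∩ Icc (t m) (t (m + 1)) = {t m} :=
        Icc_inter_Icc_eq_singleton bot_le (htm m.le_succ)
      rw [← h1, ← hWinter]
      refine .inter_of_acyc (hWopen isClosed_Icc) (hWopen isClosed_Icc) ih
        ((hub s).mono (compl_subset_compl.2 (image_mono (prod_mono_right hs)))) ?_
      rw [hWunion, h2]
      exact hac _
  have := key n
  rw [hn n le_rfl] at this
  refine this.mono ?_
  have h3 : Icc (0 : unitInterval) 1 = univ := Icc_bot_top
  simp only [hW, h3, univ_prod_univ, image_univ]
  exact subset_rfl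

theorem good_cube (d : ℕ) : Good (Fin d → unitInterval) := by
  induction d with
  | zero => exact .of_unique _
  | succ d ih =>
    refine ih.prod.of_bijective (g := fun p => Fin.cons p.2 p.1) (by fun_prop) ⟨?_, ?_⟩
    · rintro ⟨a, b⟩ ⟨a', b'⟩ h
      obtain ⟨h1, h2⟩ := Fin.cons_inj.1 h
      exact Prod.ext h2 h1
    · intro f
      exact ⟨(Fin.tail f, f 0), Fin.cons_self_tail f⟩

/-- A set which is a homeomorphic image of a cube. -/
def IsCell {X : Type*} [TopologicalSpace X] (S : Set X) : Prop :=
  ∃ d, ∃ g : (Fin d → unitInterval) → X, Continuous g ∧ Function.Injective g ∧ range g = S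

theorem IsCell.image {X Y : Type*} [TopologicalSpace X] [TopologicalSpace Y] {S : Set X}
    (hS : IsCell S) {h : X → Y} (hc : ContinuousOn h S) (hi : InjOn h S) : IsCell (h '' S) := by
  obtain ⟨d, g, hg, hgi, rfl⟩ := hS
  refine ⟨d, h ∘ g, hc.comp_continuous hg mem_range_self, ?_, range_comp _ _⟩
  intro a b hab
  exact hgi (hi (mem_range_self a) (mem_range_self b) hab)

theorem IsCell.isCompact {X : Type*} [TopologicalSpace X] {S : Set X} (hS : IsCell S) :
    IsCompact S := by
  obtain ⟨d, g, hg, -, rfl⟩ := hS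
  exact isCompact_range hg

theorem IsCell.acyc [Fintype ι] [DecidableEq ι] {S : Set (ι → ℝ)} (hS : IsCell S) {M : ℝ}
    (hM : ∀ x ∈ S, ∀ i, |x i| ≤ M) : Acyc (outer ι M) Sᶜ := by
  obtain ⟨d, g, hg, hgi, rfl⟩ := hS
  exact good_cube d ι g M hg hgi fun x => hM _ (mem_range_self x)

end CubicalDuality

namespace CubicalDuality

open Set Topology
open scoped InnerProductSpace

theorem isCell_closedBall {F : Type*} [NormedAddCommGroup F] [NormedSpace ℝ F]
    [FiniteDimensional ℝ F] {ρ : ℝ} (hρ : 0 < ρ) : IsCell (Metric.closedBall (0 : F) ρ) := by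
  have e : F ≃L[ℝ] (Fin (Module.finrank ℝ F) → ℝ) := ContinuousLinearEquiv.ofFinrankEq (by simp)
  set C : Set (Fin (Module.finrank ℝ F) → ℝ) := Icc 0 1 with hC
  have hcell : IsCell C := by
    refine ⟨_, fun x i => x i, by fun_prop, ?_, ?_⟩
    · intro x y h
      ext i
      exact congrFun h i
    · ext x
      simp only [mem_range, hC, mem_Icc, Pi.le_def]
      constructor
      · rintro ⟨y, rfl⟩
        exact ⟨fun i => (y i).2.1, fun i => (y i).2.2⟩
      · rintro ⟨h, h'⟩
        exact ⟨fun i => ⟨x i, h i, h' i⟩, rfl⟩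
  have hne : (interior (e.symm '' C)).Nonempty := by
    have : e.symm '' interior C ⊆ interior (e.symm '' C) :=
      interior_maximal (image_mono interior_subset)
        (e.symm.toHomeomorph.isOpenMap _ isOpen_interior)
    refine Nonempty.mono this (Nonempty.image _ ?_)
    refine ⟨fun _ => 1 / 2, ?_⟩
    rw [hC, ← pi_univ_Icc, interior_pi_set finite_univ]
    intro i _
    simp only [Pi.zero_apply, Pi.one_apply, interior_Icc]
    norm_num
  have hcomp : IsCompact (e.symm '' C) := isCompact_Icc.image e.symm.continuous
  obtain ⟨h, -, h2, -⟩ := exists_homeomorph_image_interior_closure_frontier_eq_unitBall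
    (show Convex ℝ (e.symm '' C) from
      (convex_Icc (0 : Fin (Module.finrank ℝ F) → ℝ) 1).is_linear_image e.symm.isLinear)
    hne hcomp.isBounded
  rw [hcomp.isClosed.closure_eq] at h2
  have hb : IsCell (Metric.closedBall (0 : F) 1) := by
    rw [← h2]
    exact (hcell.image e.symm.continuous.continuousOn e.symm.injective.injOn).image
      h.continuous.continuousOn h.injective.injOn
  have := hb.image (h := fun x => ρ • x) (by fun_prop) (fun x _ y _ hxy => smul_right_injective F hρ.ne' hxy)
  convert this using 1
  ext x
  simp only [mem_closedBall_zero_iff, mem_image]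
  constructor
  · intro hx
    refine ⟨ρ⁻¹ • x, ?_, smul_inv_smul₀ hρ.ne' x⟩
    rwa [norm_smul, norm_inv, Real.norm_of_nonneg hρ.le, inv_mul_le_iff₀ hρ, mul_one]
  · rintro ⟨y, hy, rfl⟩
    rw [norm_smul, Real.norm_of_nonneg hρ.le]
    exact mul_le_of_le_one_right hρ.le hy

section Sphere
variable {E : Type*} [NormedAddCommGroup E] [InnerProductSpace ℝ E]

theorem inner_stereoInvFun {u : E} (hu : ‖u‖ = 1) (w : (ℝ ∙ u)ᗮ) :
    ⟪u, (stereoInvFun hu w : E)⟫_ℝ = (‖w‖ ^ 2 - 4) / (‖w‖ ^ 2 + 4) := by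
  have h : ⟪u, (w : E)⟫_ℝ = 0 := Submodule.mem_orthogonal_singleton_iff_inner_right.1 w.2
  rw [stereoInvFun_apply, inner_smul_right, inner_add_right, inner_smul_right, inner_smul_right, h,
    real_inner_self_eq_norm_sq, hu]
  ring

theorem stereoInvFun_image {u : E} (hu : ‖u‖ = 1) {P : ℝ → Prop} {Q : ℝ → Prop} (hP : ¬ P 1)
    (hPQ : ∀ t, 0 ≤ t → (Q t ↔ P ((t ^ 2 - 4) / (t ^ 2 + 4)))) :
    stereoInvFun hu '' {w | Q ‖w‖} = {x : Metric.sphere (0 : E) 1 | P ⟪u, (x : E)⟫_ℝ} := by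
  ext x
  constructor
  · rintro ⟨w, hw, rfl⟩
    simp only [mem_ofPred_eq] at hw ⊢
    rw [inner_stereoInvFun]
    exact (hPQ _ (norm_nonneg _)).1 hw
  · intro hx
    have hxu : (x : E) ≠ u := by
      rintro h
      apply hP
      simpa [h, hu] using hx
    refine ⟨stereoToFun u x, ?_, stereo_left_inv hu hxu⟩
    simp only [mem_ofPred_eq] at hx ⊢
    rw [hPQ _ (norm_nonneg _), ← inner_stereoInvFun hu, stereo_left_inv hu hxu]
    exact hx

variable {u : E} {s : ℝ}

theorem stereoInvFun_closedBall (hu : ‖u‖ = 1) (hs : -1 < s) (hs' : s < 1) :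
    stereoInvFun hu '' Metric.closedBall 0 (√(4 * (1 + s) / (1 - s))) =
      {x : Metric.sphere (0 : E) 1 | ⟪u, (x : E)⟫_ℝ ≤ s} := by
  have h1 : 0 < 1 - s := by linarith
  rw [← stereoInvFun_image hu (P := fun t => t ≤ s) (Q := fun t => t ≤ √(4 * (1 + s) / (1 - s)))]
  · congr 1; ext; simp
  · simpa using hs'
  · intro t ht
    rw [Real.le_sqrt ht (div_nonneg (by linarith) h1.le), le_div_iff₀ h1, div_le_iff₀ (by positivity)]
    constructor <;> intro h <;> linarith

theorem stereoInvFun_ball (hu : ‖u‖ = 1) (hs' : s < 1) :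
    stereoInvFun hu '' Metric.ball 0 (√(4 * (1 + s) / (1 - s))) =
      {x : Metric.sphere (0 : E) 1 | ⟪u, (x : E)⟫_ℝ < s} := by
  have h1 : 0 < 1 - s := by linarith
  rw [← stereoInvFun_image hu (P := fun t => t < s) (Q := fun t => t < √(4 * (1 + s) / (1 - s)))]
  · congr 1; ext; simp
  · simpa using hs'.le
  · intro t ht
    rw [Real.lt_sqrt ht, lt_div_iff₀ h1, div_lt_iff₀ (by positivity)]
    constructor <;> intro h <;> linarith

theorem isCell_cap [FiniteDimensional ℝ E] (hu : ‖u‖ = 1) (hs : -1 < s) (hs' : s < 1) :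
    IsCell {x : Metric.sphere (0 : E) 1 | ⟪u, (x : E)⟫_ℝ ≤ s} := by
  rw [← stereoInvFun_closedBall hu hs hs']
  refine (isCell_closedBall ?_).image (continuous_stereoInvFun hu).continuousOn ?_
  · have : 0 < 1 - s := by linarith
    have : 0 < 1 + s := by linarith
    positivity
  · intro w _ w' _ h
    rw [← stereo_right_inv hu w, h, stereo_right_inv]

theorem isPreconnected_cap (hu : ‖u‖ = 1) (hs' : s < 1) :
    IsPreconnected {x : Metric.sphere (0 : E) 1 | ⟪u, (x : E)⟫_ℝ < s} := by
  rw [← stereoInvFun_ball hu hs']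
  exact (convex_ball _ _).isPreconnected.image _ (continuous_stereoInvFun hu).continuousOn

/-- The slice of the unit sphere at the height `s`, as a copy of the equatorial sphere. -/
noncomputable def slice (u : E) (s : ℝ) (y : Metric.sphere (0 : (ℝ ∙ u)ᗮ) 1) : E :=
  s • u + √(1 - s ^ 2) • ((y : (ℝ ∙ u)ᗮ) : E)

theorem inner_slice (hu : ‖u‖ = 1) (y : Metric.sphere (0 : (ℝ ∙ u)ᗮ) 1) :
    ⟪u, slice u s y⟫_ℝ = s := by
  have h : ⟪u, ((y : (ℝ ∙ u)ᗮ) : E)⟫_ℝ = 0 :=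
    Submodule.mem_orthogonal_singleton_iff_inner_right.1 y.1.2
  rw [slice, inner_add_right, inner_smul_right, inner_smul_right, h, real_inner_self_eq_norm_sq, hu]
  ring

theorem norm_slice (hu : ‖u‖ = 1) (hs : -1 < s) (hs' : s < 1)
    (y : Metric.sphere (0 : (ℝ ∙ u)ᗮ) 1) : ‖slice u s y‖ = 1 := by
  have h : ⟪u, ((y : (ℝ ∙ u)ᗮ) : E)⟫_ℝ = 0 :=
    Submodule.mem_orthogonal_singleton_iff_inner_right.1 y.1.2
  have hy : ‖((y : (ℝ ∙ u)ᗮ) : E)‖ = 1 := by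
    have := y.2
    rw [mem_sphere_zero_iff_norm] at this
    exact this
  have h2 : ‖slice u s y‖ * ‖slice u s y‖ = 1 := by
    rw [slice, norm_add_sq_eq_norm_sq_add_norm_sq_of_inner_eq_zero (𝕜 := ℝ) _ _
      (by rw [inner_smul_left, inner_smul_right, h]; simp), norm_smul, norm_smul, hu, hy]
    rw [mul_one, mul_one, Real.norm_eq_abs, Real.norm_eq_abs, abs_mul_abs_self, abs_mul_abs_self,
      Real.mul_self_sqrt (by nlinarith)]
    ring
  nlinarith [norm_nonneg (slice u s y)]

theorem slice_continuous : Continuous (slice u s) := by unfold slice; fun_prop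

theorem slice_injective (hs : -1 < s) (hs' : s < 1) : Function.Injective (slice u s) := by
  intro y y' h
  have h1 : √(1 - s ^ 2) ≠ 0 := (Real.sqrt_pos.2 (by nlinarith)).ne'
  have := smul_right_injective E h1 (add_left_cancel h)
  exact Subtype.ext (Subtype.ext this)

theorem exists_slice (hu : ‖u‖ = 1) (hs : -1 < s) (hs' : s < 1) {x : E} (hx : ‖x‖ = 1)
    (hxs : ⟪u, x⟫_ℝ = s) : ∃ y, slice u s y = x := by
  have h1 : 0 < √(1 - s ^ 2) := Real.sqrt_pos.2 (by nlinarith)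
  have hmem : (√(1 - s ^ 2))⁻¹ • (x - s • u) ∈ (ℝ ∙ u)ᗮ := by
    rw [Submodule.mem_orthogonal_singleton_iff_inner_right, inner_smul_right, inner_sub_right,
      inner_smul_right, hxs, real_inner_self_eq_norm_sq, hu]
    ring
  have hn : ‖x - s • u‖ * ‖x - s • u‖ = 1 - s ^ 2 := by
    rw [norm_sub_mul_self_real, inner_smul_right, real_inner_comm, hxs, norm_smul, hx, hu,
      mul_one, mul_one, Real.norm_eq_abs, abs_mul_abs_self]
    ring
  have hn' : ‖x - s • u‖ = √(1 - s ^ 2) := by rw [← hn, Real.sqrt_mul_self (norm_nonneg _)]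
  refine ⟨⟨⟨_, hmem⟩, ?_⟩, ?_⟩
  · rw [mem_sphere_zero_iff_norm]
    rw [Submodule.coe_norm, norm_smul, hn', norm_inv, Real.norm_of_nonneg h1.le,
      inv_mul_cancel₀ h1.ne']
  · simp only [slice]
    rw [smul_inv_smul₀ h1.ne']
    abel

end Sphere

end CubicalDuality

namespace CubicalDuality

open Set Topology
open scoped InnerProductSpace

section
variable {E : Type*} [NormedAddCommGroup E] [InnerProductSpace ℝ E] {u : E} {s : ℝ}

/-- The slice of the unit sphere at the height `s`, as a map between unit spheres. -/
noncomputable def sphereSlice (hu : ‖u‖ = 1) (hs : -1 < s) (hs' : s < 1)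
    (y : Metric.sphere (0 : (ℝ ∙ u)ᗮ) 1) : Metric.sphere (0 : E) 1 :=
  ⟨slice u s y, by rw [mem_sphere_zero_iff_norm, norm_slice hu hs hs']⟩

variable (hu : ‖u‖ = 1) (hs : -1 < s) (hs' : s < 1)

theorem sphereSlice_continuous : Continuous (sphereSlice hu hs hs') :=
  slice_continuous.subtype_mk _

theorem sphereSlice_injective : Function.Injective (sphereSlice hu hs hs') := fun _ _ h =>
  slice_injective hs hs' (Subtype.ext_iff.1 h)

theorem range_sphereSlice : range (sphereSlice hu hs hs') =
    {x : Metric.sphere (0 : E) 1 | ⟪u, (x : E)⟫_ℝ = s} := by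
  ext x
  constructor
  · rintro ⟨y, rfl⟩
    exact inner_slice hu y
  · intro hx
    obtain ⟨y, hy⟩ := exists_slice hu hs hs' (mem_sphere_zero_iff_norm.1 x.2) hx
    exact ⟨y, Subtype.ext hy⟩

end

theorem exists_bound {X ι : Type*} [TopologicalSpace X] [CompactSpace X] [Finite ι]
    {h : X → ι → ℝ} (hc : Continuous h) : ∃ M : ℝ, 1 ≤ M ∧ ∀ x i, |h x i| ≤ M := by
  have := Fintype.ofFinite ι
  obtain ⟨R, hR⟩ := (isCompact_range hc).isBounded.exists_norm_le
  refine ⟨max R 1, le_max_right _ _, fun x i => le_max_of_le_left ?_⟩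
  exact (norm_le_pi_norm (h x) i).trans (hR _ (mem_range_self x))

/-- Alexander duality for the complement of an embedded sphere. -/
theorem sphere_duality (d : ℕ) : ∀ (E : Type) [NormedAddCommGroup E] [InnerProductSpace ℝ E]
    [FiniteDimensional ℝ E], Module.finrank ℝ E = d →
    ∀ {ι : Type} [Fintype ι] [DecidableEq ι] {M : ℝ} {h : Metric.sphere (0 : E) 1 → ι → ℝ},
    1 ≤ M → Continuous h → Function.Injective h → (∀ x i, |h x i| ≤ M) →
    AtMostOne (outer ι M) (range h)ᶜ ∧ ∃ k, ∃ z ∈ Ch k (range h)ᶜ, bd z ∈ Ch k (outer ι M) ∧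
      Deg (Fintype.card ι - d) z ∧ ¬ Bds (outer ι M) k (range h)ᶜ z := by
  induction d with
  | zero =>
    intro E _ _ _ hE ι _ _ M h hM hc hi hb
    have : Subsingleton E := Module.finrank_zero_iff.1 hE
    have : IsEmpty (Metric.sphere (0 : E) 1) := by
      refine ⟨fun x => ?_⟩
      have := mem_sphere_zero_iff_norm.1 x.2
      rw [Subsingleton.elim (x : E) 0, norm_zero] at this
      exact zero_ne_one this
    rw [range_eq_empty, compl_empty]
    refine ⟨atMostOne_univ hM, 0, ?_⟩
    simpa using exists_univ_cycle (ι := ι) (zero_le_one.trans hM)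
  | succ d ih =>
    intro E _ _ _ hE ι _ _ M h hM hc hi hb
    have : Nontrivial E := Module.nontrivial_of_finrank_eq_succ hE
    obtain ⟨u, hu⟩ := exists_norm_eq E zero_le_one
    have : Fact (Module.finrank ℝ E = d + 1) := ⟨hE⟩
    have hu' : ‖-u‖ = 1 := by rwa [norm_neg]
    have hu0 : u ≠ 0 := by rintro rfl; simp at hu
    set K₁ := {x : Metric.sphere (0 : E) 1 | ⟪u, (x : E)⟫_ℝ ≤ 0} with hK₁
    set K₂ := {x : Metric.sphere (0 : E) 1 | ⟪-u, (x : E)⟫_ℝ ≤ 0} with hK₂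
    have c₁ : IsCell (h '' K₁) :=
      (isCell_cap hu (by norm_num) (by norm_num)).image hc.continuousOn hi.injOn
    have c₂ : IsCell (h '' K₂) :=
      (isCell_cap hu' (by norm_num) (by norm_num)).image hc.continuousOn hi.injOn
    have a₁ : Acyc (outer ι M) (h '' K₁)ᶜ := c₁.acyc (by rintro - ⟨x, -, rfl⟩; exact hb x)
    have a₂ : Acyc (outer ι M) (h '' K₂)ᶜ := c₂.acyc (by rintro - ⟨x, -, rfl⟩; exact hb x)
    have o₁ := c₁.isCompact.isClosed.isOpen_compl
    have o₂ := c₂.isCompact.isClosed.isOpen_compl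
    have hrange : (h '' K₁)ᶜ ∩ (h '' K₂)ᶜ = (range h)ᶜ := by
      rw [← compl_union, ← image_union, ← image_univ]
      congr 2
      ext x
      simp [hK₁, hK₂, le_total]
    have hunion : (h '' K₁)ᶜ ∪ (h '' K₂)ᶜ =
        (range (h ∘ sphereSlice hu (s := 0) (by norm_num) (by norm_num)))ᶜ := by
      rw [← compl_inter, ← image_inter hi, range_comp, range_sphereSlice]
      congr 2
      ext x
      simp [hK₁, hK₂, le_antisymm_iff]
    obtain ⟨h1, k, w, hw, hbw, hdw, hnw⟩ := ih (ℝ ∙ u)ᗮ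
      (Submodule.finrank_orthogonal_span_singleton hu0) (M := M) (h :=
        h ∘ sphereSlice hu (s := 0) (by norm_num) (by norm_num)) hM
      (hc.comp (sphereSlice_continuous _ _ _)) (hi.comp (sphereSlice_injective _ _ _))
      (fun _ => hb _)
    rw [← hunion] at h1 hw hnw
    rw [← hrange]
    refine ⟨h1.inter o₁ o₂ a₁ a₂, ?_⟩
    obtain ⟨j, z, hz, hbz, hdz, -, hnz⟩ := exists_connecting o₁ o₂
      (fun k z hz hz' => (a₁ k z hz hz').mono subset_union_left)
      (fun k z hz hz' => (a₂ k z hz hz').mono subset_union_right) hw hbw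
    refine ⟨_, z, hz, hbz, ?_, fun h => hnw (hnz h)⟩
    have := hdz _ hdw
    push_cast
    rwa [← sub_sub]

/-- Invariance of domain, in the form: the `n`-sphere does not embed into `n`-space. -/
theorem not_injective_of_sphere {E : Type} [NormedAddCommGroup E] [InnerProductSpace ℝ E]
    [FiniteDimensional ℝ E] {ι : Type} [Fintype ι] (hE : Module.finrank ℝ E = Fintype.card ι + 1)
    {h : Metric.sphere (0 : E) 1 → ι → ℝ} (hc : Continuous h) : ¬ Function.Injective h := by
  classical
  intro hi
  obtain ⟨M, hM, hb⟩ := exists_bound hc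
  obtain ⟨-, k, z, -, -, hd, hn⟩ := sphere_duality _ E hE hM hc hi hb
  apply hn
  have : z = 0 := by
    by_contra hz
    obtain ⟨c, hc⟩ := Function.ne_iff.1 hz
    have h1 := hd c hc
    have h2 : 0 ≤ ∑ i, c i % 2 := Finset.sum_nonneg fun i _ => Int.emod_nonneg _ (by norm_num)
    push_cast at h1
    omega
  rw [this]
  exact .zero

end CubicalDuality

namespace CubicalDuality

open Set Topology

variable {ι : Type}

/-- The coordinates of a point or cell of a product with a line. -/
def consOpt {α : Type*} (a : α) (c : ι → α) : Option ι → α := fun o => o.elim a c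

/-- The product of a chain with the segment `[-N, N]`. -/
def prodSeg (N : ℤ) : Chain ι →+ Chain (Option ι) where
  toFun z d := if d none % 2 = 1 ∧ |d none| < N then z (fun i => d (some i)) else 0
  map_zero' := by ext d; simp
  map_add' a b := by
    ext d
    simp only [Pi.add_apply]
    split_ifs <;> simp

theorem prodSeg_apply (N : ℤ) (z : Chain ι) (d : Option ι → ℤ) : prodSeg N z d =
    if d none % 2 = 1 ∧ |d none| < N then z (fun i => d (some i)) else 0 := rfl

theorem of_prodSeg_ne_zero {N : ℤ} {z : Chain ι} {d : Option ι → ℤ} (h : prodSeg N z d ≠ 0) :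
    |d none| < N ∧ z (fun i => d (some i)) ≠ 0 := by
  rw [prodSeg_apply, ite_ne_right_iff] at h
  exact ⟨h.1.2, h.2⟩

theorem prodSeg_mem {N : ℤ} {k : ℕ} {U : Set (ι → ℝ)} {z : Chain ι} (hz : z ∈ Ch k U) :
    prodSeg N z ∈ Ch k {y : Option ι → ℝ | (fun i => y (some i)) ∈ U} := by
  refine ⟨?_, fun d hd y hy => ?_⟩
  · obtain ⟨R, hR⟩ := hz.1
    refine ⟨max R N, fun d hd o => ?_⟩
    obtain ⟨h1, h2⟩ := of_prodSeg_ne_zero hd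
    cases o with
    | none => exact h1.le.trans (le_max_right _ _)
    | some i => exact (hR _ h2 i).trans (le_max_left _ _)
  · exact hz.2 _ (of_prodSeg_ne_zero hd).2 fun i => hy (some i)

/-- The slice of a chain through the cells with the coordinate `1`. -/
def sliceAt : Chain (Option ι) →+ Chain ι where
  toFun y c := y (consOpt 1 c)
  map_zero' := rfl
  map_add' _ _ := rfl

theorem sliceAt_apply (y : Chain (Option ι)) (c : ι → ℤ) : sliceAt y c = y (consOpt 1 c) := rfl

theorem sliceAt_prodSeg {N : ℤ} (hN : 1 < N) (z : Chain ι) : sliceAt (prodSeg N z) = z := by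
  ext c
  rw [sliceAt_apply, prodSeg_apply, if_pos]
  · rfl
  · simp [consOpt, hN]

theorem sliceAt_sdv (y : Chain (Option ι)) : sliceAt (sdv y) = sdv (sliceAt y) := by
  classical
  ext c
  rw [sliceAt_apply, sdv_apply, sdv_apply, sliceAt_apply]
  have h1 : (∀ o, consOpt 1 c o % 4 ≠ 2) ↔ ∀ i, c i % 4 ≠ 2 := by
    rw [Option.forall]
    simp [consOpt]
  have h2 : par (consOpt 1 c) = consOpt 1 (par c) := by
    ext o
    cases o <;> simp [par, consOpt]
  simp only [h1, h2]

theorem sliceAt_sdv_iterate (j : ℕ) (y : Chain (Option ι)) :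
    sliceAt (sdv^[j] y) = sdv^[j] (sliceAt y) := by
  induction j with
  | zero => rfl
  | succ j ih => rw [Function.iterate_succ_apply', Function.iterate_succ_apply', sliceAt_sdv, ih]

theorem sliceAt_mem {k : ℕ} {U : Set (Option ι → ℝ)} {y : Chain (Option ι)} (hy : y ∈ Ch k U) :
    sliceAt y ∈ Ch k {x | consOpt 0 x ∈ U} := by
  refine ⟨?_, fun c hc x hx => hy.2 _ hc ?_⟩
  · obtain ⟨R, hR⟩ := hy.1
    exact ⟨R, fun c hc i => hR _ hc (some i)⟩
  · rintro (_ | i)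
    · simp [consOpt]
    · exact hx i

section
variable [DecidableEq ι]

theorem bdAt_some_prodSeg (i : ι) (N : ℤ) (z : Chain ι) :
    bdAt (some i) (prodSeg N z) = prodSeg N (bdAt i z) := by
  ext d
  have h : ∀ a, (fun j => Function.update d (some i) a (some j)) =
      Function.update (fun j => d (some j)) i a := by
    intro a
    ext j
    by_cases hj : j = i
    · subst hj; simp
    · simp [hj]
  simp only [bdAt_apply, prodSeg_apply, h]
  split_ifs <;> simp_all

theorem bdAt_none_prodSeg_mem {N : ℤ} (hN : N % 2 = 0) (hN0 : 0 ≤ N) {k : ℕ} {B : ℝ}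
    (hB : B < N / 2 ^ k) {U : Set (ι → ℝ)} {z : Chain ι} (hz : z ∈ Ch k U) :
    bdAt none (prodSeg N z) ∈ Ch k (outer (Option ι) B) := by
  refine ⟨(bdAt_mem none (prodSeg_mem hz)).1, fun d hd x hx => ⟨none, ?_⟩⟩
  have h5 : d none % 2 = 0 ∧ |d none| = N := by
    rw [bdAt_apply] at hd
    by_cases h0 : d none % 2 = 0
    · refine ⟨h0, ?_⟩
      rw [if_pos h0] at hd
      by_contra h6
      apply hd
      have : d none ≠ N ∧ d none ≠ - N := by
        constructor <;> intro h <;> apply h6 <;> rw [h] <;> simp [hN0]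
      have h7 : ((d none - 1) % 2 = 1 ∧ |d none - 1| < N) ↔
          ((d none + 1) % 2 = 1 ∧ |d none + 1| < N) := by
        simp only [abs_lt]
        omega
      simp only [prodSeg_apply, Function.update_self, h7]
      exact zmod_two_add_self _
    · simp [h0] at hd
  have h6 := hx none
  have h2 : (0 : ℝ) < 2 ^ k := by positivity
  rw [h5.1, Int.cast_zero, abs_nonpos_iff, sub_eq_zero] at h6
  have h7 : x none = d none / 2 ^ k := by rw [← h6]; field_simp
  have h8 : |(d none : ℝ)| = N := by exact_mod_cast h5.2
  rwa [h7, abs_div, h8, abs_of_pos h2]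

theorem bd_sliceAt [Fintype ι] (y : Chain (Option ι)) : bd (sliceAt y) = sliceAt (bd y) := by
  ext c
  rw [bd_apply, sliceAt_apply, bd_apply, Fintype.sum_option]
  have h : bdAt none y (consOpt 1 c) = 0 := by simp [bdAt_apply, consOpt]
  rw [h, zero_add]
  refine Finset.sum_congr rfl fun i _ => ?_
  have h2 : ∀ a, consOpt 1 (Function.update c i a) = Function.update (consOpt 1 c) (some i) a := by
    intro a
    ext o
    cases o with
    | none => simp [consOpt]
    | some j =>
      by_cases hj : j = i
      · subst hj; simp [consOpt]
      · simp [consOpt, hj]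
  simp only [bdAt_apply, sliceAt_apply, h2]
  rfl

theorem bd_prodSeg_mem [Fintype ι] {N : ℤ} (hN : N % 2 = 0) (hN0 : 0 ≤ N) {k : ℕ} {B : ℝ}
    (hB : B < N / 2 ^ k) {U : Set (ι → ℝ)} {z : Chain ι} (hz : z ∈ Ch k U)
    (hbz : bd z ∈ Ch k (outer ι B)) : bd (prodSeg N z) ∈ Ch k (outer (Option ι) B) := by
  have h : bd (prodSeg N z) = bdAt none (prodSeg N z) + prodSeg N (bd z) := by
    simp only [bd, AddMonoidHom.finsetSum_apply, map_sum, Fintype.sum_option,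
      AddMonoidHom.add_apply, bdAt_some_prodSeg]
  rw [h]
  refine add_mem (bdAt_none_prodSeg_mem hN hN0 hB hz) (Ch_mono ?_ (prodSeg_mem hbz))
  rintro y ⟨i, hi⟩
  exact ⟨some i, hi⟩

theorem bds_of_prodSeg [Fintype ι] {N : ℤ} (hN : 1 < N) {k : ℕ} {B : ℝ} (hB : 0 ≤ B)
    {U : Set (Option ι → ℝ)} {z : Chain ι} (h : Bds (outer (Option ι) B) k U (prodSeg N z)) :
    Bds (outer ι B) k {x | consOpt 0 x ∈ U} z := by
  obtain ⟨j, c, hc, h⟩ := h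
  refine ⟨j, sliceAt c, sliceAt_mem hc, ?_⟩
  have h1 := sliceAt_mem h
  rw [map_sub, sliceAt_sdv_iterate, sliceAt_prodSeg hN, ← bd_sliceAt] at h1
  refine Ch_mono ?_ h1
  rintro x ⟨o, ho⟩
  cases o with
  | none => simp [consOpt] at ho; exact absurd hB (not_le.2 ho)
  | some i => exact ⟨i, ho⟩

end

/-- If a cell `K` is embedded by `(h, J)`, then the cycles in the complement of `h K` bound in the
complement of the image of the zero set of `J`. -/
theorem bds_of_graph {X : Type*} [TopologicalSpace X] {K : Set X} (hK : IsCell K) {B : ℝ}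
    (hB : 0 ≤ B) (m : ℕ) : ∀ {ι : Type} [Fintype ι] [DecidableEq ι] {h : X → ι → ℝ}
    {J : X → Fin m → ℝ}, Continuous h → Continuous J → InjOn (fun x => (h x, J x)) K →
    (∀ x ∈ K, ∀ i, |h x i| ≤ B) → (∀ x ∈ K, ∀ i, |J x i| ≤ B) →
    ∀ {k : ℕ} {z : Chain ι}, z ∈ Ch k (h '' K)ᶜ → bd z ∈ Ch k (outer ι B) →
    Bds (outer ι B) k (h '' {x ∈ K | J x = 0})ᶜ z := by
  induction m with
  | zero =>
    intro ι _ _ h J hh hJ hi hhB hJB k z hz hbz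
    have hi' : InjOn h K := fun x hx y hy hxy => hi hx hy (by
      simp only [Prod.mk.injEq]
      exact ⟨hxy, Subsingleton.elim _ _⟩)
    refine ((hK.image hh.continuousOn hi').acyc (by rintro - ⟨x, hx, rfl⟩; exact hhB x hx)
      k z hz hbz).mono (compl_subset_compl.2 (image_mono fun x hx => hx.1))
  | succ m ih =>
    intro ι _ _ h J hh hJ hi hhB hJB k z hz hbz
    have h2 : (0 : ℝ) < 2 ^ k := by positivity
    obtain ⟨N, hN, hN0, h1, h3⟩ := exists_even_large (B * 2 ^ k) 0
    have hN1 : 0 < N := by exact_mod_cast h3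
    have hBN : B < N / 2 ^ k := by rwa [lt_div_iff₀ h2]
    have key := ih (h := fun x => consOpt (J x 0) (h x)) (J := fun x i => J x i.succ)
      (continuous_pi (by rintro (_ | i) <;> simp only [consOpt, Option.elim] <;> fun_prop))
      (by fun_prop) (by
        intro x hx y hy hxy
        simp only [Prod.mk.injEq] at hxy
        refine hi hx hy ?_
        simp only [Prod.mk.injEq]
        refine ⟨funext fun i => congrFun hxy.1 (some i), funext fun i => ?_⟩
        refine Fin.cases ?_ (fun i => ?_) i
        · exact congrFun hxy.1 none
        · exact congrFun hxy.2 i)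
      (by
        rintro x hx (_ | i)
        · exact hJB x hx 0
        · exact hhB x hx i)
      (fun x hx i => hJB x hx _)
      (k := k) (z := prodSeg N z) (Ch_mono (by
        rintro y hy ⟨x, hx, rfl⟩
        exact hy ⟨x, hx, rfl⟩) (prodSeg_mem hz))
      (bd_prodSeg_mem hN hN0 hBN hz hbz)
    refine (bds_of_prodSeg (by omega) hB key).mono ?_
    rintro y hy ⟨x, ⟨hx, hJx⟩, rfl⟩
    refine hy ⟨x, ⟨hx, ?_⟩, ?_⟩
    · rw [hJx]; rfl
    · simp only [hJx]; rfl

end CubicalDuality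

namespace CubicalDuality

open Set Topology

variable {ι : Type}

theorem continuousOn_indicator_connectedComponentIn {X : Type*} [TopologicalSpace X]
    [LocallyConnectedSpace X] {U : Set X} (hU : IsOpen U) (p : X) :
    ContinuousOn ((connectedComponentIn U p).indicator 1 : X → ZMod 2) U := by
  refine fun x hx => ContinuousAt.continuousWithinAt ?_
  have hDo : IsOpen (connectedComponentIn U x) := hU.connectedComponentIn
  refine (continuousAt_const (y := (connectedComponentIn U p).indicator 1 x)).congr ?_
  filter_upwards [hDo.mem_nhds (mem_connectedComponentIn hx)] with y hy
  have e := connectedComponentIn_eq hy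
  have : y ∈ connectedComponentIn U p ↔ x ∈ connectedComponentIn U p := by
    constructor
    · intro h
      rw [connectedComponentIn_eq h, ← e]
      exact mem_connectedComponentIn hx
    · intro h
      rwa [connectedComponentIn_eq h]
  by_cases hxC : x ∈ connectedComponentIn U p
  · simp [hxC, this.2 hxC]
  · simp [hxC, this.not.2 hxC]

/-- The evaluation of the function `f` on the vertices of a chain of scale `2⁻ᵏ`. -/
noncomputable def eval (k : ℕ) (f : (ι → ℝ) → ZMod 2) (z : Chain ι) : ZMod 2 :=
  open Classical in ∑ᶠ c : ι → ℤ, if ∀ i, c i % 2 = 0 then z c * f (pt k c) else 0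

theorem eval_support_subset (k : ℕ) (f : (ι → ℝ) → ZMod 2) (z : Chain ι)
    [∀ c : ι → ℤ, Decidable (∀ i, c i % 2 = 0)] :
    (Function.support fun c : ι → ℤ => if ∀ i, c i % 2 = 0 then z c * f (pt k c) else 0) ⊆
      z.support := by
  intro c hc
  simp only [Function.mem_support, ne_eq, ite_eq_right_iff, mul_eq_zero, not_or,
    Classical.not_imp] at hc
  exact hc.2.1

theorem eval_add (k : ℕ) (f : (ι → ℝ) → ZMod 2) {z w : Chain ι} (hz : z.support.Finite)
    (hw : w.support.Finite) : eval k f (z + w) = eval k f z + eval k f w := by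
  classical
  simp only [eval]
  rw [← finsum_add_distrib (hz.subset ?_) (hw.subset ?_)]
  · refine finsum_congr fun c => ?_
    split_ifs
    · simp only [Pi.add_apply, add_mul]
    · simp
  · convert eval_support_subset k f z
  · convert eval_support_subset k f w

theorem eval_eq_zero {k : ℕ} {f : (ι → ℝ) → ZMod 2} {V : Set (ι → ℝ)} (hf : ∀ x ∈ V, f x = 0)
    {z : Chain ι} (hz : z ∈ Ch k V) : eval k f z = 0 := by
  refine finsum_eq_zero_of_forall_eq_zero fun c => ?_
  by_cases h : z c = 0
  · simp [h]
  · simp [hf _ (hz.2 c h (pt_mem_cell k c))]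

theorem eval_sdv [Finite ι] (k : ℕ) (f : (ι → ℝ) → ZMod 2) (z : Chain ι) :
    eval (k + 1) f (sdv z) = eval k f z := by
  classical
  simp only [eval]
  have hinj : Function.Injective fun c : ι → ℤ => fun i => 2 * c i := by
    intro c c' h
    ext i
    have := congrFun h i
    simp only at this
    omega
  rw [← finsum_mem_univ, finsum_mem_inter_support_eq _ _
    (range fun c : ι → ℤ => fun i => 2 * c i), finsum_mem_range hinj]
  · refine finsum_congr fun c => ?_
    have h1 : ∀ i, 2 * c i % 2 = 0 := fun i => by omega
    have h2 : (∀ i, 2 * c i % 4 ≠ 2) ↔ ∀ i, c i % 2 = 0 :=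
      forall_congr' fun i => by omega
    have h3 : par (fun i => 2 * c i) = c := by
      ext i
      simp [par]
    have h4 : pt (k + 1) (fun i => 2 * c i) = pt k c := by
      ext i
      simp only [pt]
      push_cast
      rw [pow_succ]
      field_simp
    simp only [sdv_apply, h1, h2, h3, h4, implies_true, if_true]
    split_ifs <;> simp
  · ext d
    simp only [univ_inter, mem_inter_iff, mem_range, Function.mem_support, ne_eq,
      ite_eq_right_iff, mul_eq_zero, not_or, Classical.not_imp, sdv_apply]
    refine ⟨fun h => ⟨⟨fun i => d i / 2, ?_⟩, h⟩, fun h => h.2⟩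
    ext i
    have := h.1 i
    simp only
    omega

theorem eval_sdv_iterate [Finite ι] (k j : ℕ) (f : (ι → ℝ) → ZMod 2) (z : Chain ι) :
    eval (k + j) f (sdv^[j] z) = eval k f z := by
  induction j with
  | zero => rfl
  | succ j ih => rw [Function.iterate_succ_apply', ← add_assoc, eval_sdv, ih]

theorem pt_mem_cell_of_abs_le [DecidableEq ι] {k : ℕ} {d : ι → ℤ} (hd : ∀ i, d i % 2 = 0) (i : ι)
    {a b : ℤ} (ha : a % 2 = 1) (hb : |b - a| ≤ 1) :
    pt k (Function.update d i b) ∈ cell k (Function.update d i a) := by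
  intro j
  have h2 : (2 : ℝ) ^ k ≠ 0 := by positivity
  simp only [pt, mul_div_cancel₀ _ h2]
  by_cases hj : j = i
  · subst hj
    simp only [Function.update_self, ha]
    exact_mod_cast hb
  · simp [hj, hd j]

theorem eval_bdAt [Finite ι] [DecidableEq ι] {k : ℕ} {f : (ι → ℝ) → ZMod 2} {U : Set (ι → ℝ)}
    (hf : ContinuousOn f U) {z : Chain ι} (hz : z ∈ Ch k U) (i : ι) :
    eval k f (bdAt i z) = 0 := by
  classical
  simp only [eval]
  let F : (ι → ℤ) → ZMod 2 := fun d => if ∀ i, d i % 2 = 0 then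
    z (Function.update d i (d i - 1)) * f (pt k d) else 0
  let G : (ι → ℤ) → ZMod 2 := fun d => if ∀ i, d i % 2 = 0 then
    z (Function.update d i (d i + 1)) * f (pt k d) else 0
  have hfin := finite_support hz
  have hF : (Function.support F).Finite := by
    refine Set.Finite.subset (hfin.image fun d => Function.update d i (d i + 1)) ?_
    intro d hd
    simp only [F, Function.mem_support, ne_eq, ite_eq_right_iff, mul_eq_zero, not_or,
      Classical.not_imp] at hd
    exact ⟨_, hd.2.1, by simp⟩
  have hG : (Function.support G).Finite := by
    refine Set.Finite.subset (hfin.image fun d => Function.update d i (d i - 1)) ?_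
    intro d hd
    simp only [G, Function.mem_support, ne_eq, ite_eq_right_iff, mul_eq_zero, not_or,
      Classical.not_imp] at hd
    exact ⟨_, hd.2.1, by simp⟩
  let e : (ι → ℤ) ≃ (ι → ℤ) :=
    { toFun d := Function.update d i (d i + 2)
      invFun d := Function.update d i (d i - 2)
      left_inv d := by simp
      right_inv d := by simp }
  have hFG : ∀ d, F (e d) = G d := by
    intro d
    have h1 : (∀ j, e d j % 2 = 0) ↔ ∀ j, d j % 2 = 0 := by
      refine forall_congr' fun j => ?_
      by_cases hj : j = i
      · subst hj; simp [e]
      · simp [e, hj]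
    have h2 : Function.update (e d) i (e d i - 1) = Function.update d i (d i + 1) := by
      simp only [e, Equiv.coe_fn_mk, Function.update_self, Function.update_idem]
      congr 1
      omega
    simp only [F, G, h1, h2]
    split_ifs with h
    · by_cases hc : z (Function.update d i (d i + 1)) = 0
      · simp [hc]
      · congr 1
        have hi : (d i + 1) % 2 = 1 := by have := h i; omega
        refine (isPreconnected_cell k _).constant (hf.mono (hz.2 _ hc))
          (pt_mem_cell_of_abs_le h i hi ?_) ?_
        · rw [abs_le]; constructor <;> omega
        · have := pt_mem_cell_of_abs_le (k := k) h i (b := d i) hi (by simp)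
          rwa [Function.update_eq_self] at this
    · rfl
  have hsum : ∑ᶠ d, F d = ∑ᶠ d, G d := by
    rw [← finsum_comp_equiv e]
    exact finsum_congr hFG
  trans ∑ᶠ d, (F d + G d)
  · refine finsum_congr fun d => ?_
    by_cases h : ∀ i, d i % 2 = 0
    · simp only [F, G, bdAt_apply, h, implies_true, if_true, add_mul]
    · simp only [F, G, if_neg h, add_zero]
  · rw [finsum_add_distrib hF hG, hsum, zmod_two_add_self]

theorem eval_bd [Fintype ι] [DecidableEq ι] {k : ℕ} {f : (ι → ℝ) → ZMod 2} {U : Set (ι → ℝ)}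
    (hf : ContinuousOn f U) {z : Chain ι} (hz : z ∈ Ch k U) : eval k f (bd z) = 0 := by
  have h : ∀ s : Finset ι, (∑ i ∈ s, bdAt i z) ∈ Ch k U ∧ eval k f (∑ i ∈ s, bdAt i z) = 0 := by
    classical
    intro s
    induction s using Finset.induction_on with
    | empty => exact ⟨by simp, eval_eq_zero (V := ∅) (by simp) (zero_mem _)⟩
    | insert i s hi ih =>
      rw [Finset.sum_insert hi]
      refine ⟨add_mem (bdAt_mem i hz) ih.1, ?_⟩
      rw [eval_add _ _ (finite_support (bdAt_mem i hz)) (finite_support ih.1), ih.2,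
        eval_bdAt hf hz, add_zero]
  rw [show bd z = ∑ i, bdAt i z by simp [bd]]
  exact (h _).2

theorem Bds.eval_eq_zero [Fintype ι] [DecidableEq ι] {k : ℕ} {f : (ι → ℝ) → ZMod 2}
    {U V : Set (ι → ℝ)} (hf : ContinuousOn f U) (hf' : ∀ x ∈ V, f x = 0) {z : Chain ι}
    (h : Bds V k U z) : eval k f z = 0 := by
  obtain ⟨j, c, hc, h⟩ := h
  rw [← eval_sdv_iterate k j, ← sub_add_cancel (sdv^[j] z) (bd c),
    eval_add _ _ (finite_support h) (finite_support (bd_mem hc)), eval_bd hf hc,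
    CubicalDuality.eval_eq_zero hf' h, add_zero]

/-- The vertex of scale `2⁻ᵏ` obtained by rounding a point. -/
noncomputable def rnd (k : ℕ) (x : ι → ℝ) : ι → ℤ := fun i => 2 * ⌊2 ^ k * x i / 2⌋

theorem rnd_emod (k : ℕ) (x : ι → ℝ) (i : ι) : rnd k x i % 2 = 0 := by
  simp [rnd]

theorem dist_pt_rnd [Fintype ι] (k : ℕ) (x : ι → ℝ) : dist (pt k (rnd k x)) x ≤ 2 / 2 ^ k := by
  have h2 : (0 : ℝ) < 2 ^ k := by positivity
  refine (dist_pi_le_iff (by positivity)).2 fun i => ?_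
  have h3 := Int.floor_le (2 ^ k * x i / 2)
  have h4 := Int.lt_floor_add_one (2 ^ k * x i / 2)
  rw [Real.dist_eq, le_div_iff₀ h2]
  nth_rw 1 [← abs_of_pos h2]
  rw [← abs_mul, sub_mul]
  simp only [pt, rnd, div_mul_cancel₀ _ h2.ne', abs_le]
  push_cast
  constructor <;> linarith

theorem rnd_pt {k : ℕ} (j : ℕ) {c : ι → ℤ} (hc : ∀ i, c i % 2 = 0) :
    rnd (k + j) (pt k c) = fun i => 2 ^ j * c i := by
  ext i
  have h2 : (0 : ℝ) < 2 ^ k := by positivity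
  obtain ⟨m, hm⟩ := Int.dvd_of_emod_eq_zero (hc i)
  have h : (2 : ℝ) ^ (k + j) * pt k c i / 2 = ((2 ^ j * m : ℤ) : ℝ) := by
    simp only [pt, hm]
    push_cast
    rw [pow_add]
    field_simp
  simp only [rnd, h, Int.floor_intCast, hm]
  ring

/-- The chain consisting of a single cell. -/
noncomputable def single (c : ι → ℤ) : Chain ι := open Classical in Pi.single c 1

theorem single_mem {k : ℕ} [Finite ι] {c : ι → ℤ} {U : Set (ι → ℝ)} (h : cell k c ⊆ U) :
    single c ∈ Ch k U := by
  classical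
  have := Fintype.ofFinite ι
  have key : ∀ d, single c d ≠ 0 → d = c := by
    intro d hd
    by_contra h
    exact hd (by simp [single, h])
  refine ⟨⟨∑ i, |c i|, fun d hd i => ?_⟩, fun d hd => ?_⟩
  · rw [key d hd]
    exact Finset.single_le_sum (f := fun i => |c i|) (fun _ _ => abs_nonneg _) (Finset.mem_univ i)
  · rwa [key d hd]

theorem cell_of_even {k : ℕ} {c : ι → ℤ} (hc : ∀ i, c i % 2 = 0) : cell k c = {pt k c} := by
  have h2 : (2 : ℝ) ^ k ≠ 0 := by positivity
  rw [cell_eq_Icc]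
  simp only [hc, Int.cast_zero, sub_zero, add_zero, Icc_self]
  rfl

theorem sdv_iterate_single (j : ℕ) {c : ι → ℤ} (hc : ∀ i, c i % 2 = 0) :
    sdv^[j] (single c) = single fun i => 2 ^ j * c i := by
  classical
  induction j with
  | zero => simp
  | succ j ih =>
    rw [Function.iterate_succ_apply', ih]
    ext d
    simp only [sdv_apply, single, Pi.single_apply]
    have hc' : ∀ i, (2 ^ j * c i) % 2 = 0 := by
      intro i
      rw [Int.mul_emod, hc i]; simp
    have : ((∀ i, d i % 4 ≠ 2) ∧ par d = fun i => 2 ^ j * c i) ↔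
        d = fun i => 2 ^ (j + 1) * c i := by
      simp only [funext_iff, ← forall_and]
      refine forall_congr' fun i => ?_
      have := hc' i
      rw [pow_succ', mul_assoc]
      generalize (2 : ℤ) ^ j * c i = e at *
      simp only [par]
      split_ifs <;> constructor <;> intros <;> omega
    rw [← this]
    split_ifs <;> simp_all

theorem eval_single [Finite ι] (k : ℕ) (f : (ι → ℝ) → ZMod 2) {c : ι → ℤ}
    (hc : ∀ i, c i % 2 = 0) : eval k f (single c) = f (pt k c) := by
  classical
  rw [eval, finsum_eq_single _ c]
  · simp [hc, single]
  · intro d hd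
    simp [single, hd]

theorem exists_scale {δ : ℝ} (hδ : 0 < δ) : ∃ k₀ : ℕ, ∀ k ≥ k₀, (2 : ℝ) / 2 ^ k < δ := by
  obtain ⟨k₀, hk₀⟩ := exists_pow_lt_of_lt_one (half_pos hδ) (by norm_num : (1 / 2 : ℝ) < 1)
  refine ⟨k₀, fun k hk => ?_⟩
  have : (2 : ℝ) / 2 ^ k ≤ 2 * (1 / 2) ^ k₀ := by
    rw [one_div, inv_pow, ← div_eq_mul_inv]
    gcongr
    norm_num
  linarith

theorem exists_single_rnd_mem [Fintype ι] {U : Set (ι → ℝ)} (hU : IsOpen U) {x : ι → ℝ} (hx : x ∈ U) :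
    ∃ k₀, ∀ k ≥ k₀, single (rnd k x) ∈ Ch k U ∧
      ∀ f : (ι → ℝ) → ZMod 2, ContinuousOn f U → eval k f (single (rnd k x)) = f x := by
  obtain ⟨δ, hδ, hb⟩ := Metric.isOpen_iff.1 hU x hx
  obtain ⟨k₀, hk₀⟩ := exists_scale hδ
  refine ⟨k₀, fun k hk => ?_⟩
  have hm : pt k (rnd k x) ∈ Metric.ball x δ := (dist_pt_rnd k x).trans_lt (hk₀ k hk)
  refine ⟨single_mem ?_, fun f hf => ?_⟩
  · rw [cell_of_even (rnd_emod k x), singleton_subset_iff]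
    exact hb hm
  · rw [eval_single k f (rnd_emod k x)]
    exact (convex_ball x δ).isPreconnected.constant (hf.mono hb) hm (Metric.mem_ball_self hδ)

theorem single_rnd_pt (j : ℕ) {c : ι → ℤ} (hc : ∀ i, c i % 2 = 0) :
    single (rnd (k + j) (pt k c)) = sdv^[j] (single c) := by
  rw [rnd_pt j hc, sdv_iterate_single j hc]

section
variable [Fintype ι] [DecidableEq ι]

theorem bd_single_succ {c : ι → ℤ} (hc : ∀ i, c i % 2 = 0) (i : ι) :
    bd (single (Function.update c i (c i + 1))) =
      single c - single (Function.update c i (c i + 2)) := by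
  have h : ∀ j, bdAt j (single (Function.update c i (c i + 1))) = if j = i then
      single c - single (Function.update c i (c i + 2)) else 0 := by
    intro j
    split_ifs with hj
    · subst hj
      ext d
      have e1 : (Function.update d j (d j - 1) = Function.update c j (c j + 1)) ↔
          d = Function.update c j (c j + 2) := by
        constructor
        · intro h
          have h1 := congrFun h j
          simp only [Function.update_self] at h1
          ext l
          by_cases hl : l = j
          · subst hl; simp; omega
          · have := congrFun h l; simpa [hl] using this
        · rintro rfl
          simp only [Function.update_self, Function.update_idem]
          congr 1; omega
      have e2 : (Function.update d j (d j + 1) = Function.update c j (c j + 1)) ↔ d = c := by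
        constructor
        · intro h
          have h1 := congrFun h j
          simp only [Function.update_self] at h1
          ext l
          by_cases hl : l = j
          · subst hl; omega
          · have := congrFun h l; simpa [hl] using this
        · rintro rfl; rfl
      simp only [bdAt_apply, single, Pi.single_apply, Pi.sub_apply, e1, e2]
      by_cases hd : d j % 2 = 0
      · rw [if_pos hd, add_comm, sub_eq_add_neg, ZModModule.neg_eq_self]
        congr
      · have h1 : d ≠ c := by rintro rfl; exact hd (hc j)
        have h2 : d ≠ Function.update c j (c j + 2) := by
          rintro rfl
          have := hc j
          simp at hd
          omega
        simp [hd, h1, h2]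
    · ext d
      simp only [bdAt_apply, single, Pi.single_apply, Pi.zero_apply]
      split_ifs with h0 h1 h2 h2
      · have := congrFun h1 j; simp [hj] at this; have := hc j; omega
      · have := congrFun h1 j; simp [hj] at this; have := hc j; omega
      · have := congrFun h2 j; simp [hj] at this; have := hc j; omega
      · simp
      · rfl
  rw [show bd (single (Function.update c i (c i + 1))) =
    ∑ j, bdAt j (single (Function.update c i (c i + 1))) by simp [bd]]
  simp [h]

variable {U V : Set (ι → ℝ)} {k : ℕ}

theorem bds_single_sub_single {a b : ι → ℤ}
    (hU : ∀ x : ι → ℝ, (∀ i, (a i : ℝ) ≤ 2 ^ k * x i ∧ 2 ^ k * x i ≤ b i) → x ∈ U)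
    {c c' : ι → ℤ} (hc : ∀ i, c i % 2 = 0) (hc' : ∀ i, c' i % 2 = 0)
    (h : ∀ i, a i ≤ c i ∧ c i ≤ b i) (h' : ∀ i, a i ≤ c' i ∧ c' i ≤ b i) :
    Bds V k U (single c - single c') := by
  obtain ⟨N, hN⟩ : ∃ N, ∑ i, (c i - c' i).natAbs = N := ⟨_, rfl⟩
  induction N using Nat.strong_induction_on generalizing c c' with
  | _ N ih =>
  by_cases he : c = c'
  · rw [he, sub_self]; exact .zero
  obtain ⟨i, hi⟩ := Function.ne_iff.1 he
  wlog hlt : c i < c' i generalizing c c'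
  · have := (this hc' hc h' h (by rw [← hN]; simp only [← Int.natAbs_neg (c _ - _), neg_sub])
      (Ne.symm he) hi.symm (by omega)).neg
    rwa [neg_sub] at this
  have hi0 := hc i
  have hi0' := hc' i
  have h1 : Bds V k U (single c - single (Function.update c i (c i + 2))) := by
    refine .of_bd (single_mem (c := Function.update c i (c i + 1)) ?_)
      (by rw [bd_single_succ hc, sub_self]; exact zero_mem _)
    intro x hx
    refine hU x fun j => ?_
    have hxj := abs_le.1 (hx j)
    by_cases hj : j = i
    · subst hj
      have e : (c j + 1) % 2 = 1 := by omega
      simp only [Function.update_self, e] at hxj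
      have h3 : (a j : ℝ) ≤ c j := by exact_mod_cast (h j).1
      have h4 : (c j : ℝ) + 2 ≤ b j := by
        have := (h' j).2
        exact_mod_cast (by omega : c j + 2 ≤ b j)
      push_cast at hxj
      constructor <;> linarith
    · simp only [Function.update_of_ne hj, hc j, Int.cast_zero] at hxj
      have h3 : (a j : ℝ) ≤ c j := by exact_mod_cast (h j).1
      have h4 : (c j : ℝ) ≤ b j := by exact_mod_cast (h j).2
      constructor <;> linarith
  have h2 : Bds V k U (single (Function.update c i (c i + 2)) - single c') := by
    refine ih _ ?_ (fun j => ?_) hc' (fun j => ?_) h' rfl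
    · rw [← hN]
      refine Finset.sum_lt_sum (fun j _ => ?_) ⟨i, Finset.mem_univ i, ?_⟩
      · by_cases hj : j = i
        · subst hj; simp; omega
        · simp [hj]
      · simp; omega
    · by_cases hj : j = i
      · subst hj; simpa using hi0
      · simpa [hj] using hc j
    · by_cases hj : j = i
      · subst hj
        have := h j; have := h' j
        simp; omega
      · simpa [hj] using h j
  have := h1.add h2
  rwa [sub_add_sub_cancel] at this

/-- Points of a connected subset of `U` are homologous in `U`. -/
theorem exists_bds_rnd_sub_rnd (hU : IsOpen U) {C : Set (ι → ℝ)} (hC : IsPreconnected C)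
    (hCU : C ⊆ U) {x y : ι → ℝ} (hx : x ∈ C) (hy : y ∈ C) :
    ∃ k₀, ∀ k ≥ k₀, Bds V k U (single (rnd k x) - single (rnd k y)) := by
  refine hC.induction₂ (fun x y => ∃ k₀, ∀ k ≥ k₀, Bds V k U (single (rnd k x) - single (rnd k y)))
    ?_ ?_ ?_ hx hy
  · intro x hx
    obtain ⟨δ, hδ, hb⟩ := Metric.isOpen_iff.1 hU x (hCU hx)
    refine mem_nhdsWithin_of_mem_nhds ?_
    filter_upwards [Metric.ball_mem_nhds x (half_pos hδ)] with y hy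
    obtain ⟨k₀, hk₀⟩ := exists_scale (half_pos hδ)
    refine ⟨k₀, fun k hk => ?_⟩
    have h2 : (0 : ℝ) < 2 ^ k := by positivity
    have hx' : dist (pt k (rnd k x)) x < δ := (dist_pt_rnd k x).trans_lt
      ((hk₀ k hk).trans (half_lt_self hδ))
    have hy' : dist (pt k (rnd k y)) x < δ := by
      have h1 := (dist_pt_rnd k y).trans_lt (hk₀ k hk)
      have h2 := dist_triangle (pt k (rnd k y)) y x
      rw [Metric.mem_ball] at hy
      linarith
    refine bds_single_sub_single (a := fun i => min (rnd k x i) (rnd k y i))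
      (b := fun i => max (rnd k x i) (rnd k y i)) (fun p hp => hb ?_) (rnd_emod k x)
      (rnd_emod k y) (fun i => ⟨min_le_left _ _, le_max_left _ _⟩)
      (fun i => ⟨min_le_right _ _, le_max_right _ _⟩)
    rw [Metric.mem_ball, dist_pi_lt_iff hδ]
    intro i
    have h3 := abs_lt.1 ((dist_le_pi_dist (pt k (rnd k x)) x i).trans_lt hx')
    have h4 := abs_lt.1 ((dist_le_pi_dist (pt k (rnd k y)) x i).trans_lt hy')
    have h5 := hp i
    push_cast at h5
    have e : ∀ c : ι → ℤ, (c i : ℝ) = 2 ^ k * pt k c i := fun c => by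
      simp only [pt]; field_simp
    rw [e, e, ← mul_min_of_nonneg _ _ h2.le, ← mul_max_of_nonneg _ _ h2.le,
      mul_le_mul_iff_right₀ h2, mul_le_mul_iff_right₀ h2] at h5
    rw [Real.dist_eq, abs_lt]
    constructor
    · rcases min_choice (pt k (rnd k x) i) (pt k (rnd k y) i) with h | h <;> rw [h] at h5 <;>
        linarith
    · rcases max_choice (pt k (rnd k x) i) (pt k (rnd k y) i) with h | h <;> rw [h] at h5 <;>
        linarith
  · rintro x y z - - - ⟨k₀, h⟩ ⟨k₁, h'⟩
    refine ⟨max k₀ k₁, fun k hk => ?_⟩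
    have := (h k (le_of_max_le_left hk)).add (h' k (le_of_max_le_right hk))
    rwa [sub_add_sub_cancel] at this
  · rintro x y - - ⟨k₀, h⟩
    refine ⟨k₀, fun k hk => ?_⟩
    have := (h k hk).neg
    rwa [neg_sub] at this

/-- A zero dimensional chain on which the locally constant functions on `U` vanish bounds. -/
theorem bds_of_eval_eq_zero (hU : IsOpen U) (hV : IsOpen V) {z : Chain ι} (hz : z ∈ Ch k U)
    (hd : Deg 0 z) (h : ∀ f : (ι → ℝ) → ZMod 2, ContinuousOn f U → (∀ x ∈ V, f x = 0) →
      eval k f z = 0) : Bds V k U z := by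
  classical
  obtain ⟨N, hN⟩ : ∃ N, z.support.ncard = N := ⟨_, rfl⟩
  induction N using Nat.strong_induction_on generalizing z with
  | _ N ih =>
  have heven : ∀ c, z c ≠ 0 → ∀ i, c i % 2 = 0 := by
    intro c hc i
    have := (Finset.sum_eq_zero_iff_of_nonneg
      (fun i _ => Int.emod_nonneg (c i) (by norm_num : (2 : ℤ) ≠ 0))).1 (hd c hc) i
      (Finset.mem_univ i)
    exact this
  have hone : ∀ c, z c ≠ 0 → z c = 1 := fun c => by
    generalize z c = a
    revert a
    decide
  have hfin := finite_support hz
  have hsub : ∀ c, z c ≠ 0 → Bds V k U (single c) → Bds V k U z := by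
    intro c hc hb
    have hs : single c ∈ Ch k U := single_mem (hz.2 c hc)
    have hsupp : (z - single c).support ⊆ z.support \ {c} := by
      intro d hd
      by_cases hdc : d = c
      · subst hdc; simp [single, hone d hc] at hd
      · simpa [single, hdc] using hd
    have := ih _ ?_ (sub_mem hz hs) (fun d hd' => hd d (hsupp hd').1) (fun f hf hf' => ?_) rfl
    · have := this.add hb
      rwa [sub_add_cancel] at this
    · rw [← hN]
      refine Set.ncard_lt_ncard (hsupp.trans_ssubset ?_) hfin
      exact sdiff_singleton_ssubset.2 hc
    · rw [sub_eq_add_neg, eval_add _ _ hfin (finite_support (neg_mem hs)),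
        h f hf hf', hb.neg.eval_eq_zero hf hf', add_zero]
  by_cases hz0 : z = 0
  · rw [hz0]; exact .zero
  obtain ⟨c, hc⟩ := Function.ne_iff.1 hz0
  have hcU : pt k c ∈ U := hz.2 c hc (pt_mem_cell k c)
  set C := connectedComponentIn U (pt k c) with hCdef
  have hcC : pt k c ∈ C := mem_connectedComponentIn hcU
  have hCU : C ⊆ U := connectedComponentIn_subset _ _
  have hC : IsPreconnected C := isPreconnected_connectedComponentIn
  by_cases hCV : (C ∩ V).Nonempty
  · obtain ⟨x, hxC, hxV⟩ := hCV
    obtain ⟨k₀, hk₀⟩ := exists_bds_rnd_sub_rnd (V := V) hU hC hCU hcC hxC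
    obtain ⟨k₁, hk₁⟩ := exists_single_rnd_mem hV hxV
    refine hsub c hc (.of_iterate (i := k₀ + k₁) ?_)
    rw [← single_rnd_pt _ (heven c hc)]
    exact (sub_add_cancel _ (single (rnd (k + (k₀ + k₁)) x))) ▸
      (hk₀ _ (by omega)).add (.of_mem (hk₁ _ (by omega)).1)
  by_cases hC2 : ∃ c', c' ≠ c ∧ z c' ≠ 0 ∧ pt k c' ∈ C
  · obtain ⟨c', hcc, hc', hc'C⟩ := hC2
    obtain ⟨k₀, hk₀⟩ := exists_bds_rnd_sub_rnd (V := V) hU hC hCU hcC hc'C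
    have hb : Bds V k U (single c - single c') := by
      refine .of_iterate (i := k₀) ?_
      rw [iterate_map_sub, ← single_rnd_pt _ (heven c hc), ← single_rnd_pt _ (heven c' hc')]
      exact hk₀ _ (by omega)
    have hs : single c - single c' ∈ Ch k U :=
      sub_mem (single_mem (hz.2 c hc)) (single_mem (hz.2 c' hc'))
    have hsupp : (z - (single c - single c')).support ⊆ z.support \ {c} := by
      intro d hd
      by_cases hdc : d = c
      · subst hdc; simp [single, hone d hc, hcc.symm] at hd
      · by_cases hdc' : d = c'
        · subst hdc'; exact ⟨hc', hdc⟩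
        · simpa [single, hdc, hdc'] using hd
    have := ih _ ?_ (sub_mem hz hs) (fun d hd' => hd d (hsupp hd').1) (fun f hf hf' => ?_) rfl
    · have := this.add hb
      rwa [sub_add_cancel] at this
    · rw [← hN]
      refine Set.ncard_lt_ncard (hsupp.trans_ssubset ?_) hfin
      exact sdiff_singleton_ssubset.2 hc
    · rw [sub_eq_add_neg, eval_add _ _ hfin (finite_support (neg_mem hs)),
        h f hf hf', hb.neg.eval_eq_zero hf hf', add_zero]
  · exfalso
    push Not at hC2
    have hf : ContinuousOn (C.indicator 1 : (ι → ℝ) → ZMod 2) U :=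
      continuousOn_indicator_connectedComponentIn hU _
    have h1 := h _ hf fun x hx => indicator_of_notMem (fun hxC => hCV ⟨x, hxC, hx⟩) _
    rw [eval, finsum_eq_single _ c] at h1
    · simp [heven c hc, hcC, hone c hc] at h1
    · intro d hd
      by_cases hzd : z d = 0
      · simp [hzd]
      · simp [hC2 d hd hzd]

end

end CubicalDuality

namespace CubicalDuality

open Set Topology
open scoped InnerProductSpace

theorem isOpen_outer (ι : Type) (M : ℝ) : IsOpen (outer ι M) := by
  rw [show outer ι M = ⋃ i, {x | M < |x i|} by ext; simp [outer]]
  exact isOpen_iUnion fun i => isOpen_lt continuous_const (by fun_prop)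

theorem eval_congr {ι : Type} {k : ℕ} {f g : (ι → ℝ) → ZMod 2} {U : Set (ι → ℝ)} {z : Chain ι}
    (hz : z ∈ Ch k U) (h : EqOn f g U) : eval k f z = eval k g z := by
  refine finsum_congr fun c => ?_
  by_cases hc : z c = 0
  · simp [hc]
  · rw [h (hz.2 c hc (pt_mem_cell k c))]

theorem deg_single {ι : Type} [Fintype ι] {c : ι → ℤ} (hc : ∀ i, c i % 2 = 0) :
    Deg 0 (single c) := by
  classical
  intro d hd
  have : d = c := by
    by_contra h
    exact hd (by simp [single, h])
  simp [this, hc]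

theorem Deg.sub {ι : Type} [Fintype ι] {d : ℤ} {z w : Chain ι} (hz : Deg d z) (hw : Deg d w) :
    Deg d (z - w) := by
  intro c hc
  by_cases h : z c = 0
  · exact hw c fun h' => hc (by simp [h, h'])
  · exact hz c h

theorem bd_eq_zero_of_deg {ι : Type} [Fintype ι] [DecidableEq ι] {z : Chain ι} (h : Deg 0 z) :
    bd z = 0 := by
  by_contra h0
  obtain ⟨c, hc⟩ := Function.ne_iff.1 h0
  have h1 := h.bd c hc
  have h2 : 0 ≤ ∑ i, c i % 2 := Finset.sum_nonneg fun i _ => Int.emod_nonneg _ (by norm_num)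
  omega

section Caps
variable {E : Type} [NormedAddCommGroup E] [InnerProductSpace ℝ E]
  {ι : Type} {h : Metric.sphere (0 : E) 1 → ι → ℝ} {M : ℝ} {u : E} {s : ℝ}

theorem isClosed_cap (u : E) (s : ℝ) :
    IsClosed {x : Metric.sphere (0 : E) 1 | ⟪u, (x : E)⟫_ℝ ≤ s} :=
  isClosed_le (by fun_prop) continuous_const

theorem compl_inter_compl_caps :
    (h '' {x : Metric.sphere (0 : E) 1 | ⟪u, (x : E)⟫_ℝ ≤ s})ᶜ ∩
      (h '' {x : Metric.sphere (0 : E) 1 | ⟪-u, (x : E)⟫_ℝ ≤ -s})ᶜ = (range h)ᶜ := by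
  rw [← compl_union, ← image_union, ← image_univ]
  congr 2
  ext x
  simp [le_total]

theorem compl_union_compl_caps
    (hi : ∀ p : Metric.sphere (0 : E) 1, s ≤ ⟪u, (p : E)⟫_ℝ → ∀ q, h q = h p → q = p) :
    (h '' {x : Metric.sphere (0 : E) 1 | ⟪u, (x : E)⟫_ℝ ≤ s})ᶜ ∪
      (h '' {x : Metric.sphere (0 : E) 1 | ⟪-u, (x : E)⟫_ℝ ≤ -s})ᶜ =
      (h '' {x : Metric.sphere (0 : E) 1 | ⟪u, (x : E)⟫_ℝ = s})ᶜ := by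
  rw [← compl_inter]
  congr 1
  ext y
  constructor
  · rintro ⟨⟨a, ha, rfl⟩, b, hb, hab⟩
    simp only [mem_ofPred_eq, inner_neg_left, neg_le_neg_iff] at ha hb
    have := hi b hb a hab.symm
    subst this
    exact ⟨a, le_antisymm ha hb, rfl⟩
  · rintro ⟨a, ha, rfl⟩
    simp only [mem_ofPred_eq] at ha
    exact ⟨⟨a, ha.le, rfl⟩, a, by simp [ha], rfl⟩

theorem range_comp_sphereSlice (hu : ‖u‖ = 1) (hs : -1 < s) (hs' : s < 1) :
    range (h ∘ sphereSlice hu hs hs') =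
      h '' {x : Metric.sphere (0 : E) 1 | ⟪u, (x : E)⟫_ℝ = s} := by
  rw [range_comp, range_sphereSlice]

theorem injective_comp_sphereSlice (hu : ‖u‖ = 1) (hs : -1 < s) (hs' : s < 1)
    (hi : ∀ p : Metric.sphere (0 : E) 1, s ≤ ⟪u, (p : E)⟫_ℝ → ∀ q, h q = h p → q = p) :
    Function.Injective (h ∘ sphereSlice hu hs hs') := by
  intro y y' hy
  refine sphereSlice_injective hu hs hs' (hi _ ?_ _ hy)
  exact (inner_slice hu y').ge

variable [FiniteDimensional ℝ E]

theorem isOpen_compl_image (hc : Continuous h) {K : Set (Metric.sphere (0 : E) 1)}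
    (hK : IsClosed K) : IsOpen (h '' K)ᶜ :=
  (hK.isCompact.image hc).isClosed.isOpen_compl

variable [Fintype ι]

theorem bds_compl_level_set [DecidableEq ι] (hM : 1 ≤ M) (hc : Continuous h)
    (hb : ∀ x i, |h x i| ≤ M) (hu : ‖u‖ = 1) (hs : -1 < s) (hs' : s < 1)
    (hi : ∀ p : Metric.sphere (0 : E) 1, s ≤ ⟪u, (p : E)⟫_ℝ → ∀ q, h q = h p → q = p)
    {k : ℕ} {z : Chain ι}
    (hz : z ∈ Ch k (h '' {x : Metric.sphere (0 : E) 1 | ⟪u, (x : E)⟫_ℝ ≤ s})ᶜ)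
    (hbz : bd z ∈ Ch k (outer ι M)) :
    Bds (outer ι M) k (h '' {x : Metric.sphere (0 : E) 1 | ⟪u, (x : E)⟫_ℝ = s})ᶜ z := by
  let e := (Module.finBasis ℝ E).equivFunL
  let J₀ : Metric.sphere (0 : E) 1 → Fin (Module.finrank ℝ E) → ℝ :=
    fun x => e ((s - ⟪u, (x : E)⟫_ℝ) • (x : E))
  have hJ₀ : Continuous J₀ := e.continuous.comp (by fun_prop)
  obtain ⟨R, hR, hRb⟩ := exists_bound hJ₀
  have hR0 : 0 < R := one_pos.trans_le hR
  have hJ₀z : ∀ x, R⁻¹ • J₀ x = 0 ↔ ⟪u, (x : E)⟫_ℝ = s := by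
    intro x
    have hx : (x : E) ≠ 0 := by
      intro h0
      have := mem_sphere_zero_iff_norm.1 x.2
      simp [h0] at this
    simp only [J₀, smul_eq_zero, inv_eq_zero, hR0.ne', false_or,
      EmbeddingLike.map_eq_zero_iff, hx, or_false, sub_eq_zero]
    exact eq_comm
  have key := bds_of_graph (isCell_cap hu hs hs') (zero_le_one.trans hM) _ (h := h)
    (J := fun x => R⁻¹ • J₀ x) hc (by fun_prop) ?_ (fun x _ => hb x) ?_ hz hbz
  · convert key using 4
    ext x
    simp only [mem_ofPred_eq, hJ₀z]
    exact ⟨fun h => ⟨h.le, h⟩, fun h => h.2⟩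
  · intro x hx x' hx' hxx
    simp only [Prod.mk.injEq] at hxx
    by_cases h1 : ⟪u, (x : E)⟫_ℝ = s
    · exact (hi x h1.ge x' hxx.1.symm).symm
    have h2 : J₀ x = J₀ x' := smul_right_injective _ (inv_ne_zero hR0.ne') hxx.2
    have h3 := e.injective h2
    have n1 := mem_sphere_zero_iff_norm.1 x.2
    have n2 := mem_sphere_zero_iff_norm.1 x'.2
    have h4 := congrArg norm h3
    simp only [mem_ofPred_eq] at hx hx'
    rw [norm_smul, norm_smul, n1, n2, mul_one, mul_one, Real.norm_of_nonneg (by linarith),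
      Real.norm_of_nonneg (by linarith)] at h4
    rw [← h4] at h3
    exact Subtype.ext (smul_right_injective E (sub_ne_zero.2 (Ne.symm h1)) h3)
  · intro x _ i
    rw [Pi.smul_apply, smul_eq_mul, abs_mul, abs_of_pos (inv_pos.2 hR0)]
    have := hRb x i
    refine le_trans ?_ hM
    rw [inv_mul_le_iff₀ hR0]
    linarith

/-- The image of the cap `s ≤ ⟪u, x⟫` on which `h` is injective separates: some locally constant
function on the complement of the image of `h` does not extend across it. -/
theorem exists_not_extend (hE : Module.finrank ℝ E = Fintype.card ι) (hM : 1 ≤ M)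
    (hc : Continuous h) (hb : ∀ x i, |h x i| ≤ M) (hu : ‖u‖ = 1) (hs : -1 < s) (hs' : s < 1)
    (hi : ∀ p : Metric.sphere (0 : E) 1, s ≤ ⟪u, (p : E)⟫_ℝ → ∀ q, h q = h p → q = p) :
    ∃ f : (ι → ℝ) → ZMod 2, ContinuousOn f (range h)ᶜ ∧ (∀ x ∈ outer ι M, f x = 0) ∧
      ¬ ∃ g : (ι → ℝ) → ZMod 2,
        ContinuousOn g (h '' {x : Metric.sphere (0 : E) 1 | ⟪u, (x : E)⟫_ℝ ≤ s})ᶜ ∧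
        (∀ x ∈ outer ι M, g x = 0) ∧ EqOn f g (range h)ᶜ := by
  classical
  have hu0 : u ≠ 0 := by rintro rfl; simp at hu
  have : Nontrivial E := ⟨u, 0, hu0⟩
  obtain ⟨d, hd⟩ := Nat.exists_eq_succ_of_ne_zero (Module.finrank_pos (R := ℝ) (M := E)).ne'
  have : Fact (Module.finrank ℝ E = d + 1) := ⟨hd⟩
  obtain ⟨-, k, w, hw, hbw, hdw, hnw⟩ := sphere_duality d (ℝ ∙ u)ᗮ
      (Submodule.finrank_orthogonal_span_singleton hu0) (M := M) (h := h ∘ sphereSlice hu hs hs') hM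
      (hc.comp (sphereSlice_continuous _ _ _)) (injective_comp_sphereSlice hu hs hs' hi)
      (fun _ => hb _)
  rw [range_comp_sphereSlice, ← compl_union_compl_caps hi] at hw hnw
  have o₁ := isOpen_compl_image hc (isClosed_cap u s)
  have o₂ := isOpen_compl_image hc (isClosed_cap (-u) (-s))
  have hcell : IsCell (h '' {x : Metric.sphere (0 : E) 1 | ⟪-u, (x : E)⟫_ℝ ≤ -s}) := by
    refine (isCell_cap (by rwa [norm_neg]) (by linarith) (by linarith)).image hc.continuousOn ?_
    intro x hx y hy hxy
    simp only [mem_ofPred_eq, inner_neg_left, neg_le_neg_iff] at hx hy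
    exact hi y hy x hxy
  have a₂ := hcell.acyc (M := M) (by rintro - ⟨x, -, rfl⟩; exact hb x)
  obtain ⟨j, z, hz, hbz, hdz, hz₁, hnz⟩ := exists_connecting o₁ o₂
    (fun k z hz hbz => by
      rw [compl_union_compl_caps hi]
      exact bds_compl_level_set hM hc hb hu hs hs' hi hz hbz)
    (fun k z hz hz' => (a₂ k z hz hz').mono subset_union_right) hw hbw
  have o : IsOpen (range h)ᶜ := by
    rw [← image_univ]; exact isOpen_compl_image hc isClosed_univ
  have hdz : Deg 0 z := by
    have := hdz _ hdw
    rw [← hE, hd] at this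
    simpa using this
  rw [compl_inter_compl_caps] at hz hnz
  by_contra! hcon
  refine hnw (hnz (bds_of_eval_eq_zero o (isOpen_outer ι M) hz hdz fun f hf hf' => ?_))
  obtain ⟨g, hg, hgM, hfg⟩ := hcon f hf hf'
  rw [eval_congr hz hfg]
  exact hz₁.eval_eq_zero hg hgM

/-- Of three points which cannot be separated by locally constant functions outside of the image
of the cap `⟪u, x⟫ ≤ s`, two cannot be separated outside of the image of `h`. -/
theorem not_separated_of_three (hM : 1 ≤ M)
    (hc : Continuous h) (hb : ∀ x i, |h x i| ≤ M) (hu : ‖u‖ = 1) (hs : -1 < s) (hs' : s < 1)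
    (hi : ∀ p : Metric.sphere (0 : E) 1, s ≤ ⟪u, (p : E)⟫_ℝ → ∀ q, h q = h p → q = p)
    {p q t : ι → ℝ} (hp : p ∈ (range h)ᶜ) (hq : q ∈ (range h)ᶜ) (ht : t ∈ (range h)ᶜ)
    (H : ∀ f : (ι → ℝ) → ZMod 2,
      ContinuousOn f (h '' {x : Metric.sphere (0 : E) 1 | ⟪u, (x : E)⟫_ℝ ≤ s})ᶜ →
      (∀ x ∈ outer ι M, f x = 0) → f p = f q ∧ f p = f t) :
    ∃ x y, ((x = p ∧ y = q) ∨ (x = p ∧ y = t) ∨ (x = q ∧ y = t)) ∧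
      ∀ f : (ι → ℝ) → ZMod 2, ContinuousOn f (range h)ᶜ →
        (∀ x ∈ outer ι M, f x = 0) → f x = f y := by
  classical
  have hu0 : u ≠ 0 := by rintro rfl; simp at hu
  have : Nontrivial E := ⟨u, 0, hu0⟩
  obtain ⟨d, hd⟩ := Nat.exists_eq_succ_of_ne_zero (Module.finrank_pos (R := ℝ) (M := E)).ne'
  have : Fact (Module.finrank ℝ E = d + 1) := ⟨hd⟩
  obtain ⟨h1, -⟩ := sphere_duality d (ℝ ∙ u)ᗮ
      (Submodule.finrank_orthogonal_span_singleton hu0) (M := M) (h := h ∘ sphereSlice hu hs hs') hM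
      (hc.comp (sphereSlice_continuous _ _ _)) (injective_comp_sphereSlice hu hs hs' hi)
      (fun _ => hb _)
  rw [range_comp_sphereSlice, ← compl_union_compl_caps hi] at h1
  have o₁ := isOpen_compl_image hc (isClosed_cap u s)
  have o₂ := isOpen_compl_image hc (isClosed_cap (-u) (-s))
  have o : IsOpen (range h)ᶜ := by
    rw [← image_univ]; exact isOpen_compl_image hc isClosed_univ
  have hcell : IsCell (h '' {x : Metric.sphere (0 : E) 1 | ⟪-u, (x : E)⟫_ℝ ≤ -s}) := by
    refine (isCell_cap (by rwa [norm_neg]) (by linarith) (by linarith)).image hc.continuousOn ?_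
    intro x hx y hy hxy
    simp only [mem_ofPred_eq, inner_neg_left, neg_le_neg_iff] at hx hy
    exact hi y hy x hxy
  have a₂ := hcell.acyc (M := M) (by rintro - ⟨x, -, rfl⟩; exact hb x)
  obtain ⟨k₁, hk₁⟩ := exists_single_rnd_mem o hp
  obtain ⟨k₂, hk₂⟩ := exists_single_rnd_mem o hq
  obtain ⟨k₃, hk₃⟩ := exists_single_rnd_mem o ht
  obtain ⟨k, hkk⟩ : ∃ k, k = k₁ + k₂ + k₃ := ⟨_, rfl⟩
  obtain ⟨mp, ep⟩ := hk₁ k (by omega)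
  obtain ⟨mq, eq⟩ := hk₂ k (by omega)
  obtain ⟨mt, et⟩ := hk₃ k (by omega)
  have hsub₁ : (range h)ᶜ ⊆ (h '' {x : Metric.sphere (0 : E) 1 | ⟪u, (x : E)⟫_ℝ ≤ s})ᶜ :=
    compl_subset_compl.2 (image_subset_range _ _)
  have hsub₂ : (range h)ᶜ ⊆ (h '' {x : Metric.sphere (0 : E) 1 | ⟪-u, (x : E)⟫_ℝ ≤ -s})ᶜ :=
    compl_subset_compl.2 (image_subset_range _ _)
  have hev : ∀ {x y : ι → ℝ}, single (rnd k x) ∈ Ch k (range h)ᶜ →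
      single (rnd k y) ∈ Ch k (range h)ᶜ → ∀ f : (ι → ℝ) → ZMod 2,
      eval k f (single (rnd k x) - single (rnd k y)) =
        eval k f (single (rnd k x)) - eval k f (single (rnd k y)) := by
    intro x y hx hy f
    rw [sub_eq_add_neg, sub_eq_add_neg, eval_add _ _ (finite_support hx)
      (finite_support (neg_mem hy)), ZModModule.neg_eq_self, ZModModule.neg_eq_self]
  have b₁ : ∀ {y : ι → ℝ}, single (rnd k y) ∈ Ch k (range h)ᶜ →
      (∀ f : (ι → ℝ) → ZMod 2, ContinuousOn f (range h)ᶜ → eval k f (single (rnd k y)) = f y) →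
      (∀ f : (ι → ℝ) → ZMod 2,
        ContinuousOn f (h '' {x : Metric.sphere (0 : E) 1 | ⟪u, (x : E)⟫_ℝ ≤ s})ᶜ →
        (∀ x ∈ outer ι M, f x = 0) → f p = f y) →
      Bds (outer ι M) k (h '' {x : Metric.sphere (0 : E) 1 | ⟪u, (x : E)⟫_ℝ ≤ s})ᶜ
        (single (rnd k p) - single (rnd k y)) := by
    intro y my ey Hy
    refine bds_of_eval_eq_zero o₁ (isOpen_outer ι M) (Ch_mono hsub₁ (sub_mem mp my))
      ((deg_single (rnd_emod k p)).sub (deg_single (rnd_emod k y))) fun f hf hf' => ?_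
    rw [hev mp my, ep f (hf.mono hsub₁), ey f (hf.mono hsub₁), Hy f hf hf', sub_self]
  have b₂ : ∀ {y : ι → ℝ}, single (rnd k y) ∈ Ch k (range h)ᶜ →
      Bds (outer ι M) k (h '' {x : Metric.sphere (0 : E) 1 | ⟪-u, (x : E)⟫_ℝ ≤ -s})ᶜ
        (single (rnd k p) - single (rnd k y)) := by
    intro y my
    refine a₂ k _ (Ch_mono hsub₂ (sub_mem mp my)) ?_
    rw [bd_eq_zero_of_deg ((deg_single (rnd_emod k p)).sub (deg_single (rnd_emod k y)))]
    exact zero_mem _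
  have hfin := h1.bds_inter o₁ o₂ (b₁ mq eq fun f hf hf' => (H f hf hf').1) (b₂ mq)
    (b₁ mt et fun f hf hf' => (H f hf hf').2) (b₂ mt)
  rw [compl_inter_compl_caps] at hfin
  rcases hfin with hB | hB | hB
  · refine ⟨p, q, by tauto, fun f hf hf' => ?_⟩
    have := hB.eval_eq_zero hf hf'
    rw [hev mp mq, ep f hf, eq f hf] at this
    exact sub_eq_zero.1 this
  · refine ⟨p, t, by tauto, fun f hf hf' => ?_⟩
    have := hB.eval_eq_zero hf hf'
    rw [hev mp mt, ep f hf, et f hf] at this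
    exact sub_eq_zero.1 this
  · refine ⟨q, t, by tauto, fun f hf hf' => ?_⟩
    have := hB.neg.eval_eq_zero hf hf'
    rw [sub_sub_sub_cancel_left, neg_sub, hev mq mt, eq f hf, et f hf] at this
    exact sub_eq_zero.1 this

end Caps

end CubicalDuality

namespace CubicalDuality

open Set Topology
open scoped InnerProductSpace

section
variable {F : Type} [NormedAddCommGroup F] [InnerProductSpace ℝ F]

/-- Stereographic projection from `q`, in coordinates. -/
theorem exists_stereographic_coordinates {m : ℕ} [Fact (Module.finrank ℝ F = m + 1)]
    (q : Metric.sphere (0 : F) 1) :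
    ∃ (φ : Metric.sphere (0 : F) 1 → Fin m → ℝ) (ψ : (Fin m → ℝ) → Metric.sphere (0 : F) 1),
      ContinuousOn φ {q}ᶜ ∧ Continuous ψ ∧ (∀ y ≠ q, ψ (φ y) = y) ∧ (∀ x, φ (ψ x) = x) ∧
      ∀ x, ψ x ≠ q := by
  let e := stereographic' m q
  let c := EuclideanSpace.equiv (Fin m) ℝ
  have hs : e.source = {q}ᶜ := stereographic'_source q
  have ht : e.target = univ := stereographic'_target q
  refine ⟨fun y => c (e y), fun x => e.symm (c.symm x), ?_, ?_, ?_, ?_, ?_⟩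
  · rw [← hs]
    exact c.continuous.comp_continuousOn e.continuousOn
  · have := e.continuousOn_symm
    rw [ht, continuousOn_univ] at this
    exact this.comp c.symm.continuous
  · intro y hy
    simp only [ContinuousLinearEquiv.symm_apply_apply]
    exact e.left_inv (by rw [hs]; exact hy)
  · intro x
    simp only
    rw [e.right_inv (by rw [ht]; trivial), ContinuousLinearEquiv.apply_symm_apply]
  · intro x
    have := e.map_target (x := c.symm x) (by rw [ht]; trivial)
    rw [hs] at this
    exact this

theorem neBot_nhdsWithin_sphere (h : 1 < Module.finrank ℝ F) (x : Metric.sphere (0 : F) 1) :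
    (𝓝[≠] x).NeBot := by
  have : FiniteDimensional ℝ F := Module.finite_of_finrank_pos (by omega)
  have : ConnectedSpace (Metric.sphere (0 : F) 1) :=
    isConnected_iff_connectedSpace.1 (isConnected_sphere (by
      rw [← Module.finrank_eq_rank]; exact_mod_cast h) 0 zero_le_one)
  have : Nontrivial (Metric.sphere (0 : F) 1) := by
    refine ⟨x, -x, fun h => ?_⟩
    have h1 : (x : F) = -x := congrArg Subtype.val h
    have h2 := mem_sphere_zero_iff_norm.1 x.2
    have h3 : (2 : ℝ) • (x : F) = 0 := by
      rw [two_smul]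
      nth_rw 2 [h1]
      exact add_neg_cancel _
    rw [(smul_eq_zero_iff_right two_ne_zero).1 h3] at h2
    simp at h2
  infer_instance

variable {E : Type} [NormedAddCommGroup E] [InnerProductSpace ℝ E] [FiniteDimensional ℝ E]
  {m : ℕ} {f : Metric.sphere (0 : E) 1 → Metric.sphere (0 : F) 1} {u : E} {s : ℝ}

/-- A map injective on a cap cannot cover a sphere of larger dimension. -/
theorem exists_notMem_range [FiniteDimensional ℝ F] [Fact (Module.finrank ℝ F = m + 1 + 1)]
    (hE : Module.finrank ℝ E = m + 1) (hf : Continuous f) (hu : ‖u‖ = 1) (hs : -1 < s)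
    (hs' : s < 1)
    (hi : ∀ p : Metric.sphere (0 : E) 1, s ≤ ⟪u, (p : E)⟫_ℝ → ∀ q, f q = f p → q = p) :
    (range f)ᶜ.Nonempty := by
  by_contra hne
  rw [not_nonempty_iff_eq_empty, compl_empty_iff] at hne
  have : Fact (Module.finrank ℝ E = m + 1) := ⟨hE⟩
  let K := {x : Metric.sphere (0 : E) 1 | ⟪u, (x : E)⟫_ℝ ≤ s}
  let D := {x : Metric.sphere (0 : E) 1 | s ≤ ⟪u, (x : E)⟫_ℝ}
  have hDc : IsClosed D := isClosed_le continuous_const (by fun_prop)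
  let p₀ : Metric.sphere (0 : E) 1 := ⟨u, mem_sphere_zero_iff_norm.2 hu⟩
  have hp₀ : ⟪u, (p₀ : E)⟫_ℝ = 1 := by
    change ⟪u, u⟫_ℝ = 1
    rw [real_inner_self_eq_norm_sq, hu]; norm_num
  have hO : IsOpen (f '' K)ᶜ := ((isClosed_cap u s).isCompact.image hf).isClosed.isOpen_compl
  have hfp : f p₀ ∈ (f '' K)ᶜ := by
    rintro ⟨x, hx, hxp⟩
    have := hi p₀ (by linarith) x hxp
    subst this
    have hx' : ⟪u, (p₀ : E)⟫_ℝ ≤ s := hx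
    linarith
  have hsub : (f '' K)ᶜ ⊆ f '' D := by
    intro y hy
    obtain ⟨x, rfl⟩ : y ∈ range f := hne ▸ mem_univ y
    refine ⟨x, ?_, rfl⟩
    by_contra hx
    have hx' : ⟪u, (x : E)⟫_ℝ < s := not_le.1 hx
    exact hy ⟨x, hx'.le, rfl⟩
  obtain ⟨ε, hε, hball⟩ := Metric.isOpen_iff.1 hO _ hfp
  have hv : ‖((f p₀ : Metric.sphere (0 : F) 1) : F)‖ = 1 := mem_sphere_zero_iff_norm.1 (f p₀).2
  obtain ⟨t, ht, ht', htε⟩ : ∃ t : ℝ, -1 < t ∧ t < 1 ∧ 2 - 2 * t < ε ^ 2 := by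
    have h0 : 0 < min 1 (ε ^ 2 / 4) := by positivity
    have h1 := min_le_left 1 (ε ^ 2 / 4)
    have h2 := min_le_right 1 (ε ^ 2 / 4)
    have h3 : 0 < ε ^ 2 := by positivity
    exact ⟨1 - min 1 (ε ^ 2 / 4), by linarith, by linarith, by linarith⟩
  let σ := sphereSlice hv ht ht'
  have hσ : ∀ y, σ y ∈ f '' D := by
    intro y
    apply hsub
    apply hball
    have h1 : ⟪((f p₀ : Metric.sphere (0 : F) 1) : F), (σ y : F)⟫_ℝ = t := inner_slice hv y
    have h2 : ‖(σ y : F)‖ = 1 := mem_sphere_zero_iff_norm.1 (σ y).2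
    rw [Metric.mem_ball, Subtype.dist_eq, dist_eq_norm]
    refine lt_of_pow_lt_pow_left₀ 2 hε.le ?_
    rw [norm_sub_sq_real, real_inner_comm, h1, h2, hv]
    linarith
  choose g hgD hg using hσ
  let fD : D → Metric.sphere (0 : F) 1 := fun x => f x
  have hfD : IsEmbedding fD := by
    have : CompactSpace D := isCompact_iff_compactSpace.1 hDc.isCompact
    refine (Continuous.isClosedEmbedding (hf.comp continuous_subtype_val) ?_).isEmbedding
    intro x y hxy
    exact Subtype.ext (hi y y.2 x hxy)
  have hgc : Continuous g := by
    have : Continuous fun y => (⟨g y, hgD y⟩ : D) := by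
      rw [hfD.continuous_iff]
      refine (sphereSlice_continuous hv ht ht').congr fun y => ?_
      exact (hg y).symm
    exact continuous_subtype_val.comp this
  have hgi : Function.Injective g := by
    intro y y' h
    apply sphereSlice_injective hv ht ht'
    change σ y = σ y'
    rw [← hg, ← hg, h]
  obtain ⟨φ, ψ, hφ, -, hψφ, -, -⟩ := exists_stereographic_coordinates (m := m) (-p₀)
  have hgn : ∀ y, g y ≠ -p₀ := by
    intro y hy
    have := hgD y
    simp only [D, mem_ofPred_eq, hy] at this
    rw [show ((-p₀ : Metric.sphere (0 : E) 1) : E) = -(p₀ : E) from rfl, inner_neg_right,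
      hp₀] at this
    linarith
  have hF : ((f p₀ : Metric.sphere (0 : F) 1) : F) ≠ 0 := by
    intro h; rw [h] at hv; simp at hv
  refine not_injective_of_sphere (E := (ℝ ∙ ((f p₀ : Metric.sphere (0 : F) 1) : F))ᗮ)
    (ι := Fin m) (h := fun y => φ (g y)) ?_ ?_ ?_
  · rw [Submodule.finrank_orthogonal_span_singleton (n := m + 1) hF, Fintype.card_fin]
  · exact hφ.comp_continuous hgc hgn
  · intro y y' h
    apply hgi
    rw [← hψφ _ (hgn y), ← hψφ _ (hgn y')]
    exact congrArg ψ h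

end

/-- A locally constant function vanishing outside of a cube extends by zero to the point at
infinity `q`. -/
theorem continuousOn_extend {Y : Type*} [TopologicalSpace Y] [T2Space Y] {m : ℕ} {q : Y}
    {φ : Y → Fin m → ℝ}
    {ψ : (Fin m → ℝ) → Y} (hφ : ContinuousOn φ {q}ᶜ) (hψ : Continuous ψ)
    (hψφ : ∀ y ≠ q, ψ (φ y) = y) (hψq : ∀ x, ψ x ≠ q) {M : ℝ} {a : (Fin m → ℝ) → ZMod 2}
    {U : Set Y} (ha : ContinuousOn a (ψ ⁻¹' U))
    (haM : ∀ x ∈ outer (Fin m) M, a x = 0) (b : Y → ZMod 2) (hbq : b q = 0)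
    (hb : ∀ y ≠ q, b y = a (φ y)) : ContinuousOn b U := by
  have hcube : IsClosed (ψ '' (outer (Fin m) M)ᶜ) := by
    refine (IsCompact.image ?_ hψ).isClosed
    refine Metric.isCompact_of_isClosed_isBounded (isOpen_outer _ _).isClosed_compl ?_
    refine (Metric.isBounded_closedBall (x := 0) (r := max M 0)).subset fun x hx => ?_
    rw [mem_closedBall_zero_iff, pi_norm_le_iff_of_nonneg (le_max_right _ _)]
    intro i
    by_contra h
    exact hx ⟨i, (le_max_left _ _).trans_lt (not_le.1 h)⟩
  intro y hy
  by_cases hyq : y = q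
  · refine ContinuousAt.continuousWithinAt ((continuousAt_const (y := 0)).congr ?_)
    filter_upwards [hcube.isOpen_compl.mem_nhds (x := y)
      (by rintro ⟨x, -, hx⟩; exact hψq x (hx.trans hyq))] with y' hy'
    by_cases hyq' : y' = q
    · rw [hyq', hbq]
    · rw [hb _ hyq', haM]
      by_contra h
      exact hy' ⟨φ y', h, hψφ y' hyq'⟩
  · have h1 : ContinuousWithinAt (a ∘ φ) (U ∩ {q}ᶜ) y := by
      refine ContinuousWithinAt.comp (t := ψ ⁻¹' U) (ha _ ?_) ?_ ?_
      · rw [mem_preimage, hψφ y hyq]; exact hy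
      · exact (hφ y hyq).mono inter_subset_right
      · rintro y' ⟨h1, h2⟩
        rw [mem_preimage, hψφ y' h2]; exact h1
    rw [ContinuousWithinAt, nhdsWithin_inter_of_mem' (mem_nhdsWithin_of_mem_nhds
      (isOpen_compl_singleton.mem_nhds hyq))] at h1
    have h2 : ContinuousWithinAt (a ∘ φ) U y := h1
    refine h2.congr_of_eventuallyEq ?_ (hb y hyq)
    filter_upwards [mem_nhdsWithin_of_mem_nhds (isOpen_compl_singleton.mem_nhds hyq)] with z hz
    exact hb z hz

/-- A locally constant function near the point at infinity `q` is constant on the complement of a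
cube contained in its domain. -/
theorem eq_of_mem_outer {Y : Type*} [TopologicalSpace Y] [CompactSpace Y] {m : ℕ} {q : Y}
    {φ : Y → Fin m → ℝ}
    {ψ : (Fin m → ℝ) → Y} (hφ : ContinuousOn φ {q}ᶜ) (hψ : Continuous ψ)
    (hφψ : ∀ x, φ (ψ x) = x)
    {M : ℝ} (hM : 1 ≤ M) {U : Set Y} (hq : q ∈ U)
    (hU : ∀ x ∈ outer (Fin m) M, ψ x ∈ U) {b : Y → ZMod 2}
    (hb : ContinuousOn b U) {x : Fin m → ℝ} (hx : x ∈ outer (Fin m) M) : b (ψ x) = b q := by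
  let R := (fun t : ℝ => ψ (t • x)) '' Ici 1
  have hR : IsPreconnected R := isPreconnected_Ici.image _ (by fun_prop)
  obtain ⟨i, hi⟩ := hx
  have hRU : R ⊆ U := by
    rintro - ⟨t, ht, rfl⟩
    refine hU _ ⟨i, ?_⟩
    rw [Pi.smul_apply, smul_eq_mul, abs_mul, abs_of_pos (one_pos.trans_le ht)]
    have : (1 : ℝ) ≤ t := ht
    nlinarith
  have hqR : q ∈ closure R := by
    rw [mem_closure_iff]
    intro N hN hqN
    have hK : IsCompact (φ '' Nᶜ) := hN.isClosed_compl.isCompact.image_of_continuousOn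
      (hφ.mono fun y hy hyq => hy (hyq ▸ hqN))
    obtain ⟨B, hB⟩ := hK.isBounded.exists_norm_le
    refine ⟨ψ ((|B| + 1) • x), ?_, |B| + 1, ?_, rfl⟩
    · by_contra h
      have h1 := hB _ (mem_image_of_mem φ h)
      rw [hφψ] at h1
      have h2 := (norm_le_pi_norm ((|B| + 1) • x) i).trans h1
      rw [Pi.smul_apply, smul_eq_mul, Real.norm_eq_abs, abs_mul,
        abs_of_pos (by positivity : 0 < |B| + 1)] at h2
      have h3 := le_abs_self B
      have h4 := abs_nonneg B
      nlinarith
    · simp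
  have h1 : IsPreconnected (insert q R) :=
    hR.subset_closure (subset_insert _ _) (insert_subset hqR subset_closure)
  exact h1.constant (hb.mono (insert_subset hq hRU))
    (mem_insert_of_mem _ ⟨1, by simp, by simp⟩) (mem_insert _ _)

end CubicalDuality

namespace CubicalDuality

open Set Topology
open scoped InnerProductSpace

theorem preimage_compl_image_eq {X Y Z : Type*} {f : X → Y} {φ : Y → Z} {ψ : Z → Y} {q : Y}
    (hq : q ∉ range f) (hψφ : ∀ y ≠ q, ψ (φ y) = y) (hφψ : ∀ x, φ (ψ x) = x) (K : Set X) :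
    ψ ⁻¹' (f '' K)ᶜ = ((φ ∘ f) '' K)ᶜ := by
  rw [preimage_compl]
  congr 1
  ext x
  constructor
  · rintro ⟨k, hk, h⟩
    exact ⟨k, hk, by rw [Function.comp_apply, h, hφψ]⟩
  · rintro ⟨k, hk, rfl⟩
    exact ⟨k, hk, (hψφ _ fun h => hq ⟨k, h⟩).symm⟩

section
variable {E F : Type} [NormedAddCommGroup E] [InnerProductSpace ℝ E] [FiniteDimensional ℝ E]
  [NormedAddCommGroup F] [InnerProductSpace ℝ F] [FiniteDimensional ℝ F]
  {m : ℕ}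
  {f : Metric.sphere (0 : E) 1 → Metric.sphere (0 : F) 1} {u : E} {s : ℝ}

/-- The cap `s ≤ ⟪u, x⟫` separates: some locally constant function on the complement of the range
of `f` does not extend across the image of the cap. -/
theorem exists_not_extend_sphere [Fact (Module.finrank ℝ F = m + 1 + 1)]
    (hE : Module.finrank ℝ E = m + 1) (hf : Continuous f)
    (hu : ‖u‖ = 1) (hs : -1 < s) (hs' : s < 1)
    (hi : ∀ p : Metric.sphere (0 : E) 1, s ≤ ⟪u, (p : E)⟫_ℝ → ∀ q, f q = f p → q = p) :
    ∃ b : Metric.sphere (0 : F) 1 → ZMod 2, ContinuousOn b (range f)ᶜ ∧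
      ¬ ∃ g : Metric.sphere (0 : F) 1 → ZMod 2,
        ContinuousOn g (f '' {x : Metric.sphere (0 : E) 1 | ⟪u, (x : E)⟫_ℝ ≤ s})ᶜ ∧
        EqOn b g (range f)ᶜ := by
  classical
  obtain ⟨q, hq⟩ := exists_notMem_range (m := m) hE hf hu hs hs' hi
  obtain ⟨φ, ψ, hφ, hψ, hψφ, hφψ, hψq⟩ := exists_stereographic_coordinates (m := m + 1) q
  have hfq : ∀ x, f x ≠ q := fun x h => hq ⟨x, h⟩
  have hc : Continuous (φ ∘ f) := hφ.comp_continuous hf hfq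
  obtain ⟨M, hM, hb⟩ := exists_bound hc
  have hr : ψ ⁻¹' (range f)ᶜ = (range (φ ∘ f))ᶜ := by
    rw [← image_univ, ← image_univ]
    exact preimage_compl_image_eq hq hψφ hφψ univ
  obtain ⟨a, ha, haM, hne⟩ := exists_not_extend (by rw [hE, Fintype.card_fin]) hM hc hb hu hs hs'
    (fun p hp x hx => hi p hp x (by
      rw [← hψφ _ (hfq x), ← hψφ _ (hfq p)]; exact congrArg ψ hx))
  refine ⟨fun y => if y = q then 0 else a (φ y), ?_, ?_⟩
  · refine continuousOn_extend hφ hψ hψφ hψq (a := a) (M := M) (by rwa [hr]) haM _ (by simp) ?_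
    intro y hy
    simp [hy]
  · rintro ⟨g, hg, hag⟩
    have key : EqOn a (g ∘ ψ) (range (φ ∘ f))ᶜ := by
      intro x hx
      rw [← hr] at hx
      have := hag hx
      simpa [hψq, hφψ] using this
    refine hne ⟨g ∘ ψ, ?_, ?_, key⟩
    · rw [← preimage_compl_image_eq hq hψφ hφψ]
      exact hg.comp hψ.continuousOn (mapsTo_preimage _ _)
    · intro x hx
      rw [← key, haM x hx]
      rintro ⟨y, rfl⟩
      obtain ⟨i, hi⟩ := hx
      exact (hb y i).not_gt hi

/-- Of three points which cannot be separated outside of the image of the cap `⟪u, x⟫ ≤ s`, two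
cannot be separated outside of the range of `f`. -/
theorem not_separated_of_three_sphere (hF : Module.finrank ℝ F = m + 1 + 1) (hf : Continuous f)
    (hu : ‖u‖ = 1) (hs : -1 < s) (hs' : s < 1)
    (hi : ∀ p : Metric.sphere (0 : E) 1, s ≤ ⟪u, (p : E)⟫_ℝ → ∀ q, f q = f p → q = p)
    {p₁ p₂ p₃ : Metric.sphere (0 : F) 1} (h₁ : p₁ ∈ (range f)ᶜ) (h₂ : p₂ ∈ (range f)ᶜ)
    (h₃ : p₃ ∈ (range f)ᶜ)
    (H : ∀ b : Metric.sphere (0 : F) 1 → ZMod 2,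
      ContinuousOn b (f '' {x : Metric.sphere (0 : E) 1 | ⟪u, (x : E)⟫_ℝ ≤ s})ᶜ →
      b p₁ = b p₂ ∧ b p₁ = b p₃) :
    ∃ x y, ((x = p₁ ∧ y = p₂) ∨ (x = p₁ ∧ y = p₃) ∨ (x = p₂ ∧ y = p₃)) ∧
      ∀ b : Metric.sphere (0 : F) 1 → ZMod 2, ContinuousOn b (range f)ᶜ → b x = b y := by
  classical
  have : Fact (Module.finrank ℝ F = m + 1 + 1) := ⟨hF⟩
  have ho : IsOpen (range f)ᶜ := (isCompact_range hf).isClosed.isOpen_compl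
  have : ∀ x : Metric.sphere (0 : F) 1, (𝓝[≠] x).NeBot :=
    neBot_nhdsWithin_sphere (by omega)
  obtain ⟨q, hq, hq'⟩ := (infinite_of_mem_nhds p₁ (ho.mem_nhds h₁)).exists_notMem_finset
    {p₁, p₂, p₃}
  simp only [Finset.mem_insert, Finset.mem_singleton, not_or] at hq'
  obtain ⟨n₁, n₂, n₃⟩ := hq'
  obtain ⟨φ, ψ, hφ, hψ, hψφ, hφψ, hψq⟩ := exists_stereographic_coordinates (m := m + 1) q
  have hfq : ∀ x, f x ≠ q := fun x h => hq ⟨x, h⟩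
  have hc : Continuous (φ ∘ f) := hφ.comp_continuous hf hfq
  obtain ⟨M, hM, hb⟩ := exists_bound hc
  have hr : ψ ⁻¹' (range f)ᶜ = (range (φ ∘ f))ᶜ := by
    rw [← image_univ, ← image_univ]
    exact preimage_compl_image_eq hq hψφ hφψ univ
  have hmem : ∀ y ∈ (range f)ᶜ, y ≠ q → φ y ∈ (range (φ ∘ f))ᶜ := by
    intro y hy hyq
    rw [← hr, mem_preimage, hψφ y hyq]
    exact hy
  obtain ⟨x, y, hxy, h⟩ := not_separated_of_three hM hc hb hu hs hs'
    (fun p hp x hx => hi p hp x (by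
      rw [← hψφ _ (hfq x), ← hψφ _ (hfq p)]; exact congrArg ψ hx))
    (hmem _ h₁ (Ne.symm n₁)) (hmem _ h₂ (Ne.symm n₂)) (hmem _ h₃ (Ne.symm n₃)) (fun a ha haM => by
      rw [← preimage_compl_image_eq hq hψφ hφψ] at ha
      have := H (fun y => if y = q then 0 else a (φ y)) (continuousOn_extend hφ hψ hψφ hψq ha haM _
        (by simp) (fun y hy => by simp [hy]))
      simpa [Ne.symm n₁, Ne.symm n₂, Ne.symm n₃] using this)
  refine ⟨ψ x, ψ y, ?_, fun b hb' => ?_⟩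
  · rcases hxy with ⟨rfl, rfl⟩ | ⟨rfl, rfl⟩ | ⟨rfl, rfl⟩ <;>
      simp [hψφ _ (Ne.symm n₁), hψφ _ (Ne.symm n₂), hψφ _ (Ne.symm n₃)]
  · have ho' : ∀ x ∈ outer (Fin (m + 1)) M, ψ x ∈ (range f)ᶜ := by
      intro x hx
      rw [← mem_preimage, hr]
      rintro ⟨y, rfl⟩
      obtain ⟨i, hi⟩ := hx
      exact (hb y i).not_gt hi
    have := h (fun x => b (ψ x) - b q)
      ((hb'.comp hψ.continuousOn (fun x hx => by rwa [← hr] at hx)).sub continuousOn_const)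
      (fun x hx => sub_eq_zero.2 (eq_of_mem_outer hφ hψ hφψ hM hq ho' hb' hx))
    exact sub_left_injective this

end

/-- A component of an open set `W` whose closure meets a connected set `D` is contained in the
component of `W ∪ D` containing `D`. -/
theorem connectedComponentIn_subset_of_closure_inter {X : Type*} [TopologicalSpace X]
    [LocallyConnectedSpace X] {W U D : Set X} (hU : IsOpen U) (hWU : W ⊆ U)
    (hDU : D ⊆ U) (hD : IsPreconnected D) {d y : X} (hd : d ∈ D) (hy : y ∈ W)
    (h : (closure (connectedComponentIn W y) ∩ D).Nonempty) : y ∈ connectedComponentIn U d := by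
  obtain ⟨z, hz, hzD⟩ := h
  have hzT : z ∈ connectedComponentIn U d := hD.subset_connectedComponentIn hd hDU hzD
  obtain ⟨t, ht, ht'⟩ := mem_closure_iff.1 hz _ hU.connectedComponentIn hzT
  have h1 := isPreconnected_connectedComponentIn.subset_connectedComponentIn ht'
    ((connectedComponentIn_subset W y).trans hWU) (mem_connectedComponentIn hy)
  rwa [← connectedComponentIn_eq ht] at h1

theorem closure_inter_nonempty_of_mem {X : Type*} [TopologicalSpace X]
    [LocallyConnectedSpace X] {W U D : Set X} (hW : IsOpen W) (hUWD : U ⊆ W ∪ D)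
    {d y : X} (hd : d ∈ D) (hdU : d ∈ U) (hy : y ∈ W)
    (h : y ∈ connectedComponentIn U d) : (closure (connectedComponentIn W y) ∩ D).Nonempty := by
  by_contra hcon
  rw [not_nonempty_iff_eq_empty, ← disjoint_iff_inter_eq_empty] at hcon
  have hclos : ∀ z ∈ closure (connectedComponentIn W y), z ∈ W → z ∈ connectedComponentIn W y := by
    intro z hz hzW
    obtain ⟨t, ht, ht'⟩ := mem_closure_iff.1 hz _ hW.connectedComponentIn
      (mem_connectedComponentIn hzW)
    rw [connectedComponentIn_eq ht', ← connectedComponentIn_eq ht]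
    exact mem_connectedComponentIn hzW
  obtain ⟨z, -, hz1, hz2⟩ := isPreconnected_connectedComponentIn (F := U) (x := d)
    (connectedComponentIn W y) (closure (connectedComponentIn W y))ᶜ hW.connectedComponentIn
    isClosed_closure.isOpen_compl
    (by
      intro z hz
      by_cases hzc : z ∈ closure (connectedComponentIn W y)
      · left
        rcases hUWD (connectedComponentIn_subset U d hz) with h1 | h1
        · exact hclos z hzc h1
        · exact absurd h1 (disjoint_left.1 hcon hzc)
      · exact Or.inr hzc)
    ⟨y, h, mem_connectedComponentIn hy⟩
    ⟨d, mem_connectedComponentIn hdU, fun h => disjoint_left.1 hcon h hd⟩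
  exact hz2 (subset_closure hz1)

end CubicalDuality

namespace CubicalDuality

open Set Topology
open scoped InnerProductSpace

/-- A locally constant function on `W` which is constant on the part of `W` inside a component of
`U ⊇ W` extends to `U` if this component contains `U \ W`. -/
theorem exists_continuousOn_extension {X : Type*} [TopologicalSpace X] [LocallyConnectedSpace X]
    {W U : Set X} (hW : IsOpen W) (hU : IsOpen U) {d : X}
    (hUW : ∀ y ∈ U, y ∉ connectedComponentIn U d → y ∈ W) {b : X → ZMod 2}
    (hb : ContinuousOn b W)
    (h : ∀ y ∈ W ∩ connectedComponentIn U d, ∀ z ∈ W ∩ connectedComponentIn U d, b y = b z) :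
    ∃ g : X → ZMod 2, ContinuousOn g U ∧ EqOn b g W := by
  classical
  obtain ⟨a, ha⟩ : ∃ a, ∀ y ∈ W ∩ connectedComponentIn U d, b y = a := by
    rcases (W ∩ connectedComponentIn U d).eq_empty_or_nonempty with h0 | ⟨z, hz⟩
    · exact ⟨0, by simp [h0]⟩
    · exact ⟨b z, fun y hy => h y hy z hz⟩
  refine ⟨fun y => if y ∈ connectedComponentIn U d then a else b y, fun y hy => ?_, fun y hy => ?_⟩
  · apply ContinuousAt.continuousWithinAt
    by_cases hyT : y ∈ connectedComponentIn U d
    · refine (continuousAt_const (y := a)).congr ?_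
      filter_upwards [hU.connectedComponentIn.mem_nhds hyT] with z hz
      simp [hz]
    · refine (hb.continuousAt (hW.mem_nhds (hUW y hy hyT))).congr ?_
      filter_upwards [hU.connectedComponentIn.mem_nhds (mem_connectedComponentIn hy)] with z hz
      rw [if_neg]
      intro hzT
      rw [connectedComponentIn_eq hzT, ← connectedComponentIn_eq hz] at hyT
      exact hyT (mem_connectedComponentIn hy)
  · by_cases hyT : y ∈ connectedComponentIn U d
    · simp [hyT, ha y ⟨hy, hyT⟩]
    · simp [hyT]

section
variable {E F : Type} [NormedAddCommGroup E] [InnerProductSpace ℝ E] [FiniteDimensional ℝ E]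
  [NormedAddCommGroup F] [InnerProductSpace ℝ F] [FiniteDimensional ℝ F]
  {m : ℕ} [Fact (Module.finrank ℝ F = m + 1 + 1)]
  {f : Metric.sphere (0 : E) 1 → Metric.sphere (0 : F) 1} {u : E} {s : ℝ}

/-- There are precisely two components of the complement of the range of `f` whose closure meets
the image of the open cap `s < ⟪u, x⟫`. -/
theorem exists_two_components (hE : Module.finrank ℝ E = m + 1) (hf : Continuous f)
    (hu : ‖u‖ = 1) (hs : -1 < s) (hs' : s < 1)
    (hi : ∀ p : Metric.sphere (0 : E) 1, s ≤ ⟪u, (p : E)⟫_ℝ → ∀ q, f q = f p → q = p) :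
    ∃ y₁ ∈ (range f)ᶜ, ∃ y₂ ∈ (range f)ᶜ,
      connectedComponentIn (range f)ᶜ y₁ ≠ connectedComponentIn (range f)ᶜ y₂ ∧
      (closure (connectedComponentIn (range f)ᶜ y₁) ∩
        f '' {x : Metric.sphere (0 : E) 1 | s < ⟪u, (x : E)⟫_ℝ}).Nonempty ∧
      (closure (connectedComponentIn (range f)ᶜ y₂) ∩
        f '' {x : Metric.sphere (0 : E) 1 | s < ⟪u, (x : E)⟫_ℝ}).Nonempty ∧
      ∀ y ∈ (range f)ᶜ, (closure (connectedComponentIn (range f)ᶜ y) ∩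
        f '' {x : Metric.sphere (0 : E) 1 | s < ⟪u, (x : E)⟫_ℝ}).Nonempty →
        connectedComponentIn (range f)ᶜ y = connectedComponentIn (range f)ᶜ y₁ ∨
          connectedComponentIn (range f)ᶜ y = connectedComponentIn (range f)ᶜ y₂ := by
  have : LocallyConnectedSpace (Metric.sphere (0 : F) 1) :=
    ChartedSpace.locallyConnectedSpace (EuclideanSpace ℝ (Fin (m + 1))) _
  set W := (range f)ᶜ with hWdef
  set K := {x : Metric.sphere (0 : E) 1 | ⟪u, (x : E)⟫_ℝ ≤ s} with hK
  set D := {x : Metric.sphere (0 : E) 1 | s < ⟪u, (x : E)⟫_ℝ} with hD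
  have hW : IsOpen W := (isCompact_range hf).isClosed.isOpen_compl
  have hU : IsOpen (f '' K)ᶜ := isClosed_cap u s |>.isCompact.image hf |>.isClosed.isOpen_compl
  have hWU : W ⊆ (f '' K)ᶜ := compl_subset_compl.2 (image_subset_range f K)
  have hDU : f '' D ⊆ (f '' K)ᶜ := by
    rintro - ⟨x, hx, rfl⟩ ⟨y, hy, hyx⟩
    have hx' : s < ⟪u, (x : E)⟫_ℝ := hx
    have hy' : ⟪u, (y : E)⟫_ℝ ≤ s := hy
    have := hi x hx'.le y hyx
    subst this
    linarith
  have hUWD : (f '' K)ᶜ ⊆ W ∪ f '' D := by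
    intro y hy
    by_cases h : y ∈ range f
    · obtain ⟨x, rfl⟩ := h
      refine Or.inr ⟨x, ?_, rfl⟩
      by_contra hx
      have hx' : ⟪u, (x : E)⟫_ℝ ≤ s := not_lt.1 hx
      exact hy ⟨x, hx', rfl⟩
    · exact Or.inl h
  have hDp : IsPreconnected (f '' D) := by
    refine IsPreconnected.image ?_ f hf.continuousOn
    have := isPreconnected_cap (u := -u) (s := -s) (by rwa [norm_neg]) (by linarith)
    simpa only [inner_neg_left, neg_lt_neg_iff] using this
  obtain ⟨d, hd⟩ : (f '' D).Nonempty := by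
    refine ⟨_, ⟨u, mem_sphere_zero_iff_norm.2 hu⟩, ?_, rfl⟩
    change s < ⟪u, u⟫_ℝ
    rw [real_inner_self_eq_norm_sq, hu]
    linarith
  have hmeet : ∀ y ∈ W, (closure (connectedComponentIn W y) ∩ f '' D).Nonempty ↔
      y ∈ connectedComponentIn (f '' K)ᶜ d := fun y hy =>
    ⟨connectedComponentIn_subset_of_closure_inter hU hWU hDU hDp hd hy,
      closure_inter_nonempty_of_mem hW hUWD hd (hDU hd) hy⟩
  obtain ⟨b, hb, hne⟩ := exists_not_extend_sphere hE hf hu hs hs' hi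
  obtain ⟨y₁, hy₁, y₂, hy₂, h₁₂⟩ : ∃ y₁ ∈ W ∩ connectedComponentIn (f '' K)ᶜ d,
      ∃ y₂ ∈ W ∩ connectedComponentIn (f '' K)ᶜ d, b y₁ ≠ b y₂ := by
    by_contra! h
    refine hne (exists_continuousOn_extension hW hU (fun y hy hyT => ?_) hb h)
    exact (hUWD hy).resolve_right fun h => hyT (hDp.subset_connectedComponentIn hd hDU h)
  have h₁₂' : connectedComponentIn W y₁ ≠ connectedComponentIn W y₂ := by
    intro h
    refine h₁₂ (isPreconnected_connectedComponentIn.constant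
      (hb.mono (connectedComponentIn_subset W y₁)) (mem_connectedComponentIn hy₁.1) ?_)
    rw [h]
    exact mem_connectedComponentIn hy₂.1
  refine ⟨y₁, hy₁.1, y₂, hy₂.1, h₁₂', (hmeet _ hy₁.1).2 hy₁.2, (hmeet _ hy₂.1).2 hy₂.2,
    fun y hy hyD => ?_⟩
  rw [hmeet y hy] at hyD
  have hsame : ∀ x ∈ W, ∀ z ∈ W,
      (∀ b : Metric.sphere (0 : F) 1 → ZMod 2, ContinuousOn b W → b x = b z) →
      connectedComponentIn W z = connectedComponentIn W x := by
    intro x hx z hz h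
    have h1 := h _ (continuousOn_indicator_connectedComponentIn hW x)
    rw [indicator_of_mem (mem_connectedComponentIn hx)] at h1
    by_cases hzx : z ∈ connectedComponentIn W x
    · exact (connectedComponentIn_eq hzx).symm
    · rw [indicator_of_notMem hzx] at h1
      simp at h1
  have hconst : ∀ g : Metric.sphere (0 : F) 1 → ZMod 2, ContinuousOn g (f '' K)ᶜ →
      g y₁ = g y₂ ∧ g y₁ = g y := fun g hg =>
    have h := hg.mono (connectedComponentIn_subset (f '' K)ᶜ d)
    ⟨isPreconnected_connectedComponentIn.constant h hy₁.2 hy₂.2,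
      isPreconnected_connectedComponentIn.constant h hy₁.2 hyD⟩
  obtain ⟨x, z, hxz, h⟩ :=
    not_separated_of_three_sphere (m := m) Fact.out hf hu hs hs' hi hy₁.1 hy₂.1 hy hconst
  rcases hxz with ⟨rfl, rfl⟩ | ⟨rfl, rfl⟩ | ⟨rfl, rfl⟩
  · exact absurd (hsame _ hy₁.1 _ hy₂.1 h).symm h₁₂'
  · exact Or.inl (hsame _ hy₁.1 _ hy h)
  · exact Or.inr (hsame _ hy₂.1 _ hy h)

end

end CubicalDuality

open scoped InnerProductSpace in
theorem CubicalDuality.dist_sq_eq {E : Type} [NormedAddCommGroup E] [InnerProductSpace ℝ E]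
    (x y : Metric.sphere (0 : E) 1) : dist y x ^ 2 = 2 - 2 * ⟪(x : E), (y : E)⟫_ℝ := by
  rw [Subtype.dist_eq, dist_eq_norm, norm_sub_sq_real, mem_sphere_zero_iff_norm.1 x.2,
    mem_sphere_zero_iff_norm.1 y.2, real_inner_comm]
  ring

/-- Let `n ≥ 1` and let `f : Sⁿ → Sⁿ⁺¹` be a continuous map whose set of
injectivity contains the closed metric ball `D` of radius `0 < r < 1` about `x₀ ∈ Sⁿ`.
Then there are precisely two connected components of `Sⁿ⁺¹ \ f(Sⁿ)` whose closure
intersects `f(D°)`. -/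
theorem two_components_meet_image_of_disk_interior
    (n : ℕ) (hn : 1 ≤ n)
    (f : (Metric.sphere (0 : EuclideanSpace ℝ (Fin (n + 1))) 1) →
         (Metric.sphere (0 : EuclideanSpace ℝ (Fin (n + 2))) 1))
    (hf : Continuous f)
    (x₀ : Metric.sphere (0 : EuclideanSpace ℝ (Fin (n + 1))) 1)
    (r : ℝ) (hr0 : 0 < r) (hr1 : r < 1)
    (hinj : ∀ p, dist p x₀ ≤ r → ∀ q, f q = f p → q = p) :
    ∃ C₁ C₂ : Set (Metric.sphere (0 : EuclideanSpace ℝ (Fin (n + 2))) 1),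
      C₁ ≠ C₂ ∧
      IsConnCompIn (Set.range f)ᶜ C₁ ∧ IsConnCompIn (Set.range f)ᶜ C₂ ∧
      (closure C₁ ∩ f '' {x | dist x x₀ < r}).Nonempty ∧
      (closure C₂ ∩ f '' {x | dist x x₀ < r}).Nonempty ∧
      ∀ C, IsConnCompIn (Set.range f)ᶜ C →
        (closure C ∩ f '' {x | dist x x₀ < r}).Nonempty → C = C₁ ∨ C = C₂ := by
  have hF : Fact (Module.finrank ℝ (EuclideanSpace ℝ (Fin (n + 2))) = n + 1 + 1) :=
    ⟨finrank_euclideanSpace_fin⟩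
  have hD : {x : Metric.sphere (0 : EuclideanSpace ℝ (Fin (n + 1))) 1 | dist x x₀ < r} =
      {x : Metric.sphere (0 : EuclideanSpace ℝ (Fin (n + 1))) 1 |
        1 - r ^ 2 / 2 < inner ℝ (x₀ : EuclideanSpace ℝ (Fin (n + 1))) x} := by
    ext x
    have h := CubicalDuality.dist_sq_eq x₀ x
    rw [Set.mem_ofPred_eq, Set.mem_ofPred_eq, ← pow_lt_pow_iff_left₀ dist_nonneg hr0.le two_ne_zero]
    constructor <;> intro h' <;> linarith
  have hr : r ^ 2 < 1 := by nlinarith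
  have hr' : 0 < r ^ 2 := by positivity
  obtain ⟨y₁, hy₁, y₂, hy₂, h⟩ := CubicalDuality.exists_two_components (m := n) (f := f)
    (u := (x₀ : EuclideanSpace ℝ (Fin (n + 1)))) (s := 1 - r ^ 2 / 2) finrank_euclideanSpace_fin hf
    (mem_sphere_zero_iff_norm.1 x₀.2) (by linarith) (by linarith) (fun p hp => hinj p (by
      refine le_of_sq_le_sq ?_ hr0.le
      rw [CubicalDuality.dist_sq_eq]
      linarith))
  rw [← hD] at h
  obtain ⟨h₁, h₂, h₃, h₄⟩ := h
  refine ⟨_, _, h₁, ⟨y₁, hy₁, rfl⟩, ⟨y₂, hy₂, rfl⟩, h₂, h₃, ?_⟩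
  rintro - ⟨y, hy, rfl⟩ hC
  exact h₄ y hy hC
end

section
/- Let n ≥ 1 and let f : S^n → S^{n+1} be a continuous map whose set of injectivity I contains the closed metric ball D := {x ∈ S^n : |x − x₀| ≤ r} for some x₀ ∈ S^n and 0 < r < 1. If C and C′ are connected components of S^{n+1} \ f(S^n) whose closures intersect f(D°), then C and C′ lie in the same connected component of S^{n+1} \ f(S^n \ D°). -/
/-- Two preconnected sets, one of which meets the closure of the other, have preconnected union. -/
theorem IsPreconnected.union_of_closure_inter_nonempty {α : Type*} [TopologicalSpace α]
    {s t : Set α} (hs : IsPreconnected s) (ht : IsPreconnected t)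
    (h : (closure s ∩ t).Nonempty) : IsPreconnected (s ∪ t) := by
  obtain ⟨p, hps, hpt⟩ := h
  have hs' : IsPreconnected (insert p s) :=
    hs.subset_closure (Set.subset_insert p s) (Set.insert_subset hps subset_closure)
  have := hs'.union p (Set.mem_insert p s) hpt ht
  rwa [Set.insert_union, Set.insert_eq_of_mem (Set.mem_union_right s hpt)] at this

/-- An open ball of radius at most `√2` in the unit sphere of a real inner product space, for the
induced metric, is preconnected. -/
theorem isPreconnected_ball_unitSphere {E : Type*} [NormedAddCommGroup E] [InnerProductSpace ℝ E]
    (x₀ : Metric.sphere (0 : E) 1) {r : ℝ} (hr0 : 0 < r) (hr : r ^ 2 ≤ 2) :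
    IsPreconnected {x : Metric.sphere (0 : E) 1 | dist x x₀ < r} := by
  have hx₀ : ‖(x₀ : E)‖ = 1 := norm_eq_of_mem_sphere x₀
  have key (x : E) (hx : ‖x‖ = 1) : dist x x₀ < r ↔ 1 - r ^ 2 / 2 < inner ℝ x (x₀ : E) := by
    rw [← sq_lt_sq₀ dist_nonneg hr0.le, dist_eq_norm, norm_sub_sq_real, hx, hx₀]
    constructor <;> intro h <;> linarith
  set K : Set E := {y | (1 - r ^ 2 / 2) * ‖y‖ < inner ℝ y (x₀ : E)} with hK
  have hKconv : Convex ℝ K := by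
    rw [convex_iff_forall_pos]
    intro y hy z hz a b ha hb _
    simp only [hK, Set.mem_ofPred_eq] at hy hz ⊢
    have hnorm : ‖a • y + b • z‖ ≤ a * ‖y‖ + b * ‖z‖ := by
      simpa [norm_smul, abs_of_pos ha, abs_of_pos hb] using norm_add_le (a • y) (b • z)
    rw [inner_add_left, real_inner_smul_left, real_inner_smul_left]
    have hc := mul_le_mul_of_nonneg_left hnorm (by linarith : (0 : ℝ) ≤ 1 - r ^ 2 / 2)
    have h1 := mul_lt_mul_of_pos_left hy ha
    have h2 := mul_lt_mul_of_pos_left hz hb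
    linarith
  have hKne (y : E) (hy : y ∈ K) : ‖y‖ ≠ 0 := by
    intro h
    simp [hK, norm_eq_zero.mp h] at hy
  have himage : (Subtype.val '' {x : Metric.sphere (0 : E) 1 | dist x x₀ < r}) =
      (fun y : E => ‖y‖⁻¹ • y) '' K := by
    ext x
    constructor
    · rintro ⟨x, hx, rfl⟩
      have hx1 : ‖(x : E)‖ = 1 := norm_eq_of_mem_sphere x
      refine ⟨x, ?_, by simp [hx1]⟩
      simpa only [hK, Set.mem_ofPred_eq, hx1, mul_one] using (key x hx1).mp hx
    · rintro ⟨y, hy, rfl⟩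
      have hy0 := hKne y hy
      have hy1 : ‖‖y‖⁻¹ • y‖ = 1 := by
        rw [norm_smul, norm_inv, norm_norm, inv_mul_cancel₀ hy0]
      refine ⟨⟨‖y‖⁻¹ • y, by simpa using hy1⟩, (key _ hy1).mpr ?_, rfl⟩
      rw [real_inner_smul_left, inv_mul_eq_div, lt_div_iff₀ (lt_of_le_of_ne' (norm_nonneg y) hy0)]
      exact hy
  rw [← Topology.IsInducing.subtypeVal.isPreconnected_image, himage]
  exact hKconv.isPreconnected.image _
    ((continuousOn_id.norm.inv₀ hKne).smul continuousOn_id)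

/-- Let `n ≥ 1` and let `f : Sⁿ → Sⁿ⁺¹` be a continuous map whose set of
injectivity contains the closed metric ball `D` of radius `0 < r < 1` about `x₀ ∈ Sⁿ`.
If `C` and `C'` are connected components of `Sⁿ⁺¹ \ f(Sⁿ)` whose closures intersect
`f(D°)`, then `C` and `C'` lie in the same connected component of `Sⁿ⁺¹ \ f(Sⁿ \ D°)`. -/
theorem components_meeting_disk_interior_lie_in_same_component
    (n : ℕ) (hn : 1 ≤ n)
    (f : (Metric.sphere (0 : EuclideanSpace ℝ (Fin (n + 1))) 1) →
         (Metric.sphere (0 : EuclideanSpace ℝ (Fin (n + 2))) 1))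
    (hf : Continuous f)
    (x₀ : Metric.sphere (0 : EuclideanSpace ℝ (Fin (n + 1))) 1)
    (r : ℝ) (hr0 : 0 < r) (hr1 : r < 1)
    (hinj : ∀ p, dist p x₀ ≤ r → ∀ q, f q = f p → q = p)
    (C C' : Set (Metric.sphere (0 : EuclideanSpace ℝ (Fin (n + 2))) 1))
    (hC : IsConnCompIn (Set.range f)ᶜ C)
    (hC' : IsConnCompIn (Set.range f)ᶜ C')
    (hCcl : (closure C ∩ f '' {x | dist x x₀ < r}).Nonempty)
    (hC'cl : (closure C' ∩ f '' {x | dist x x₀ < r}).Nonempty) :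
    ∃ x ∈ (f '' {x | r ≤ dist x x₀})ᶜ,
      C ⊆ connectedComponentIn (f '' {x | r ≤ dist x x₀})ᶜ x ∧
      C' ⊆ connectedComponentIn (f '' {x | r ≤ dist x x₀})ᶜ x := by
  set S := (f '' {x | r ≤ dist x x₀})ᶜ
  set U := f '' {x | dist x x₀ < r}
  have hUconn : IsPreconnected U :=
    (isPreconnected_ball_unitSphere x₀ hr0 (by nlinarith)).image f hf.continuousOn
  have hUS : U ⊆ S := by
    rintro _ ⟨p, hp, rfl⟩ ⟨q, hq, hqp⟩
    have hp' : dist p x₀ < r := hp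
    have hq' : r ≤ dist q x₀ := hq
    rw [hinj p hp'.le q hqp] at hq'
    exact hq'.not_gt hp'
  have hx₀U : f x₀ ∈ U := ⟨x₀, by simpa using hr0, rfl⟩
  have key {A : Set _} (hA : IsConnCompIn (Set.range f)ᶜ A) (hAcl : (closure A ∩ U).Nonempty) :
      A ⊆ connectedComponentIn S (f x₀) := by
    obtain ⟨a, -, rfl⟩ := hA
    have hAS := (connectedComponentIn_subset (Set.range f)ᶜ a).trans
      (Set.compl_subset_compl.mpr (Set.image_subset_range f {x | r ≤ dist x x₀}))
    exact Set.subset_union_left.trans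
      ((isPreconnected_connectedComponentIn.union_of_closure_inter_nonempty hUconn
        hAcl).subset_connectedComponentIn (Or.inr hx₀U) (Set.union_subset hAS hUS))
  exact ⟨f x₀, hUS hx₀U, key hC hCcl, key hC' hC'cl⟩
end
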